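/- The partial order of the Solovay degrees of computably enumerable reals and the partial order of the K-degrees of computably enumerable reals are not elementarily equivalent: the Solovay degrees of c.e. reals contain a minimal pair, while the K-degrees of c.e. reals do not. -/

import Mathlib

open Part Filter

open scoped Classical

namespace KPaper

/-- Binary strings. -/
abbrev Str := List Bool

/-! ### Oracle (Turing) reducibility -/

/-- The functions `ℕ →. ℕ` that are partial recursive relative to an oracle `O : ℕ →. ℕ`.
This mirrors Mathlib's `Nat.Partrec`, with an extra base case for the oracle. -/
inductive RecursiveIn (O : ℕ →. ℕ) : (ℕ →. ℕ) → Prop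
  | oracle : RecursiveIn O O
  | zero : RecursiveIn O (pure 0)
  | succ : RecursiveIn O ↑Nat.succ
  | left : RecursiveIn O ↑fun n : ℕ => n.unpair.1
  | right : RecursiveIn O ↑fun n : ℕ => n.unpair.2
  | pair {f g} : RecursiveIn O f → RecursiveIn O g →
      RecursiveIn O fun n => Nat.pair <$> f n <*> g n
  | comp {f g} : RecursiveIn O f → RecursiveIn O g → RecursiveIn O fun n => g n >>= f
  | prec {f g} : RecursiveIn O f → RecursiveIn O g → RecursiveIn O (Nat.unpaired fun a n =>
      n.rec (f a) fun y IH => do let i ← IH; g (Nat.pair a (Nat.pair y i)))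
  | rfind {f} : RecursiveIn O f →
      RecursiveIn O fun a => Nat.rfind fun n => (fun m => m = 0) <$> f (Nat.pair a n)

/-- The characteristic (partial) function of a set of naturals, used as a Turing oracle. -/
noncomputable def chi (A : Set ℕ) : ℕ →. ℕ := fun n => Part.some (if n ∈ A then 1 else 0)

/-- The characteristic function of an infinite binary sequence, used as a Turing oracle. -/
def chiSeq (X : ℕ → Bool) : ℕ →. ℕ := fun n => Part.some (cond (X n) 1 0)

/-- `A` is Turing reducible to `B`. -/
noncomputable def TuringLeSet (A B : Set ℕ) : Prop := RecursiveIn (chi B) (chi A)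

/-- `A` is Turing equivalent to `B`. -/
noncomputable def TuringEquivSet (A B : Set ℕ) : Prop := TuringLeSet A B ∧ TuringLeSet B A

/-- Turing equivalence between a set and an infinite binary sequence. -/
noncomputable def TuringEquivSetSeq (A : Set ℕ) (X : ℕ → Bool) : Prop :=
  RecursiveIn (chiSeq X) (chi A) ∧ RecursiveIn (chi A) (chiSeq X)

/-- The halting problem `∅'`. -/
def haltingSet : Set ℕ := {n | ((Denumerable.ofNat Nat.Partrec.Code n).eval n).Dom}

/-- A set of naturals is computably enumerable iff it is the domain of a
partial computable function. -/
def CESet (A : Set ℕ) : Prop := ∃ f : ℕ →. ℕ, Nat.Partrec f ∧ ∀ n, n ∈ A ↔ (f n).Dom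

/-! ### Machines and Kolmogorov complexity -/

/-- A (plain) machine is a partial computable map from binary strings to binary strings. -/
def PlainMachine (M : Str →. Str) : Prop := Partrec M

/-- A prefix-free machine: a partial computable map on binary strings whose
domain is an antichain under the prefix relation. -/
def PFMachine (M : Str →. Str) : Prop :=
  Partrec M ∧ ∀ ρ₁ ρ₂ : Str, (M ρ₁).Dom → (M ρ₂).Dom → ρ₁ <+: ρ₂ → ρ₁ = ρ₂

/-- The Kolmogorov complexity of a string `σ` with respect to a machine `M`:
the least length of an `M`-description of `σ` (`⊤` if there is none). -/
noncomputable def KC (M : Str →. Str) (σ : Str) : ℕ∞ :=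
  ⨅ ρ : {ρ : Str // σ ∈ M ρ}, ((ρ : Str).length : ℕ∞)

/-- An optimal prefix-free machine: a prefix-free machine whose associated complexity
is minimal, up to an additive constant, among all prefix-free machines. -/
def OptimalPF (U : Str →. Str) : Prop :=
  PFMachine U ∧ ∀ M : Str →. Str, PFMachine M → ∃ c : ℕ, ∀ σ : Str, KC U σ ≤ KC M σ + c

/-- An optimal plain machine. -/
def OptimalPlain (V : Str →. Str) : Prop :=
  PlainMachine V ∧ ∀ M : Str →. Str, PlainMachine M → ∃ c : ℕ, ∀ σ : Str, KC V σ ≤ KC M σ + c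

/-! ### Initial segments -/

/-- The first `n` bits of the characteristic sequence of a set of naturals. -/
noncomputable def restrSet (A : Set ℕ) (n : ℕ) : Str :=
  (List.range n).map fun i => decide (i ∈ A)

/-- The first `n` bits of an infinite binary sequence. -/
def restrSeq (X : ℕ → Bool) (n : ℕ) : Str := (List.range n).map X

/-- The string `0^n`; `K(n)` is identified with `K(0^n)`. -/
def zeroStr (n : ℕ) : Str := List.replicate n false

/-! ### `≤_K`, `<_K`, `K`-triviality (and the `≤_C` analogues) -/

def KLeSet (U : Str →. Str) (A B : Set ℕ) : Prop :=
  ∃ c : ℕ, ∀ n, KC U (restrSet A n) ≤ KC U (restrSet B n) + c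

def KLtSet (U : Str →. Str) (A B : Set ℕ) : Prop := KLeSet U A B ∧ ¬ KLeSet U B A

def KTrivialSet (U : Str →. Str) (A : Set ℕ) : Prop :=
  ∃ c : ℕ, ∀ n, KC U (restrSet A n) ≤ KC U (zeroStr n) + c

def KLeSeq (U : Str →. Str) (X Y : ℕ → Bool) : Prop :=
  ∃ c : ℕ, ∀ n, KC U (restrSeq X n) ≤ KC U (restrSeq Y n) + c

def KLtSeq (U : Str →. Str) (X Y : ℕ → Bool) : Prop := KLeSeq U X Y ∧ ¬ KLeSeq U Y X

def KTrivialSeq (U : Str →. Str) (X : ℕ → Bool) : Prop :=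
  ∃ c : ℕ, ∀ n, KC U (restrSeq X n) ≤ KC U (zeroStr n) + c

/-! ### Computably enumerable reals -/

/-- The real number in `[0,1]` whose binary expansion is the sequence `X`. -/
noncomputable def realOfSeq (X : ℕ → Bool) : ℝ := ∑' i : ℕ, cond (X i) ((2 : ℝ) ^ (i + 1))⁻¹ 0

/-- `X` (identified with the real it is the binary expansion of) is a computably
enumerable real: it is the limit of a nondecreasing computable sequence of
(dyadic) rationals. -/
def CEReal (X : ℕ → Bool) : Prop :=
  ∃ f : ℕ → ℤ, Computable f ∧
    (∀ s, (f s : ℝ) / 2 ^ s ≤ (f (s + 1) : ℝ) / 2 ^ (s + 1)) ∧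
    Tendsto (fun s => (f s : ℝ) / 2 ^ s) atTop (nhds (realOfSeq X))

/-- The characteristic sequence of a set of naturals. -/
noncomputable def seqOfSet (A : Set ℕ) : ℕ → Bool := fun i => decide (i ∈ A)

/-! ### Solovay reducibility -/

/-- Solovay reducibility on c.e. reals: `X ≤_S Y` iff there are nondecreasing computable
rational approximations to `X` and `Y` and a constant `c` such that at each stage the
distance to `X` is bounded by `c` times the distance to `Y`. -/
def SolovayLe (X Y : ℕ → Bool) : Prop :=
  ∃ (c : ℕ) (f g : ℕ → ℤ), Computable f ∧ Computable g ∧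
    (∀ s, (f s : ℝ) / 2 ^ s ≤ (f (s + 1) : ℝ) / 2 ^ (s + 1)) ∧
    (∀ s, (g s : ℝ) / 2 ^ s ≤ (g (s + 1) : ℝ) / 2 ^ (s + 1)) ∧
    Tendsto (fun s => (f s : ℝ) / 2 ^ s) atTop (nhds (realOfSeq X)) ∧
    Tendsto (fun s => (g s : ℝ) / 2 ^ s) atTop (nhds (realOfSeq Y)) ∧
    ∀ s, realOfSeq X - (f s : ℝ) / 2 ^ s ≤ (c : ℝ) * (realOfSeq Y - (g s : ℝ) / 2 ^ s)


/-- `X` lies in the least Solovay degree of c.e. reals (it is Solovay reducible to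
every c.e. real). -/
def SolovayLeastSeq (X : ℕ → Bool) : Prop := ∀ Y : ℕ → Bool, CEReal Y → SolovayLe X Y

attribute [fun_prop] Computable

section Toolkit
variable {α β γ σ τ: Type*} [Primcodable α] [Primcodable β] [Primcodable γ] [Primcodable σ] [Primcodable τ]

@[fun_prop] theorem cid : Computable (fun a : α => a) := Computable.id
@[fun_prop] theorem cconst (b : β) : Computable (fun _ : α => b) := Computable.const b
@[fun_prop] theorem ccomp {f : β → γ} {g : α → β} (hf : Computable f) (hg : Computable g) : Computable (fun a => f (g a)) := hf.comp hg
@[fun_prop] theorem cfst {f : α → β × γ} (hf : Computable f) : Computable (fun a => (f a).1) := Computable.fst.comp hf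
@[fun_prop] theorem csnd {f : α → β × γ} (hf : Computable f) : Computable (fun a => (f a).2) := Computable.snd.comp hf
@[fun_prop] theorem cpair {f : α → β} {g : α → γ} (hf : Computable f) (hg : Computable g) : Computable (fun a => (f a, g a)) := hf.pair hg
theorem cbin {f : α → β} {g : α → γ} {h : β → γ → σ} (hh : Primrec₂ h) (hf : Computable f) (hg : Computable g) :
    Computable (fun a => h (f a) (g a)) := hh.to_comp.comp hf hg
@[fun_prop] theorem cadd {f g : α → ℕ} (hf : Computable f) (hg : Computable g) : Computable (fun a => f a + g a) := cbin Primrec.nat_add hf hg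
@[fun_prop] theorem csub {f g : α → ℕ} (hf : Computable f) (hg : Computable g) : Computable (fun a => f a - g a) := cbin Primrec.nat_sub hf hg
@[fun_prop] theorem cmul {f g : α → ℕ} (hf : Computable f) (hg : Computable g) : Computable (fun a => f a * g a) := cbin Primrec.nat_mul hf hg
@[fun_prop] theorem cdiv {f g : α → ℕ} (hf : Computable f) (hg : Computable g) : Computable (fun a => f a / g a) := cbin Primrec.nat_div hf hg
@[fun_prop] theorem cmod {f g : α → ℕ} (hf : Computable f) (hg : Computable g) : Computable (fun a => f a % g a) := cbin Primrec.nat_mod hf hg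
@[fun_prop] theorem cmin {f g : α → ℕ} (hf : Computable f) (hg : Computable g) : Computable (fun a => min (f a) (g a)) := cbin Primrec.nat_min hf hg
@[fun_prop] theorem cmax {f g : α → ℕ} (hf : Computable f) (hg : Computable g) : Computable (fun a => max (f a) (g a)) := cbin Primrec.nat_max hf hg
@[fun_prop] theorem cnpair {f g : α → ℕ} (hf : Computable f) (hg : Computable g) : Computable (fun a => Nat.pair (f a) (g a)) := cbin Primrec₂.natPair hf hg
@[fun_prop] theorem cunpair {f : α → ℕ} (hf : Computable f) : Computable (fun a => Nat.unpair (f a)) := Primrec.unpair.to_comp.comp hf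
theorem cnrec {f : α → ℕ} {g : α → σ} {h : α → ℕ → σ → σ} (hf : Computable f) (hg : Computable g)
    (hh : Computable (fun p : α × ℕ × σ => h p.1 p.2.1 p.2.2)) :
    Computable (fun a => Nat.rec (motive := fun _ => σ) (g a) (fun y IH => h a y IH) (f a)) :=
  Computable.nat_rec (h := fun a p => h a p.1 p.2) hf hg hh
@[fun_prop] theorem cpow {f g : α → ℕ} (hf : Computable f) (hg : Computable g) : Computable (fun a => f a ^ g a) := by
  have := cnrec (f := g) (g := fun _ => 1) (h := fun a _ r => r * f a) hg (by fun_prop) (by fun_prop)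
  refine this.of_eq fun a => ?_
  induction g a with
  | zero => rfl
  | succ n ih => simp only [ih, pow_succ]
@[fun_prop] theorem clength {f : α → List β} (hf : Computable f) : Computable (fun a => (f a).length) := Computable.list_length.comp hf
@[fun_prop] theorem cappend {f g : α → List β} (hf : Computable f) (hg : Computable g) : Computable (fun a => f a ++ g a) := cbin Primrec.list_append hf hg
@[fun_prop] theorem ccons {f : α → β} {g : α → List β} (hf : Computable f) (hg : Computable g) : Computable (fun a => f a :: g a) := cbin Primrec.list_cons hf hg
@[fun_prop] theorem ctake {f : α → ℕ} {g : α → List β} (hf : Computable f) (hg : Computable g) : Computable (fun a => (g a).take (f a)) := cbin Primrec.list_take hf hg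
@[fun_prop] theorem cdrop {f : α → ℕ} {g : α → List β} (hf : Computable f) (hg : Computable g) : Computable (fun a => (g a).drop (f a)) := cbin Primrec.list_drop hf hg
@[fun_prop] theorem cgetD {f : α → ℕ} {g : α → List β} (d : β) (hf : Computable f) (hg : Computable g) : Computable (fun a => (g a).getD (f a) d) :=
  cbin (h := fun (l : List β) n => l.getD n d) (Primrec.list_getD d) hg hf
@[fun_prop] theorem cencode {f : α → β} (hf : Computable f) : Computable (fun a => Encodable.encode (f a)) := Computable.encode.comp hf
@[fun_prop] theorem cdecode {f : α → ℕ} (hf : Computable f) : Computable (fun a => (Encodable.decode (f a) : Option β)) := Computable.decode.comp hf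
@[fun_prop] theorem cofNat {β} [Denumerable β] {f : α → ℕ} (hf : Computable f) : Computable (fun a => (Denumerable.ofNat β (f a))) := (Computable.ofNat β).comp hf
@[fun_prop] theorem csome {f : α → β} (hf : Computable f) : Computable (fun a => Option.some (f a)) := Computable.option_some.comp hf
@[fun_prop] theorem cgetDo {f : α → Option β} {g : α → β} (hf : Computable f) (hg : Computable g) : Computable (fun a => (f a).getD (g a)) := Computable.option_getD hf hg
@[fun_prop] theorem cisSome {f : α → Option β} (hf : Computable f) : Computable (fun a => (f a).isSome) := Primrec.option_isSome.to_comp.comp hf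
@[fun_prop] theorem crepl {f : α → ℕ} (hf : Computable f) (b : β) : Computable (fun a => List.replicate (f a) b) := by
  have := cnrec (f := f) (g := fun _ => []) (h := fun a _ r => b :: r) hf (by fun_prop) (by fun_prop)
  refine this.of_eq fun a => ?_
  induction f a with
  | zero => rfl
  | succ n ih => simp only [ih, List.replicate_succ]
@[fun_prop] theorem czeroStr {f : α → ℕ} (hf : Computable f) : Computable (fun a => zeroStr (f a)) := by
  unfold zeroStr; fun_prop
@[fun_prop] theorem crangeMap {f : α → ℕ} {g : α → ℕ → β} (hf : Computable f) (hg : Computable (fun p : α × ℕ => g p.1 p.2)) :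
    Computable (fun a => (List.range (f a)).map (fun i => g a i)) := by
  have := cnrec (f := f) (g := fun _ => []) (h := fun a n r => r ++ [g a n]) hf (by fun_prop) (by fun_prop)
  refine this.of_eq fun a => ?_
  induction f a with
  | zero => rfl
  | succ n ih => simp only [ih, List.range_succ, List.map_append, List.map_cons, List.map_nil]
@[fun_prop] theorem crestr {f : α → ℕ} {g : α → ℕ → Bool} (hf : Computable f) (hg : Computable (fun p : α × ℕ => g p.1 p.2)) :
    Computable (fun a => restrSeq (fun i => g a i) (f a)) := by
  unfold restrSeq; fun_prop

/-! computable predicates -/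
@[fun_prop] def CP (p : α → Prop) : Prop := ∃ b : α → Bool, Computable b ∧ ∀ a, p a ↔ b a = true
@[fun_prop] theorem CP.comp {p : β → Prop} {g : α → β} (hp : CP p) (hg : Computable g) : CP (fun a => p (g a)) := by
  obtain ⟨b, hb, h⟩ := hp
  exact ⟨fun a => b (g a), hb.comp hg, fun a => h _⟩
@[fun_prop] theorem CP.const (p : Prop) : CP (fun _ : α => p) := ⟨fun _ => decide p, by fun_prop, by simp⟩
@[fun_prop] theorem cand {f g : α → Bool} (hf : Computable f) (hg : Computable g) : Computable (fun a => f a && g a) := cbin Primrec.and hf hg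
@[fun_prop] theorem cor {f g : α → Bool} (hf : Computable f) (hg : Computable g) : Computable (fun a => f a || g a) := cbin Primrec.or hf hg
@[fun_prop] theorem cnot {f : α → Bool} (hf : Computable f) : Computable (fun a => !(f a)) := Primrec.not.to_comp.comp hf
@[fun_prop] theorem CP.and {p q : α → Prop} (hp : CP p) (hq : CP q) : CP (fun a => p a ∧ q a) := by
  obtain ⟨b, hb, h⟩ := hp
  obtain ⟨b', hb', h'⟩ := hq
  exact ⟨fun a => b a && b' a, by fun_prop, fun a => by simp [h, h']⟩
@[fun_prop] theorem CP.or {p q : α → Prop} (hp : CP p) (hq : CP q) : CP (fun a => p a ∨ q a) := by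
  obtain ⟨b, hb, h⟩ := hp
  obtain ⟨b', hb', h'⟩ := hq
  exact ⟨fun a => b a || b' a, by fun_prop, fun a => by simp [h, h']⟩
@[fun_prop] theorem CP.not {p : α → Prop} (hp : CP p) : CP (fun a => ¬ p a) := by
  obtain ⟨b, hb, h⟩ := hp
  exact ⟨fun a => !(b a), by fun_prop, fun a => by simp [h]⟩
theorem CP.of_iff {p q : α → Prop} (hp : CP p) (h : ∀ a, q a ↔ p a) : CP q := by
  have : q = p := by funext a; exact propext (h a)
  rwa [this]
theorem CP.imp {p q : α → Prop} (hp : CP p) (hq : CP q) : CP (fun a => p a → q a) :=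
  CP.of_iff (p := fun a => ¬ p a ∨ q a) (by fun_prop) fun a => by tauto
@[fun_prop] theorem CP.le {f g : α → ℕ} (hf : Computable f) (hg : Computable g) : CP (fun a => f a ≤ g a) :=
  ⟨fun a => decide (f a ≤ g a), (cbin (PrimrecRel.decide Primrec.nat_le) hf hg).of_eq (by simp), by simp⟩
@[fun_prop] theorem CP.lt {f g : α → ℕ} (hf : Computable f) (hg : Computable g) : CP (fun a => f a < g a) :=
  ⟨fun a => decide (f a < g a), (cbin (PrimrecRel.decide Primrec.nat_lt) hf hg).of_eq (by simp), by simp⟩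
@[fun_prop] theorem CP.eq {f g : α → β} (hf : Computable f) (hg : Computable g) : CP (fun a => f a = g a) :=
  ⟨fun a => decide (f a = g a), (cbin (PrimrecRel.decide Primrec.eq) hf hg).of_eq (by simp), by simp⟩
@[fun_prop] theorem CP.ne {f g : α → β} (hf : Computable f) (hg : Computable g) : CP (fun a => f a ≠ g a) :=
  (CP.eq hf hg).not
@[fun_prop] theorem cite {p : α → Prop} {f g : α → β} [∀ a, Decidable (p a)] (hp : CP p) (hf : Computable f) (hg : Computable g) :
   Computable (fun a => if p a then f a else g a) := by
  obtain ⟨b, hb, h⟩ := hp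
  refine (Computable.cond hb hf hg).of_eq fun a => ?_
  by_cases hp : p a
  · simp [hp, (h a).1 hp]
  · have : b a = false := by have := (h a).not.1 hp; simpa using this
    simp [hp, this]
@[fun_prop] theorem cdecide {p : α → Prop} [∀ a, Decidable (p a)] (hp : CP p) : Computable (fun a => decide (p a)) := by
  obtain ⟨b, hb, h⟩ := hp
  refine hb.of_eq fun a => ?_
  by_cases hp : p a
  · simp [hp, (h a).1 hp]
  · have : b a = false := by have := (h a).not.1 hp; simpa using this
    simp [hp, this]

/-- least `i < n` with `p i`, or `n` if there is none -/
noncomputable def mu : ℕ → (ℕ → Prop) → ℕ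
  | 0, _ => 0
  | n+1, p => if mu n p < n then mu n p else if p n then n else n+1
theorem mu_spec (n : ℕ) (p : ℕ → Prop) : (mu n p < n ∧ p (mu n p) ∧ ∀ i < mu n p, ¬ p i) ∨ (mu n p = n ∧ ∀ i < n, ¬ p i) := by
  induction n with
  | zero => right; simp [mu]
  | succ n ih =>
    rcases ih with ⟨h1, h2, h3⟩ | ⟨h1, h2⟩
    · left
      simp only [mu, h1, if_true]
      exact ⟨by omega, h2, h3⟩
    · by_cases hp : p n
      · left
        have : mu (n+1) p = n := by simp [mu, h1, hp]
        rw [this]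
        exact ⟨by omega, hp, h2⟩
      · right
        have : mu (n+1) p = n+1 := by simp [mu, h1, hp]
        refine ⟨this, fun i hi => ?_⟩
        rcases Nat.lt_succ_iff_lt_or_eq.1 hi with h | rfl
        · exact h2 i h
        · exact hp
theorem mu_le (n p) : mu n p ≤ n := by rcases mu_spec n p with h | h <;> omega
theorem mu_lt_iff (n p) : mu n p < n ↔ ∃ i < n, p i := by
  rcases mu_spec n p with ⟨h1, h2, h3⟩ | ⟨h1, h2⟩
  · exact ⟨fun _ => ⟨_, h1, h2⟩, fun _ => h1⟩
  · rw [h1]; constructor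
    · intro h; omega
    · rintro ⟨i, hi, hp⟩; exact absurd hp (h2 i hi)
theorem mu_congr {n : ℕ} {p q : ℕ → Prop} (h : ∀ i < n, p i ↔ q i) : mu n p = mu n q := by
  induction n with
  | zero => rfl
  | succ n ih =>
    have := ih (fun i hi => h i (by omega))
    simp only [mu, this, h n (by omega)]
@[fun_prop] theorem cmu {n : α → ℕ} {p : α → ℕ → Prop} (hn : Computable n) (hp : CP (fun q : α × ℕ => p q.1 q.2)) :
    Computable (fun a => mu (n a) (fun i => p a i)) := by
  have := cnrec (f := n) (g := fun _ => 0) (h := fun a n r => if r < n then r else if p a n then n else n+1) hn (by fun_prop) (by fun_prop)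
  refine this.of_eq fun a => ?_
  induction n a with
  | zero => rfl
  | succ n ih => simp only [ih, mu]

def bAll (n : ℕ) (p : ℕ → Prop) : Prop := ∀ i < n, p i
def bEx (n : ℕ) (p : ℕ → Prop) : Prop := ∃ i < n, p i
@[fun_prop] theorem CP.bEx {n : α → ℕ} {p : α → ℕ → Prop} (hn : Computable n) (hp : CP (fun q : α × ℕ => p q.1 q.2)) :
    CP (fun a => bEx (n a) (fun i => p a i)) :=
  CP.of_iff (p := fun a => mu (n a) (fun i => p a i) < n a) (by fun_prop) fun a => (mu_lt_iff _ _).symm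
@[fun_prop] theorem CP.bAll {n : α → ℕ} {p : α → ℕ → Prop} (hn : Computable n) (hp : CP (fun q : α × ℕ => p q.1 q.2)) :
    CP (fun a => bAll (n a) (fun i => p a i)) :=
  CP.of_iff (p := fun a => ¬ KPaper.bEx (n a) (fun i => ¬ p a i)) (by fun_prop) fun a => by
    simp [KPaper.bAll, KPaper.bEx]

@[fun_prop] theorem csum {n : α → ℕ} {f : α → ℕ → ℕ} (hn : Computable n) (hf : Computable (fun q : α × ℕ => f q.1 q.2)) :
    Computable (fun a => ∑ i ∈ Finset.range (n a), f a i) := by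
  have := cnrec (f := n) (g := fun _ => 0) (h := fun a n r => r + f a n) hn (by fun_prop) (by fun_prop)
  refine this.of_eq fun a => ?_
  induction n a with
  | zero => rfl
  | succ n ih => simp only [ih, Finset.sum_range_succ]

/-! computable dyadic nonnegative reals -/
@[fun_prop] def CR (x : α → ℝ) : Prop := ∃ d : α → ℕ × ℕ, Computable d ∧ ∀ a, x a = (d a).1 / 2 ^ (d a).2
@[fun_prop] theorem CR.comp {x : β → ℝ} {g : α → β} (hx : CR x) (hg : Computable g) : CR (fun a => x (g a)) := by
  obtain ⟨b, hb, h⟩ := hx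
  exact ⟨fun a => b (g a), hb.comp hg, fun a => h _⟩
@[fun_prop] theorem CR.add {x y : α → ℝ} (hx : CR x) (hy : CR y) : CR (fun a => x a + y a) := by
  obtain ⟨b, hb, h⟩ := hx
  obtain ⟨b', hb', h'⟩ := hy
  refine ⟨fun a => ((b a).1 * 2 ^ (b' a).2 + (b' a).1 * 2 ^ (b a).2, (b a).2 + (b' a).2), by fun_prop, fun a => ?_⟩
  simp only [h, h']; push_cast; rw [pow_add]; field_simp
@[fun_prop] theorem CR.mul {x y : α → ℝ} (hx : CR x) (hy : CR y) : CR (fun a => x a * y a) := by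
  obtain ⟨b, hb, h⟩ := hx
  obtain ⟨b', hb', h'⟩ := hy
  refine ⟨fun a => ((b a).1 * (b' a).1, (b a).2 + (b' a).2), by fun_prop, fun a => ?_⟩
  simp only [h, h']; push_cast; rw [pow_add]; field_simp
@[fun_prop] theorem CR.cast {f : α → ℕ} (hf : Computable f) : CR (fun a => (f a : ℝ)) :=
  ⟨fun a => (f a, 0), by fun_prop, by simp⟩
@[fun_prop] theorem CR.half {f : α → ℕ} (hf : Computable f) : CR (fun a => (1/2 : ℝ) ^ (f a)) :=
  ⟨fun a => (1, f a), by fun_prop, by simp⟩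
@[fun_prop] theorem CR.two {f : α → ℕ} (hf : Computable f) : CR (fun a => (2 : ℝ) ^ (f a)) :=
  ⟨fun a => (2 ^ f a, 0), by fun_prop, by simp⟩
@[fun_prop] theorem CR.four {f : α → ℕ} (hf : Computable f) : CR (fun a => (4 : ℝ) ^ (f a)) :=
  ⟨fun a => (4 ^ f a, 0), by fun_prop, by simp⟩
class Dy (c : ℝ) : Prop where
  out : ∃ d : ℕ × ℕ, c = d.1 / 2 ^ d.2
@[fun_prop] theorem CR.const (c : ℝ) [h : Dy c] : CR (fun _ : α => c) := by
  obtain ⟨d, hd⟩ := h.out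
  exact ⟨fun _ => d, by fun_prop, fun _ => hd⟩
instance : Dy 0 := ⟨⟨(0, 0), by simp⟩⟩
instance : Dy 1 := ⟨⟨(1, 0), by simp⟩⟩
instance : Dy 2 := ⟨⟨(2, 0), by simp⟩⟩
instance : Dy 3 := ⟨⟨(3, 0), by simp⟩⟩
instance : Dy 4 := ⟨⟨(4, 0), by simp⟩⟩
instance (n : ℕ) : Dy (n : ℝ) := ⟨⟨(n, 0), by simp⟩⟩
instance : Dy (1/2) := ⟨⟨(1, 1), by simp⟩⟩
@[fun_prop] theorem CR.ite {p : α → Prop} {f g : α → ℝ} [∀ a, Decidable (p a)] (hp : CP p) (hf : CR f) (hg : CR g) :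
   CR (fun a => if p a then f a else g a) := by
  obtain ⟨b, hb, h⟩ := hf
  obtain ⟨b', hb', h'⟩ := hg
  refine ⟨fun a => if p a then b a else b' a, by fun_prop, fun a => ?_⟩
  by_cases h0 : p a <;> simp [h0, h, h']
@[fun_prop] theorem CR.sum {n : α → ℕ} {f : α → ℕ → ℝ} (hn : Computable n) (hf : CR (fun q : α × ℕ => f q.1 q.2)) :
    CR (fun a => ∑ i ∈ Finset.range (n a), f a i) := by
  obtain ⟨b, hb, h⟩ := hf
  have h2 := cnrec (f := n) (g := fun _ => (0, 0)) (h := fun a n (r : ℕ × ℕ) => ((b (a,n)).1 * 2 ^ r.2 + r.1 * 2 ^ (b (a, n)).2, (b (a,n)).2 + r.2)) hn (by fun_prop) (by fun_prop)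
  refine ⟨_, h2, fun a => ?_⟩
  beta_reduce
  have h : ∀ a i, f a i = (b (a, i)).1 / 2 ^ (b (a, i)).2 := fun a i => h (a, i)
  induction n a with
  | zero => simp
  | succ n ih =>
    rw [Finset.sum_range_succ, ih, h a n]
    simp only
    push_cast; rw [pow_add]; field_simp; ring
@[fun_prop] theorem CP.rle {x y : α → ℝ} (hx : CR x) (hy : CR y) : CP (fun a => x a ≤ y a) := by
  obtain ⟨b, hb, h⟩ := hx
  obtain ⟨b', hb', h'⟩ := hy
  refine CP.of_iff (p := fun a => (b a).1 * 2 ^ (b' a).2 ≤ (b' a).1 * 2 ^ (b a).2) (by fun_prop) fun a => ?_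
  rw [h, h', div_le_div_iff₀ (by positivity) (by positivity)]
  exact_mod_cast Iff.rfl
@[fun_prop] theorem CP.rlt {x y : α → ℝ} (hx : CR x) (hy : CR y) : CP (fun a => x a < y a) :=
  CP.of_iff (p := fun a => ¬ (y a ≤ x a)) (by fun_prop) fun a => by simp
theorem CR.nonneg {x : α → ℝ} (hx : CR x) (a : α) : 0 ≤ x a := by
  obtain ⟨b, hb, h⟩ := hx
  rw [h]; positivity

/-! strong recursion -/
/-- truncation of a history -/
noncomputable def trunc (d : τ) (E : ℕ → τ) (t : ℕ) : ℕ → τ := fun r => if r < t then E r else d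

theorem exists_rec (d : τ) (step : β → (ℕ → τ) → ℕ → τ)
    (hs : Computable (fun p : β × List τ => step p.1 (fun r => p.2.getD r d) p.2.length)) :
    ∃ E : β → ℕ → τ, Computable (fun p : β × ℕ => E p.1 p.2) ∧ ∀ b t, E b t = step b (trunc d (E b) t) t := by
  let L : β → ℕ → List τ := fun b n => Nat.rec (motive := fun _ => List τ) [] (fun _ l => l ++ [step b (fun r => l.getD r d) l.length]) n
  let E : β → ℕ → τ := fun b t => step b (fun r => (L b t).getD r d) (L b t).length
  have hL : Computable (fun p : β × ℕ => L p.1 p.2) :=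
    cnrec (f := fun p : β × ℕ => p.2) (g := fun _ => []) (h := fun p n (l : List τ) => l ++ [step p.1 (fun r => l.getD r d) l.length]) (by fun_prop) (by fun_prop)
      (cappend (by fun_prop) (ccons (hs.comp (g := fun p : (β × ℕ) × ℕ × List τ => (p.1.1, p.2.2)) (by fun_prop)) (by fun_prop)))
  have hE : Computable (fun p : β × ℕ => E p.1 p.2) := hs.comp (g := fun p : β × ℕ => (p.1, L p.1 p.2)) (by fun_prop)
  have hLE : ∀ b n, L b n = (List.range n).map (E b) := by
    intro b n
    induction n with
    | zero => rfl
    | succ n ih =>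
      rw [List.range_succ, List.map_append, ← ih]; rfl
  refine ⟨E, hE, fun b t => ?_⟩
  have h1 : (L b t).length = t := by rw [hLE]; simp
  have h2 : (fun r => (L b t).getD r d) = trunc d (E b) t := by
    funext r
    rw [hLE, trunc]
    by_cases hr : r < t
    · simp [hr, List.getD]
    · simp [hr, List.getD]
  show step b (fun r => (L b t).getD r d) (L b t).length = _
  rw [h1, h2]

/-! integers -/
@[fun_prop] theorem ctoNat {f : α → ℤ} (hf : Computable f) : Computable (fun a => (f a).toNat) := by
  have : Computable (fun a => if Encodable.encode (f a) % 2 = 0 then Encodable.encode (f a) / 2 else 0) := by fun_prop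
  refine this.of_eq fun a => ?_
  rcases f a with n | n
  · have : Encodable.encode (Int.ofNat n) = 2 * n := rfl
    rw [this]; simp
  · have : Encodable.encode (Int.negSucc n) = 2 * n + 1 := rfl
    rw [this]; simp
@[fun_prop] theorem cofNatInt {f : α → ℕ} (hf : Computable f) : Computable (fun a => ((f a : ℕ) : ℤ)) := by
  have : Computable (fun a => Denumerable.ofNat ℤ (2 * f a)) := by fun_prop
  refine this.of_eq fun a => ?_
  have : Encodable.encode ((f a : ℕ) : ℤ) = 2 * f a := rfl
  rw [← this, Denumerable.ofNat_encode]
@[fun_prop] theorem cnegInt {f : α → ℤ} (hf : Computable f) : Computable (fun a => - f a) := by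
  have : Computable (fun a => if Encodable.encode (f a) % 2 = 0 then (if Encodable.encode (f a) / 2 = 0 then 0 else Denumerable.ofNat ℤ (Encodable.encode (f a) - 1)) 
     else Denumerable.ofNat ℤ (Encodable.encode (f a) + 1)) := by fun_prop
  refine this.of_eq fun a => ?_
  rcases f a with n | n
  · have h : Encodable.encode (Int.ofNat n) = 2 * n := rfl
    rw [h]
    rcases n with _ | n
    · simp
    · have : Encodable.encode (Int.negSucc n) = 2 * (n+1) - 1 := rfl
      rw [← this, Denumerable.ofNat_encode]
      simp [Int.negSucc_eq]
  · have h : Encodable.encode (Int.negSucc n) = 2 * n + 1 := rfl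
    have : Encodable.encode ((n+1 : ℕ) : ℤ) = 2 * n + 1 + 1 := rfl
    rw [h, ← this, Denumerable.ofNat_encode]
    simp [Int.neg_negSucc, Nat.add_mod]
end Toolkit



/-! ### value of a string -/
def val (σ : Str) : ℕ := σ.foldl (fun a b => 2 * a + cond b 1 0) 0
@[simp] theorem val_nil : val [] = 0 := rfl
theorem val_concat (σ : Str) (b : Bool) : val (σ ++ [b]) = 2 * val σ + cond b 1 0 := by
  simp [val, List.foldl_append]
theorem val_append (σ τ : Str) : val (σ ++ τ) = val σ * 2 ^ τ.length + val τ := by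
  induction τ using List.reverseRecOn with
  | nil => simp
  | append_singleton τ b ih =>
    rw [← List.append_assoc, val_concat, ih, val_concat, List.length_append, List.length_singleton, pow_succ]; ring
theorem val_lt (σ : Str) : val σ < 2 ^ σ.length := by
  induction σ using List.reverseRecOn with
  | nil => simp
  | append_singleton τ b ih =>
    rw [val_concat, List.length_append, List.length_singleton, pow_succ]
    cases b <;> simp <;> omega
theorem val_inj : ∀ (σ τ : Str), σ.length = τ.length → val σ = val τ → σ = τ := by
  intro σ
  induction σ using List.reverseRecOn with
  | nil => intro τ h _; symm; simpa using h.symm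
  | append_singleton σ b ih =>
    intro τ
    induction τ using List.reverseRecOn with
    | nil => intro h; simp at h
    | append_singleton τ b' _ =>
      intro h1 h2
      rw [val_concat, val_concat] at h2
      have hb : b = b' := by cases b <;> cases b' <;> simp at h2 ⊢ <;> omega
      subst hb
      rw [ih τ (by simpa using h1) (by omega)]
theorem exists_val (n k : ℕ) (h : k < 2 ^ n) : ∃ σ : Str, σ.length = n ∧ val σ = k := by
  induction n generalizing k with
  | zero => exact ⟨[], rfl, by simp at h; simp [h]⟩
  | succ n ih =>
    obtain ⟨σ, h1, h2⟩ := ih (k / 2) (by rw [pow_succ] at h; omega)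
    refine ⟨σ ++ [decide (k % 2 = 1)], by simp [h1], ?_⟩
    rw [val_concat, h2]
    by_cases hk : k % 2 = 1
    · simp [hk]; omega
    · simp [hk]; omega
@[fun_prop] theorem cval {α} [Primcodable α] {f : α → Str} (hf : Computable f) : Computable (fun a => val (f a)) := by
  have h : Primrec val := Primrec.list_foldl (α := Str) (σ := ℕ) (h := fun _ p => 2 * p.1 + cond p.2 1 0)
    Primrec.id (Primrec.const 0)
    (Primrec.nat_add.comp (Primrec.nat_mul.comp (Primrec.const 2) (Primrec.fst.comp Primrec.snd))
      (Primrec.cond (Primrec.snd.comp Primrec.snd) (Primrec.const 1) (Primrec.const 0)))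
  exact h.to_comp.comp hf
@[simp] theorem restrSeq_length (X : ℕ → Bool) (n : ℕ) : (restrSeq X n).length = n := by simp [restrSeq]
theorem restrSeq_succ (X : ℕ → Bool) (n : ℕ) : restrSeq X (n+1) = restrSeq X n ++ [X n] := by
  simp [restrSeq, List.range_succ]
theorem restrSeq_congr {X Y : ℕ → Bool} {n : ℕ} (h : ∀ i < n, X i = Y i) : restrSeq X n = restrSeq Y n := by
  simp only [restrSeq]; apply List.map_congr_left; intro i hi; exact h i (by simpa using hi)
theorem restrSeq_inj {X Y : ℕ → Bool} {n : ℕ} (h : restrSeq X n = restrSeq Y n) : ∀ i < n, X i = Y i := by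
  intro i hi
  have := List.map_inj_left.1 h i (by simpa using hi)
  exact this

/-! ### partial recursive search -/
noncomputable def searchPart (Q : ℕ → Prop) : Part ℕ := Nat.rfind (fun n => Part.some (decide (Q n)))
theorem partrec_search {α β} [Primcodable α] [Primcodable β] {Q : α → ℕ → Prop} (hQ : CP (fun p : α × ℕ => Q p.1 p.2))
    {g : ℕ → β} (hg : Computable g) :
    Partrec (fun a => (searchPart (Q a)).map g) := by
  have h1 : Partrec (fun a => searchPart (Q a)) := by
    refine Partrec.rfind (p := fun a n => Part.some (decide (Q a n))) ?_
    have : Computable (fun p : α × ℕ => decide (Q p.1 p.2)) := by fun_prop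
    exact this.partrec
  exact h1.map (f := fun a => searchPart (Q a)) (g := fun _ n => g n) (hg.comp Computable.snd)

theorem mem_search {β} {Q : ℕ → Prop} {g : ℕ → β} {y : β} :
    y ∈ (searchPart Q).map g ↔ ∃ n, (Q n ∧ ∀ m < n, ¬ Q m) ∧ g n = y := by
  rw [Part.mem_map_iff]
  constructor
  · rintro ⟨n, h, h2⟩
    have h := Nat.mem_rfind.1 h
    refine ⟨n, ⟨by simpa using h.1, fun m hm => by simpa using h.2 hm⟩, h2⟩
  · rintro ⟨n, ⟨h1, h3⟩, h2⟩
    refine ⟨n, Nat.mem_rfind.2 ?_, h2⟩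
    exact ⟨by simpa using h1, fun {m} hm => by simpa using h3 m hm⟩

theorem csearch {α} [Primcodable α] {Q : α → ℕ → Prop} (hQ : CP (fun p : α × ℕ => Q p.1 p.2))
    (h : ∀ a, ∃ n, Q a n) : ∃ f : α → ℕ, Computable f ∧ ∀ a, Q a (f a) := by
  refine ⟨fun a => Nat.find (h a), ?_, fun a => Nat.find_spec (h a)⟩
  refine (partrec_search hQ Computable.id).of_eq_tot fun a => ?_
  refine mem_search.2 ?_
  exact ⟨_, ⟨Nat.find_spec (h a), fun m hm => Nat.find_min (h a) hm⟩, rfl⟩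

/-! ### Kraft -/
theorem kraft (S : Finset Str) (h : ∀ a ∈ S, ∀ b ∈ S, a <+: b → a = b) :
    ∑ w ∈ S, (1/2 : ℝ) ^ w.length ≤ 1 := by
  by_cases h0 : [] ∈ S
  · have : S = {[]} := by
      ext x; constructor
      · intro hx; have := h _ h0 _ hx ⟨_, List.nil_append _⟩; simp [← this]
      · intro hx; rw [Finset.mem_singleton] at hx; rwa [hx]
    simp [this]
  · have hU : InformationTheory.UniquelyDecodable (S : Set (List Bool)) := by
      intro L1
      induction L1 with
      | nil =>
        intro L2 _ h2 he
        cases L2 with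
        | nil => rfl
        | cons b L2 =>
          exfalso
          simp at he
          exact h0 (by have := h2 b (by simp); rw [he.1] at this; exact this)
      | cons a L1 ih =>
        intro L2 h1 h2 he
        cases L2 with
        | nil =>
          exfalso
          simp at he
          exact h0 (by have := h1 a (by simp); rw [he.1] at this; exact this)
        | cons b L2 =>
          simp only [List.flatten_cons] at he
          have ha : a ∈ S := h1 a (by simp)
          have hb : b ∈ S := h2 b (by simp)
          have hab : a = b := by
            rcases List.append_eq_append_iff.1 he with ⟨c, h3, _⟩ | ⟨c, h3, _⟩
            · exact h a ha b hb ⟨c, h3.symm⟩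
            · exact (h b hb a ha ⟨c, h3.symm⟩).symm
          subst hab
          rw [ih L2 (fun w hw => h1 w (by simp [hw])) (fun w hw => h2 w (by simp [hw])) (List.append_cancel_left he)]
    have := InformationTheory.kraft_mcmillan_inequality hU
    simpa using this

theorem KC_le_iff (U : Str →. Str) (σ : Str) (d : ℕ) : KC U σ ≤ d ↔ ∃ ρ, σ ∈ U ρ ∧ ρ.length ≤ d := by
  constructor
  · intro h
    by_contra hc
    push Not at hc
    have : ((d + 1 : ℕ) : ℕ∞) ≤ KC U σ := by
      refine le_iInf fun ρ => ?_
      exact_mod_cast hc ρ.1 ρ.2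
    have h2 := this.trans h
    have : d + 1 ≤ d := by exact_mod_cast h2
    omega
  · rintro ⟨ρ, h1, h2⟩
    exact (iInf_le (fun ρ : {ρ : Str // σ ∈ U ρ} => ((ρ : Str).length : ℕ∞)) ⟨ρ, h1⟩).trans (by exact_mod_cast h2)

/-- weight of the `t`-th request -/
noncomputable def rw_ (ok : ℕ → Prop) (d : ℕ → ℕ) (t : ℕ) : ℝ := if ok t then (1/2)^(d t) else 0
theorem rw_nonneg (ok d t) : 0 ≤ rw_ ok d t := by unfold rw_; split_ifs <;> positivity

theorem kc_theorem {U : Str →. Str} (hU : OptimalPF U) (ok : ℕ → Prop) (hok : CP ok) (d : ℕ → ℕ) (hd : Computable d)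
    (σ : ℕ → Str) (hσ : Computable σ) (hsum : ∀ n, ∑ t ∈ Finset.range n, rw_ ok d t ≤ 1) :
    ∃ c : ℕ, ∀ t, ok t → KC U (σ t) ≤ (d t + c : ℕ) := by
  have hw : CR (fun t => rw_ ok d t) := by unfold rw_; fun_prop
  let S : ℕ → ℝ := fun t => ∑ r ∈ Finset.range t, rw_ ok d r
  have hS : CR S := by show CR (fun t => ∑ r ∈ Finset.range t, rw_ ok d r); fun_prop
  let k : ℕ → ℕ := fun t => mu (2 ^ (d t + 1)) (fun k => S t * 2 ^ (d t + 1) ≤ k)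
  have hk : Computable k := by
    show Computable (fun t => mu (2 ^ (d t + 1)) (fun k => S t * 2 ^ (d t + 1) ≤ k)); fun_prop
  have S0 : ∀ t, 0 ≤ S t := fun t => Finset.sum_nonneg fun i _ => rw_nonneg _ _ _
  have Smono : ∀ s t, s ≤ t → S s ≤ S t := fun s t h =>
    Finset.sum_le_sum_of_subset_of_nonneg (by simpa using h) (fun i _ _ => rw_nonneg _ _ _)
  have Ssucc : ∀ t, ok t → S (t+1) = S t + (1/2)^(d t) := by
    intro t ht; simp [S, Finset.sum_range_succ, rw_, ht]
  have kspec : ∀ t, ok t → k t < 2 ^ (d t + 1) ∧ S t * 2 ^ (d t + 1) ≤ k t ∧ (k t + 1 : ℝ) ≤ S (t+1) * 2 ^ (d t + 1) := by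
    intro t ht
    have h1 : S (t+1) ≤ 1 := hsum (t+1)
    have h2 : S (t+1) * 2 ^ (d t + 1) = S t * 2 ^ (d t + 1) + 2 := by
      rw [Ssucc t ht, add_mul]; congr 1; rw [pow_succ, one_div, inv_pow]; field_simp
    have h3 : S (t+1) * 2 ^ (d t + 1) ≤ 2 ^ (d t + 1) := by
      have : (0:ℝ) < 2 ^ (d t + 1) := by positivity
      nlinarith
    have hceil : ⌈S t * 2 ^ (d t + 1)⌉₊ < 2 ^ (d t + 1) := by
      have := Nat.ceil_lt_add_one (mul_nonneg (S0 t) (by positivity : (0:ℝ) ≤ 2 ^ (d t + 1)))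
      have : (⌈S t * 2 ^ (d t + 1)⌉₊ : ℝ) < 2 ^ (d t + 1) := by linarith
      exact_mod_cast this
    rcases mu_spec (2 ^ (d t + 1)) (fun k : ℕ => S t * 2 ^ (d t + 1) ≤ k) with ⟨h5, h6, h7⟩ | ⟨_, h5⟩
    · change k t < _ at h5
      change S t * 2 ^ (d t + 1) ≤ k t at h6
      refine ⟨h5, h6, ?_⟩
      rcases Nat.eq_zero_or_pos (k t) with h0 | h0
      · rw [h0, h2]; have := mul_nonneg (S0 t) (by positivity : (0:ℝ) ≤ 2 ^ (d t + 1)); push_cast; linarith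
      · have h8 := h7 (k t - 1) (by show k t - 1 < k t; omega)
        rw [not_le, Nat.cast_sub h0] at h8
        rw [h2]; push_cast at h8; linarith
    · exact absurd (Nat.le_ceil _) (h5 _ hceil)
  let Q : Str → ℕ → Prop := fun ρ t => ok t ∧ ρ.length = d t + 1 ∧ val ρ = k t
  have hQ : CP (fun p : Str × ℕ => Q p.1 p.2) := by
    show CP (fun p : Str × ℕ => ok p.2 ∧ p.1.length = d p.2 + 1 ∧ val p.1 = k p.2); fun_prop
  let M : Str →. Str := fun ρ => (searchPart (Q ρ)).map σ
  have hM : Partrec M := partrec_search hQ hσ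
  have key : ∀ ρ₁ ρ₂ t₁ t₂, Q ρ₁ t₁ → Q ρ₂ t₂ → ρ₁ <+: ρ₂ → t₁ = t₂ := by
    rintro ρ₁ ρ₂ t₁ t₂ ⟨o1, l1, v1⟩ ⟨o2, l2, v2⟩ ⟨τ, rfl⟩
    rw [val_append, v1] at v2
    rw [List.length_append, l1] at l2
    have hτ := val_lt τ
    obtain ⟨a1, a2, a3⟩ := kspec t₁ o1
    obtain ⟨b1, b2, b3⟩ := kspec t₂ o2
    rw [← v2, ← l2, pow_add] at b2 b3
    have hτ' : (val τ : ℝ) + 1 ≤ 2 ^ τ.length := by exact_mod_cast hτ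
    push_cast at b2 b3
    have p1 : (0:ℝ) < 2 ^ (d t₁ + 1) := by positivity
    have p2 : (0:ℝ) < 2 ^ τ.length := by positivity
    by_contra hne
    rcases Nat.lt_or_gt_of_ne hne with hlt | hlt
    · -- S (t1+1) ≤ S t2
      have h5 := Smono (t₁+1) t₂ hlt
      have h6 : (k t₁ : ℝ) + 1 ≤ S t₂ * 2 ^ (d t₁ + 1) := a3.trans (by gcongr)
      have h7 : ((k t₁ : ℝ) + 1) * 2 ^ τ.length ≤ S t₂ * 2 ^ (d t₁ + 1) * 2 ^ τ.length := by gcongr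
      nlinarith
    · have h5 := Smono (t₂+1) t₁ hlt
      have h6 : S (t₂+1) * 2 ^ (d t₁ + 1) ≤ k t₁ := le_trans (by gcongr) a2
      have h7 : S (t₂+1) * 2 ^ (d t₁ + 1) * 2 ^ τ.length ≤ k t₁ * 2 ^ τ.length := by gcongr
      have : (0:ℝ) ≤ val τ := by positivity
      nlinarith
  have hPF : PFMachine M := by
    refine ⟨hM, fun ρ₁ ρ₂ h1 h2 hp => ?_⟩
    obtain ⟨y1, h1⟩ := Part.dom_iff_mem.1 h1
    obtain ⟨y2, h2⟩ := Part.dom_iff_mem.1 h2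
    obtain ⟨t1, ⟨q1, _⟩, _⟩ := mem_search.1 h1
    obtain ⟨t2, ⟨q2, _⟩, _⟩ := mem_search.1 h2
    have := key _ _ _ _ q1 q2 hp
    subst this
    exact hp.eq_of_length (q1.2.1.trans q2.2.1.symm)
  obtain ⟨c, hc⟩ := hU.2 M hPF
  refine ⟨c + 1, fun t ht => (hc _).trans ?_⟩
  have : KC M (σ t) ≤ (d t + 1 : ℕ) := by
    rw [KC_le_iff]
    obtain ⟨ρ, h1, h2⟩ := exists_val (d t + 1) (k t) (kspec t ht).1
    refine ⟨ρ, ?_, h1.le⟩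
    refine mem_search.2 ⟨t, ⟨⟨ht, h1, h2⟩, fun m hm hq => ?_⟩, rfl⟩
    have := key ρ ρ m t hq ⟨ht, h1, h2⟩ (List.prefix_refl _)
    omega
  calc KC M (σ t) + c ≤ (d t + 1 : ℕ) + c := by gcongr
    _ = (d t + (c + 1) : ℕ) := by push_cast; ring

/-- A computable enumeration of the descriptions of a machine. -/
structure UEnum (U : Str →. Str) where
  ok : ℕ → Prop
  len : ℕ → ℕ
  str : ℕ → Str
  cok : CP ok
  clen : Computable len
  cstr : Computable str
  str_le : ∀ t, ok t → (str t).length ≤ t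
  sound : ∀ t, ok t → KC U (str t) ≤ len t
  complete : ∀ σ (d : ℕ), KC U σ ≤ d → ∃ t, ok t ∧ str t = σ ∧ len t ≤ d
  kraft : ∀ n, ∑ t ∈ Finset.range n, rw_ ok len t ≤ 1

theorem exists_UEnum {U : Str →. Str} (hU : PFMachine U) : Nonempty (UEnum U) := by
  obtain ⟨c, hc⟩ := Nat.Partrec.Code.exists_code.1 hU.1
  have hmem : ∀ ρ σ, σ ∈ U ρ ↔ Encodable.encode σ ∈ c.eval (Encodable.encode ρ) := by
    intro ρ σ; rw [hc]; simp
  let ev : ℕ → ℕ → Option ℕ := fun k x => Nat.Partrec.Code.evaln k c x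
  have hev : Computable (fun p : ℕ × ℕ => ev p.1 p.2) :=
    Nat.Partrec.Code.primrec_evaln.to_comp.comp (((Computable.fst).pair (Computable.const c)).pair Computable.snd)
  let st : ℕ → ℕ → Str := fun k x => (Encodable.decode ((ev k x).getD 0) : Option Str).getD []
  have hst : Computable (fun p : ℕ × ℕ => st p.1 p.2) := by
    show Computable (fun p : ℕ × ℕ => (Encodable.decode ((ev p.1 p.2).getD 0) : Option Str).getD []); fun_prop
  let ok' : ℕ → ℕ → Prop := fun k x => (ev k x).isSome = true ∧ (st k x).length ≤ k
  have hok' : CP (fun p : ℕ × ℕ => ok' p.1 p.2) := by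
    show CP (fun p : ℕ × ℕ => (ev p.1 p.2).isSome = true ∧ (st p.1 p.2).length ≤ p.1); fun_prop
  let rho : ℕ → Str := fun t => (Encodable.decode (t.unpair).1 : Option Str).getD []
  have hrho : Computable rho := by
    show Computable (fun t => (Encodable.decode (Nat.unpair t).1 : Option Str).getD []); fun_prop
  let ok : ℕ → Prop := fun t => (Encodable.encode (rho t) = (Nat.unpair t).1 ∧ ok' (Nat.unpair t).2 (Nat.unpair t).1) ∧
    bAll (Nat.unpair t).2 (fun k => ¬ ok' k (Nat.unpair t).1)
  have hok : CP ok := by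
    show CP (fun t => (Encodable.encode (rho t) = (Nat.unpair t).1 ∧ ok' (Nat.unpair t).2 (Nat.unpair t).1) ∧
      bAll (Nat.unpair t).2 (fun k => ¬ ok' k (Nat.unpair t).1)); fun_prop
  let str : ℕ → Str := fun t => st (Nat.unpair t).2 (Nat.unpair t).1
  have hsound : ∀ t, ok t → str t ∈ U (rho t) := by
    rintro t ⟨⟨h1, h2, h3⟩, _⟩
    obtain ⟨y, hy⟩ := Option.isSome_iff_exists.1 h2
    have h4 : y ∈ c.eval (Encodable.encode (rho t)) := by
      rw [h1]; exact Nat.Partrec.Code.evaln_sound hy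
    have h5 := h4
    rw [hc] at h5
    simp only [Encodable.encodek, Part.coe_some, Part.bind_some, Part.mem_map_iff] at h5
    obtain ⟨s, hs, rfl⟩ := h5
    have : str t = s := by simp [str, st, hy]
    rw [this]; exact hs
  refine ⟨⟨ok, fun t => (rho t).length, str, hok, by fun_prop, ?_, ?_, ?_, ?_, ?_⟩⟩
  · show Computable (fun t => st (Nat.unpair t).2 (Nat.unpair t).1); fun_prop
  · rintro t ⟨⟨h1, h2, h3⟩, _⟩
    exact h3.trans (Nat.unpair_right_le t)
  · intro t ht
    rw [KC_le_iff]
    exact ⟨_, hsound t ht, le_rfl⟩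
  · intro σ d h
    obtain ⟨ρ, h1, h2⟩ := (KC_le_iff _ _ _).1 h
    rw [hmem] at h1
    obtain ⟨k, hk⟩ := Nat.Partrec.Code.evaln_complete.1 h1
    have hex : ∃ k, ok' k (Encodable.encode ρ) := by
      refine ⟨max k σ.length, ?_⟩
      have : ev (max k σ.length) (Encodable.encode ρ) = Option.some (Encodable.encode σ) := Nat.Partrec.Code.evaln_mono (le_max_left _ _) hk
      simp [ok', st, this]
    have h3 := Nat.find_spec hex
    set k0 := Nat.find hex with hk0
    have hr : rho (Nat.pair (Encodable.encode ρ) k0) = ρ := by simp [rho]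
    have hok0 : ok (Nat.pair (Encodable.encode ρ) k0) := by
      refine ⟨⟨?_, ?_⟩, ?_⟩
      · rw [hr]; simp
      · simpa using h3
      · intro k hk; simp only [Nat.unpair_pair] at hk ⊢
        exact Nat.find_min hex hk
    refine ⟨Nat.pair (Encodable.encode ρ) k0, hok0, ?_, by simpa [hr] using h2⟩
    have h5 := hsound _ hok0
    rw [hr] at h5
    exact Part.mem_unique h5 ((hmem _ _).2 h1)
  · intro n
    have hinj : ∀ t ∈ (Finset.range n).filter ok, ∀ s ∈ (Finset.range n).filter ok, rho t = rho s → t = s := by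
      intro t ht s hs h
      simp only [Finset.mem_filter] at ht hs
      obtain ⟨⟨h1, h2⟩, h3⟩ := ht.2
      obtain ⟨⟨h1', h2'⟩, h3'⟩ := hs.2
      have hx : (Nat.unpair t).1 = (Nat.unpair s).1 := by rw [← h1, ← h1', h]
      have hy : (Nat.unpair t).2 = (Nat.unpair s).2 := by
        rw [hx] at h2 h3
        rcases lt_trichotomy (Nat.unpair t).2 (Nat.unpair s).2 with h | h | h
        · exact absurd h2 (h3' _ h)
        · exact h
        · exact absurd h2' (h3 _ h)
      rw [← Nat.pair_unpair t, ← Nat.pair_unpair s, hx, hy]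
    have h1 : ∑ t ∈ Finset.range n, rw_ ok (fun t => (rho t).length) t = ∑ w ∈ ((Finset.range n).filter ok).image rho, (1/2:ℝ)^ w.length := by
      rw [Finset.sum_image hinj]
      simp only [rw_, Finset.sum_filter]
    rw [h1]
    apply KPaper.kraft
    intro a ha b hb hab
    simp only [Finset.mem_image, Finset.mem_filter] at ha hb
    obtain ⟨t, ht, rfl⟩ := ha
    obtain ⟨s, hs, rfl⟩ := hb
    exact hU.2 _ _ (Part.dom_iff_mem.2 ⟨_, hsound t ht.2⟩) (Part.dom_iff_mem.2 ⟨_, hsound s hs.2⟩) hab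


/-! ### reals and their binary expansions -/
theorem summ_real (X : ℕ → Bool) : Summable (fun i : ℕ => cond (X i) ((2 : ℝ) ^ (i + 1))⁻¹ 0) := by
  have h : Summable (fun i : ℕ => (1/2 : ℝ) ^ (i + 1)) := (summable_nat_add_iff 1).2 (summable_geometric_of_lt_one (by norm_num) (by norm_num))
  refine Summable.of_nonneg_of_le (fun i => ?_) (fun i => ?_) h
  · cases X i <;> simp
  · cases X i <;> simp
theorem partial_real (X : ℕ → Bool) (n : ℕ) : ∑ i ∈ Finset.range n, cond (X i) ((2 : ℝ) ^ (i + 1))⁻¹ 0 = val (restrSeq X n) / 2 ^ n := by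
  induction n with
  | zero => simp [restrSeq]
  | succ n ih =>
    rw [Finset.sum_range_succ, ih, restrSeq_succ, val_concat]
    cases X n
    · simp [pow_succ]; field_simp
    · simp [pow_succ]; field_simp
theorem tendsto_real (X : ℕ → Bool) : Tendsto (fun n => (val (restrSeq X n) : ℝ) / 2 ^ n) atTop (nhds (realOfSeq X)) := by
  have := (summ_real X).hasSum.tendsto_sum_nat
  simp only [partial_real] at this
  exact this
theorem val_restr_mono (X : ℕ → Bool) {m n : ℕ} (h : m ≤ n) : (val (restrSeq X m) : ℝ) / 2 ^ m ≤ (val (restrSeq X n) : ℝ) / 2 ^ n := by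
  rw [← partial_real, ← partial_real]
  refine Finset.sum_le_sum_of_subset_of_nonneg (by simpa using h) (fun i _ _ => ?_)
  cases X i <;> simp
theorem val_restr_anti (X : ℕ → Bool) {m n : ℕ} (h : m ≤ n) : (val (restrSeq X n) + 1 : ℝ) / 2 ^ n ≤ (val (restrSeq X m) + 1 : ℝ) / 2 ^ m := by
  induction n, h using Nat.le_induction with
  | base => rfl
  | succ n h ih =>
    refine le_trans ?_ ih
    rw [restrSeq_succ, val_concat, div_le_div_iff₀ (by positivity) (by positivity), pow_succ]
    have : (0:ℝ) < 2 ^ n := by positivity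
    cases X n
    · push_cast; simp; nlinarith
    · push_cast; simp; nlinarith
theorem real_lower (X : ℕ → Bool) (n : ℕ) : (val (restrSeq X n) : ℝ) / 2 ^ n ≤ realOfSeq X :=
  ge_of_tendsto (tendsto_real X) (eventually_atTop.2 ⟨n, fun _ h => val_restr_mono X h⟩)
theorem real_upper (X : ℕ → Bool) (n : ℕ) : realOfSeq X ≤ (val (restrSeq X n) + 1 : ℝ) / 2 ^ n :=
  le_of_tendsto (tendsto_real X) (eventually_atTop.2 ⟨n, fun m h => le_trans (by gcongr; linarith) (val_restr_anti X h)⟩)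
theorem real_lower_strict (X : ℕ → Bool) (n : ℕ) (h : ∃ i ≥ n, X i = true) : (val (restrSeq X n) : ℝ) / 2 ^ n < realOfSeq X := by
  obtain ⟨i, hi, h⟩ := h
  refine lt_of_lt_of_le (lt_of_le_of_lt (val_restr_mono X hi) ?_) (real_lower X (i+1))
  rw [restrSeq_succ, val_concat, h, div_lt_div_iff₀ (by positivity) (by positivity), pow_succ]
  have : (0:ℝ) < 2 ^ i := by positivity
  push_cast; simp; nlinarith
theorem real_upper_strict (X : ℕ → Bool) (n : ℕ) (h : ∃ i ≥ n, X i = false) : realOfSeq X < (val (restrSeq X n) + 1 : ℝ) / 2 ^ n := by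
  obtain ⟨i, hi, h⟩ := h
  refine lt_of_le_of_lt (real_upper X (i+1)) (lt_of_lt_of_le ?_ (val_restr_anti X hi))
  rw [restrSeq_succ, val_concat, h, div_lt_div_iff₀ (by positivity) (by positivity), pow_succ]
  have : (0:ℝ) < 2 ^ i := by positivity
  push_cast; simp; nlinarith

/-! ### consequences of the KC theorem -/
theorem KC_le_of_enum {U : Str →. Str} (E : UEnum U) {σ τ : Str} {c : ℕ}
    (h : ∀ p, E.ok p → E.str p = σ → KC U τ ≤ (E.len p + c : ℕ)) : KC U τ ≤ KC U σ + c := by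
  by_cases ht : KC U σ = ⊤
  · rw [ht]; simp
  · obtain ⟨d, hd⟩ := ENat.ne_top_iff_exists.1 ht
    obtain ⟨p, h1, h2, h3⟩ := E.complete σ d hd.symm.le
    refine (h p h1 h2).trans ?_
    rw [← hd]; push_cast; gcongr

theorem sum_half_le (n : ℕ) : ∑ t ∈ Finset.range n, (1/2 : ℝ) ^ (t + 1) ≤ 1 := by
  have : ∑ t ∈ Finset.range n, (1/2 : ℝ) ^ (t + 1) = 1 - (1/2)^n := by
    induction n with
    | zero => simp
    | succ n ih => rw [Finset.sum_range_succ, ih, pow_succ]; ring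
  rw [this]; have : (0:ℝ) < (1/2)^n := by positivity
  linarith

theorem KC_zero_pow {U : Str →. Str} (hU : OptimalPF U) : ∃ C : ℕ, ∀ n, KC U (zeroStr (4 ^ (n+1))) ≤ (n + C : ℕ) := by
  obtain ⟨c, hc⟩ := kc_theorem hU (fun _ => True) (by fun_prop) (fun t => t + 1) (by fun_prop) (fun t => zeroStr (4 ^ (t+1))) (by fun_prop)
    (fun n => by simpa [rw_] using sum_half_le n)
  exact ⟨c + 1, fun n => (hc n trivial).trans (by exact_mod_cast (by omega))⟩

theorem KC_finite {U : Str →. Str} (hU : OptimalPF U) (σ : Str) : ∃ d : ℕ, KC U σ ≤ d := by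
  obtain ⟨c, hc⟩ := kc_theorem hU (fun _ => True) (by fun_prop) (fun t => t + 1) (by fun_prop) (fun t => (Encodable.decode t : Option Str).getD []) (by fun_prop)
    (fun n => by simpa [rw_] using sum_half_le n)
  have := hc (Encodable.encode σ) trivial
  simp only [Encodable.encodek, Option.getD_some] at this
  exact ⟨_, this⟩

theorem ktrivial_of_computable {U : Str →. Str} (hU : OptimalPF U) (A : ℕ → Bool) (hA : Computable A) : KTrivialSeq U A := by
  obtain ⟨E⟩ := exists_UEnum hU.1
  have h1 := E.cok; have h2 := E.clen; have h3 := E.cstr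
  obtain ⟨c, hc⟩ := kc_theorem hU E.ok h1 E.len h2 (fun t => restrSeq (fun i => A i) (E.str t).length) (by fun_prop) E.kraft
  refine ⟨c, fun n => KC_le_of_enum E fun p hp hs => ?_⟩
  have := hc p hp
  rw [hs] at this
  simpa [zeroStr] using this

theorem computable_of_eventually {A : ℕ → Bool} {b : Bool} {N : ℕ} (h : ∀ i ≥ N, A i = b) : Computable A := by
  have : Computable (fun i => (restrSeq A N).getD i b) := by fun_prop
  refine this.of_eq fun i => ?_
  by_cases hi : i < N
  · simp [List.getD, restrSeq, hi]
  · simp [List.getD, restrSeq, hi, h i (by omega)]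

/-! ### approximations from below -/
structure Apx (A : ℕ → Bool) where
  V : ℕ → ℕ → ℕ
  cV : Computable (fun p : ℕ × ℕ => V p.1 p.2)
  mono : ∀ s t i, s ≤ t → V s i ≤ V t i
  half : ∀ t i, V t i = V t (i+1) / 2
  conv : ∀ i, ∃ T, ∀ t ≥ T, V t i = val (restrSeq A i)

theorem exists_Apx {A : ℕ → Bool} (h : CEReal A) (hA : ¬ Computable A) : Nonempty (Apx A) := by
  obtain ⟨f, hf, hm, hl⟩ := h
  let V : ℕ → ℕ → ℕ := fun t i => (f t).toNat * 2 ^ i / 2 ^ t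
  have hmono : ∀ s t, s ≤ t → (f s : ℝ) / 2 ^ s ≤ (f t : ℝ) / 2 ^ t := fun s t hst =>
    monotone_nat_of_le_succ (f := fun s => (f s : ℝ) / 2 ^ s) hm hst
  have hmono' : ∀ s t, s ≤ t → ((f s).toNat : ℝ) / 2 ^ s ≤ ((f t).toNat : ℝ) / 2 ^ t := by
    intro s t hst
    have h1 := hmono s t hst
    have h2 : ∀ s, ((f s).toNat : ℝ) / 2 ^ s = max ((f s : ℝ) / 2 ^ s) 0 := by
      intro s
      rcases le_total 0 (f s) with h | h
      · have : ((f s).toNat : ℝ) = f s := by exact_mod_cast Int.toNat_of_nonneg h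
        rw [this, max_eq_left]
        have : (0:ℝ) ≤ f s := by exact_mod_cast h
        positivity
      · rw [Int.toNat_of_nonpos h, max_eq_right]; simp
        have : (f s : ℝ) ≤ 0 := by exact_mod_cast h
        exact div_nonpos_of_nonpos_of_nonneg this (by positivity)
    rw [h2, h2]; exact max_le_max h1 le_rfl
  have hVf : ∀ t i, V t i = ⌊((f t).toNat : ℝ) / 2 ^ t * 2 ^ i⌋₊ := by
    intro t i
    rw [div_mul_eq_mul_div]
    have : (((f t).toNat : ℝ) * 2 ^ i) = (((f t).toNat * 2 ^ i : ℕ) : ℝ) := by push_cast; rfl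
    rw [this]
    have : ((2:ℝ) ^ t) = ((2 ^ t : ℕ) : ℝ) := by push_cast; rfl
    rw [this, Nat.floor_div_natCast, Nat.floor_natCast]
  refine ⟨⟨V, ?_, ?_, ?_, ?_⟩⟩
  · show Computable (fun p : ℕ × ℕ => (f p.1).toNat * 2 ^ p.2 / 2 ^ p.1); fun_prop
  · intro s t i hst
    rw [hVf, hVf]
    apply Nat.floor_le_floor
    have := hmono' s t hst
    gcongr
  · intro t i
    show (f t).toNat * 2 ^ i / 2 ^ t = (f t).toNat * 2 ^ (i+1) / 2 ^ t / 2
    rw [Nat.div_div_eq_div_mul, pow_succ, ← mul_assoc, Nat.mul_div_mul_right _ _ (by norm_num)]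
  · intro i
    have h1 : ∃ j ≥ i, A j = true := by
      by_contra hc; push Not at hc
      exact hA (computable_of_eventually (b := false) (N := i) fun j hj => by simpa using hc j hj)
    have h0 : ∃ j ≥ i, A j = false := by
      by_contra hc; push Not at hc
      exact hA (computable_of_eventually (b := true) (N := i) fun j hj => by simpa using hc j hj)
    have e1 := hl.eventually (lt_mem_nhds (real_lower_strict A i h1))
    have e2 := hl.eventually (gt_mem_nhds (real_upper_strict A i h0))
    obtain ⟨T, hT⟩ := eventually_atTop.1 (e1.and e2)
    refine ⟨T, fun t ht => ?_⟩
    obtain ⟨a, b⟩ := hT t ht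
    have p : (0:ℝ) < 2 ^ t := by positivity
    have p' : (0:ℝ) < 2 ^ i := by positivity
    have hpos : 0 ≤ f t := by
      have : (0:ℝ) < (f t : ℝ) / 2 ^ t := lt_of_le_of_lt (by positivity) a
      have : (0:ℝ) < f t := by by_contra hc; push Not at hc; exact absurd this (not_lt.2 (div_nonpos_of_nonpos_of_nonneg hc p.le))
      exact_mod_cast this.le
    have : ((f t).toNat : ℝ) = f t := by exact_mod_cast Int.toNat_of_nonneg hpos
    rw [hVf, this, Nat.floor_eq_iff (by have : (0:ℝ) ≤ f t := by exact_mod_cast hpos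
                                        positivity)]
    constructor
    · rw [div_lt_iff₀ p'] at a; exact a.le
    · rw [lt_div_iff₀ p'] at b; exact b

namespace Apx
variable {A : ℕ → Bool} (P : Apx A)
theorem half' (t i k : ℕ) : P.V t i = P.V t (i+k) / 2 ^ k := by
  induction k with
  | zero => simp
  | succ k ih => rw [ih, P.half t (i+k), Nat.div_div_eq_div_mul, pow_succ, mul_comm]; rfl
theorem V_le (t i : ℕ) : P.V t i ≤ val (restrSeq A i) := by
  obtain ⟨T, hT⟩ := P.conv i
  rw [← hT (max t T) (le_max_right _ _)]
  exact P.mono _ _ _ (le_max_left _ _)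
theorem V_lt (t i : ℕ) : P.V t i < 2 ^ i := by
  have := val_lt (restrSeq A i)
  rw [restrSeq_length] at this
  exact lt_of_le_of_lt (P.V_le t i) this
theorem ne_up {s t i j : ℕ} (hij : i ≤ j) (h : P.V s i ≠ P.V t i) : P.V s j ≠ P.V t j := by
  intro hc; apply h
  obtain ⟨k, rfl⟩ := Nat.exists_eq_add_of_le hij
  rw [P.half' s i k, P.half' t i k, hc]
end Apx

/-! ### matched mass -/
section
variable {U : Str →. Str} (E : UEnum U)
/-- weight of description `p` -/
noncomputable def UEnum.wt (p : ℕ) : ℝ := rw_ E.ok E.len p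
theorem UEnum.wt_nonneg (p) : 0 ≤ E.wt p := rw_nonneg _ _ _
@[fun_prop] theorem UEnum.cwt : CR E.wt := by
  have h1 := E.cok; have h2 := E.clen
  show CR (fun t => rw_ E.ok E.len t); unfold rw_; fun_prop
theorem UEnum.sum_filter_le {ι : Type*} (s : Finset ι) (p : ι → ℕ) (hp : ∀ i ∈ s, ∀ j ∈ s, p i = p j → i = j) : ∑ i ∈ s, E.wt (p i) ≤ 1 := by
  have : ∑ i ∈ s, E.wt (p i) = ∑ x ∈ s.image p, E.wt x := (Finset.sum_image hp).symm
  rw [this]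
  obtain ⟨n, hn⟩ : ∃ n, s.image p ⊆ Finset.range n := ⟨(s.image p).sup id + 1, fun x hx => by
    simp only [Finset.mem_range]; exact Nat.lt_succ_of_le (Finset.le_sup (f := id) hx)⟩
  exact (Finset.sum_le_sum_of_subset_of_nonneg hn (fun i _ _ => E.wt_nonneg i)).trans (E.kraft n)
variable {A : ℕ → Bool} (P : Apx A)
def mat (p t : ℕ) : Prop := p < t ∧ E.ok p ∧ val (E.str p) = P.V t (E.str p).length
@[fun_prop] theorem cmat {α} [Primcodable α] {p t : α → ℕ} (hp : Computable p) (ht : Computable t) : CP (fun a => mat E P (p a) (t a)) := by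
  have h1 := E.cok; have h2 := E.clen; have h3 := E.cstr; have h4 := P.cV
  unfold mat; fun_prop
noncomputable def al (n t : ℕ) : ℝ := ∑ p ∈ Finset.range t, if mat E P p t ∧ 4 ^ n ≤ (E.str p).length then E.wt p else 0
@[fun_prop] theorem cal {α} [Primcodable α] {n t : α → ℕ} (hn : Computable n) (ht : Computable t) : CR (fun a => al E P (n a) (t a)) := by
  have h3 := E.cstr
  unfold al; fun_prop
/-- an abandoned string never returns -/
theorem mat_interval {p r s t : ℕ} (h : mat E P p r) (hrs : r ≤ s) (hst : s ≤ t) (h2 : mat E P p t) : mat E P p s := by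
  refine ⟨lt_of_lt_of_le h.1 hrs, h.2.1, ?_⟩
  have a := h.2.2; have b := h2.2.2
  have c := P.mono r s (E.str p).length hrs
  have d := P.mono s t (E.str p).length hst
  omega
theorem mat_eventually {p : ℕ} (hp : E.ok p) : ∃ T, ∀ t ≥ T, (mat E P p t ↔ E.str p = restrSeq A (E.str p).length) := by
  obtain ⟨T, hT⟩ := P.conv (E.str p).length
  refine ⟨max T (p+1), fun t ht => ?_⟩
  have h1 := hT t (le_trans (le_max_left _ _) ht)
  have h2 : p < t := lt_of_lt_of_le (Nat.lt_succ_self p) (le_trans (le_max_right _ _) ht)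
  constructor
  · rintro ⟨_, _, h⟩
    exact val_inj _ _ (by simp) (by rw [h, h1])
  · intro h
    refine ⟨h2, hp, ?_⟩
    rw [h1, ← h]
theorem al_nonneg (n t : ℕ) : 0 ≤ al E P n t :=
  Finset.sum_nonneg fun i _ => by split_ifs; exacts [E.wt_nonneg i, le_rfl]
theorem al_anti {m n : ℕ} (h : m ≤ n) (t : ℕ) : al E P n t ≤ al E P m t := by
  refine Finset.sum_le_sum fun p _ => ?_
  by_cases h1 : mat E P p t ∧ 4 ^ n ≤ (E.str p).length
  · rw [if_pos h1, if_pos ⟨h1.1, le_trans (Nat.pow_le_pow_right (by norm_num) h) h1.2⟩]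
  · rw [if_neg h1]; split_ifs; exacts [E.wt_nonneg p, le_rfl]
end
/-- string of length `k` with value `v` -/
noncomputable def strOf (v k : ℕ) : Str := restrSeq (fun i => decide (v / 2 ^ (k - 1 - i) % 2 = 1)) k
theorem strOf_val {v k : ℕ} (h : v < 2 ^ k) : val (strOf v k) = v := by
  have : ∀ j ≤ k, val (restrSeq (fun i => decide (v / 2 ^ (k - 1 - i) % 2 = 1)) j) = v / 2 ^ (k - j) := by
    intro j hj
    induction j with
    | zero => simp [restrSeq, Nat.div_eq_of_lt h]
    | succ j ih =>
      rw [restrSeq_succ, val_concat, ih (by omega)]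
      have : k - j = (k - (j+1)) + 1 := by omega
      rw [this, pow_succ, ← Nat.div_div_eq_div_mul]
      have h2 : k - 1 - j = k - (j+1) := by omega
      rw [h2]
      by_cases hk : v / 2 ^ (k - (j+1)) % 2 = 1
      · simp [hk]; omega
      · simp [hk]; omega
  have := this k le_rfl
  simpa [strOf] using this
theorem strOf_eq {X : ℕ → Bool} {k : ℕ} : strOf (val (restrSeq X k)) k = restrSeq X k := by
  apply val_inj
  · simp [strOf]
  · rw [strOf_val]; have := val_lt (restrSeq X k); simpa using this
@[fun_prop] theorem cstrOf {α} [Primcodable α] {v k : α → ℕ} (hv : Computable v) (hk : Computable k) : Computable (fun a => strOf (v a) (k a)) := by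
  unfold strOf; fun_prop


/-! ### requests indexed by pairs -/
theorem sum_pair_le {F : ℕ → ℕ → ℝ} (h0 : ∀ a b, 0 ≤ F a b) {c : ℝ} (h : ∀ n, ∑ a ∈ Finset.range n, ∑ b ∈ Finset.range n, F a b ≤ c) (n : ℕ) :
    ∑ t ∈ Finset.range n, F (Nat.unpair t).1 (Nat.unpair t).2 ≤ c := by
  refine le_trans ?_ (h n)
  rw [← Finset.sum_product']
  have e : ∑ t ∈ Finset.range n, F (Nat.unpair t).1 (Nat.unpair t).2 = ∑ x ∈ (Finset.range n).image Nat.unpair, F x.1 x.2 := by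
    rw [Finset.sum_image]
    intro a _ b _ hab
    have := congrArg (fun x : ℕ × ℕ => Nat.pair x.1 x.2) hab
    simpa using this
  rw [e]
  refine Finset.sum_le_sum_of_subset_of_nonneg ?_ (fun i _ _ => h0 _ _)
  intro x hx
  simp only [Finset.mem_image, Finset.mem_range] at hx
  obtain ⟨t, ht, rfl⟩ := hx
  simp only [Finset.mem_product, Finset.mem_range]
  exact ⟨lt_of_le_of_lt (Nat.unpair_left_le t) ht, lt_of_le_of_lt (Nat.unpair_right_le t) ht⟩

theorem kc_pair {U : Str →. Str} (hU : OptimalPF U) (ok : ℕ → ℕ → Prop) (hok : CP (fun p : ℕ × ℕ => ok p.1 p.2))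
    (d : ℕ → ℕ → ℕ) (hd : Computable (fun p : ℕ × ℕ => d p.1 p.2))
    (σ : ℕ → ℕ → Str) (hσ : Computable (fun p : ℕ × ℕ => σ p.1 p.2))
    (hsum : ∀ n, ∑ a ∈ Finset.range n, ∑ b ∈ Finset.range n, (if ok a b then (1/2:ℝ) ^ (d a b) else 0) ≤ 1) :
    ∃ c : ℕ, ∀ a b, ok a b → KC U (σ a b) ≤ (d a b + c : ℕ) := by
  obtain ⟨c, hc⟩ := kc_theorem hU (fun t => ok (Nat.unpair t).1 (Nat.unpair t).2) (hok.comp (g := Nat.unpair) (by fun_prop))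
    (fun t => d (Nat.unpair t).1 (Nat.unpair t).2) (ccomp hd (g := Nat.unpair) (by fun_prop))
    (fun t => σ (Nat.unpair t).1 (Nat.unpair t).2) (ccomp hσ (g := Nat.unpair) (by fun_prop))
    (fun n => by
      have := sum_pair_le (F := fun a b => if ok a b then (1/2:ℝ) ^ (d a b) else 0) (fun a b => by positivity) hsum n
      exact this)
  refine ⟨c, fun a b h => ?_⟩
  have := hc (Nat.pair a b) (by simpa using h)
  simpa using this

/-! ### c.e. sets give c.e. reals -/
theorem val_mono {X Y : ℕ → Bool} (h : ∀ x, X x = true → Y x = true) (n : ℕ) : val (restrSeq X n) ≤ val (restrSeq Y n) := by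
  induction n with
  | zero => simp [restrSeq]
  | succ n ih =>
    rw [restrSeq_succ, restrSeq_succ, val_concat, val_concat]
    have := h n
    cases hx : X n <;> cases hy : Y n <;> simp_all; omega
theorem cereal_of_ce {B : ℕ → Bool} (Bt : ℕ → ℕ → Bool) (hc : Computable (fun p : ℕ × ℕ => Bt p.1 p.2))
    (hm : ∀ t x, Bt t x = true → Bt (t+1) x = true) (hB : ∀ x, B x = true ↔ ∃ t, Bt t x = true) :
    CEReal B ∧ (∀ s, (val (restrSeq (Bt s) s) : ℝ) / 2 ^ s ≤ realOfSeq B) ∧ Monotone (fun s => (val (restrSeq (Bt s) s) : ℝ) / 2 ^ s) ∧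
      Tendsto (fun s => (val (restrSeq (Bt s) s) : ℝ) / 2 ^ s) atTop (nhds (realOfSeq B)) := by
  have hm' : ∀ s t x, s ≤ t → Bt s x = true → Bt t x = true := by
    intro s t x hst
    induction t, hst using Nat.le_induction with
    | base => exact id
    | succ t h ih => exact fun h => hm t x (ih h)
  have hle : ∀ s, (val (restrSeq (Bt s) s) : ℝ) / 2 ^ s ≤ realOfSeq B := fun s => by
    refine le_trans ?_ (real_lower B s)
    have := val_mono (X := Bt s) (Y := B) (fun x hx => (hB x).2 ⟨s, hx⟩) s
    gcongr
  have hmono : Monotone (fun s => (val (restrSeq (Bt s) s) : ℝ) / 2 ^ s) := by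
    refine monotone_nat_of_le_succ fun s => ?_
    refine le_trans ?_ (val_restr_mono (Bt (s+1)) (Nat.le_succ s))
    have := val_mono (X := Bt s) (Y := Bt (s+1)) (hm s) s
    gcongr
  have ht : Tendsto (fun s => (val (restrSeq (Bt s) s) : ℝ) / 2 ^ s) atTop (nhds (realOfSeq B)) := by
    refine tendsto_order.2 ⟨fun a ha => ?_, fun a ha => Eventually.of_forall fun s => lt_of_le_of_lt (hle s) ha⟩
    obtain ⟨n, hn⟩ := ((tendsto_real B).eventually (lt_mem_nhds ha)).exists
    have : ∃ T, ∀ s ≥ T, ∀ i < n, Bt s i = B i := by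
      have : ∀ i, ∃ T, ∀ s ≥ T, Bt s i = B i := by
        intro i
        by_cases hb : B i = true
        · obtain ⟨T, hT⟩ := (hB i).1 hb
          exact ⟨T, fun s hs => by rw [hb]; exact hm' _ _ _ hs hT⟩
        · refine ⟨0, fun s _ => ?_⟩
          have : ¬ Bt s i = true := fun h => hb ((hB i).2 ⟨s, h⟩)
          simp at hb this; rw [hb, this]
      choose T hT using this
      refine ⟨(Finset.range n).sup T, fun s hs i hi => hT i s (le_trans (Finset.le_sup (f := T) (by simpa using hi)) hs)⟩
    obtain ⟨T, hT⟩ := this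
    refine eventually_atTop.2 ⟨max n T, fun s hs => ?_⟩
    refine lt_of_lt_of_le hn ?_
    rw [← restrSeq_congr (hT s (le_trans (le_max_right _ _) hs))]
    exact val_restr_mono _ (le_trans (le_max_left _ _) hs)
  refine ⟨⟨fun s => (val (restrSeq (Bt s) s) : ℤ), ?_, ?_, ?_⟩, hle, hmono, ht⟩
  · have : Computable (fun s => val (restrSeq (fun i => Bt s i) s)) := by fun_prop
    exact cofNatInt this
  · intro s; have := hmono (Nat.le_succ s); simpa using this
  · simpa using ht

/-! ### the common lower bound -/
section
noncomputable def cntE (ent : ℕ → ℕ) (n t : ℕ) : ℕ := ∑ r ∈ Finset.range t, if ent r = n + 1 then 1 else 0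
def BE (ent : ℕ → ℕ) (t x : ℕ) : Prop := bEx (x+1) fun n => 4 ^ n ≤ x ∧ x < 4 ^ n + cntE ent n t
noncomputable def Bs (ent : ℕ → ℕ) (t x : ℕ) : Bool := decide (BE ent t x)
theorem cntE_mono (ent : ℕ → ℕ) (n : ℕ) {s t : ℕ} (h : s ≤ t) : cntE ent n s ≤ cntE ent n t :=
  Finset.sum_le_sum_of_subset (by simpa using h)
theorem Bs_mono (ent : ℕ → ℕ) {s t : ℕ} (h : s ≤ t) (x) (hx : Bs ent s x = true) : Bs ent t x = true := by
  simp only [Bs, decide_eq_true_eq] at *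
  obtain ⟨n, h1, h2, h3⟩ := hx
  exact ⟨n, h1, h2, lt_of_lt_of_le h3 (by have := cntE_mono ent n h; omega)⟩
variable {U : Str →. Str} (E : UEnum U)
def mB (ent : ℕ → ℕ) (p t : ℕ) : Prop := p < t ∧ E.ok p ∧ E.str p = restrSeq (fun i => Bs ent t i) (E.str p).length
noncomputable def bE (ent : ℕ → ℕ) (n t : ℕ) : ℝ := ∑ p ∈ Finset.range t, if mB E ent p t ∧ 4 ^ (n+1) ≤ (E.str p).length then E.wt p else 0
variable {A₀ A₁ : ℕ → Bool} (P₀ : Apx A₀) (P₁ : Apx A₁)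
noncomputable def stepB (ent : ℕ → ℕ) (t : ℕ) : ℕ :=
  if mu t (fun n => (1/2:ℝ) ^ (2 * n) ≤ bE E ent n t ∧ al E P₀ n t + al E P₁ n t ≤ bE E ent n t) < t then
  mu t (fun n => (1/2:ℝ) ^ (2 * n) ≤ bE E ent n t ∧ al E P₀ n t + al E P₁ n t ≤ bE E ent n t) + 1 else 0
theorem cntE_trunc (ent : ℕ → ℕ) (t n : ℕ) : cntE (trunc 0 ent t) n t = cntE ent n t := by
  refine Finset.sum_congr rfl fun r hr => ?_
  simp only [Finset.mem_range] at hr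
  simp [trunc, hr]
theorem stepB_trunc (ent : ℕ → ℕ) (t : ℕ) : stepB E P₀ P₁ (trunc 0 ent t) t = stepB E P₀ P₁ ent t := by
  have h1 : ∀ x, BE (trunc 0 ent t) t x = BE ent t x := fun x => by simp only [BE, cntE_trunc]
  have h2 : Bs (trunc 0 ent t) t = Bs ent t := by funext x; unfold Bs; congr 1; exact h1 x
  have h3 : ∀ p, mB E (trunc 0 ent t) p t = mB E ent p t := fun p => by simp only [mB, h2]
  have h4 : ∀ n, bE E (trunc 0 ent t) n t = bE E ent n t := fun n => by
    unfold bE; refine Finset.sum_congr rfl fun p _ => ?_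
    rw [h3]
  simp only [stepB, h4]
theorem exists_ent : ∃ ent : ℕ → ℕ, Computable ent ∧ ∀ t, ent t = stepB E P₀ P₁ ent t := by
  have h1 := E.cok; have h2 := E.clen; have h3 := E.cstr
  obtain ⟨F, hF, h⟩ := exists_rec (β := Unit) (0 : ℕ) (fun _ => stepB E P₀ P₁) (by
    unfold stepB bE mB Bs BE cntE
    fun_prop)
  refine ⟨F (), ?_, fun t => by rw [h, stepB_trunc]⟩
  exact ccomp hF (g := fun t : ℕ => ((), t)) (by fun_prop)

structure BProc where
  ent : ℕ → ℕ
  cent : Computable ent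
  spec : ∀ t, ent t = stepB E P₀ P₁ ent t
variable {E P₀ P₁} (Q : BProc E P₀ P₁)
namespace BProc
theorem act {t n : ℕ} (h : Q.ent t = n + 1) : (1/2:ℝ) ^ (2 * n) ≤ bE E Q.ent n t ∧ al E P₀ n t + al E P₁ n t ≤ bE E Q.ent n t := by
  have := Q.spec t
  rw [h] at this
  unfold stepB at this
  split_ifs at this with hm
  rcases mu_spec t (fun n => (1/2:ℝ) ^ (2 * n) ≤ bE E Q.ent n t ∧ al E P₀ n t + al E P₁ n t ≤ bE E Q.ent n t) with h1 | h1
  · have e : n = mu t (fun n => (1/2:ℝ) ^ (2 * n) ≤ bE E Q.ent n t ∧ al E P₀ n t + al E P₁ n t ≤ bE E Q.ent n t) := by omega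
    rw [e]; exact h1.2.1
  · omega
theorem act' {t n : ℕ} (hn : n < t) (h : (1/2:ℝ) ^ (2 * n) ≤ bE E Q.ent n t ∧ al E P₀ n t + al E P₁ n t ≤ bE E Q.ent n t) :
    ∃ m ≤ n, Q.ent t = m + 1 := by
  have := Q.spec t
  unfold stepB at this
  rcases mu_spec t (fun n => (1/2:ℝ) ^ (2 * n) ≤ bE E Q.ent n t ∧ al E P₀ n t + al E P₁ n t ≤ bE E Q.ent n t) with h1 | h1
  · rw [if_pos h1.1] at this
    refine ⟨_, ?_, this⟩
    by_contra hc
    exact h1.2.2 n (by omega) h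
  · exact absurd h (h1.2 n hn)
/-- new bit -/
theorem not_mB_later {r t n p : ℕ} (hc : ∀ n, cntE Q.ent n r ≤ 4 ^ n) (h : Q.ent r = n + 1) (hrt : r < t)
    (hp : 4 ^ (n+1) ≤ (E.str p).length) (h1 : mB E Q.ent p r) (h2 : mB E Q.ent p t) : False := by
  set x := 4 ^ n + cntE Q.ent n r with hx
  have hxn : x < 4 ^ (n+1) := by have := hc n; have : 0 < 4 ^ n := by positivity
                                 rw [pow_succ]; omega
  have hle : x < (E.str p).length := lt_of_lt_of_le hxn hp
  have e : Bs Q.ent r x = Bs Q.ent t x := restrSeq_inj (h1.2.2.symm.trans h2.2.2) x hle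
  have ht : Bs Q.ent t x = true := by
    apply Bs_mono Q.ent (Nat.succ_le_of_lt hrt)
    simp only [Bs, decide_eq_true_eq]
    refine ⟨n, ?_, by omega, ?_⟩
    · have : n < 4 ^ n := Nat.lt_pow_self (by norm_num)
      omega
    · have : cntE Q.ent n (r+1) = cntE Q.ent n r + 1 := by rw [cntE, Finset.sum_range_succ, if_pos h]; rfl
      show x < _
      rw [Nat.succ_eq_add_one, this]; omega
  rw [ht] at e
  simp only [Bs, decide_eq_true_eq] at e
  obtain ⟨n', _, h3, h4⟩ := e
  have h5 := hc n'
  have : 0 < 4 ^ n := by positivity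
  rcases lt_trichotomy n n' with hn | rfl | hn
  · have : 4 ^ (n+1) ≤ 4 ^ n' := Nat.pow_le_pow_right (by norm_num) hn
    omega
  · omega
  · have : 4 ^ (n'+1) ≤ 4 ^ n := Nat.pow_le_pow_right (by norm_num) hn
    rw [pow_succ] at this
    omega
theorem bE_eq {n t N : ℕ} (h : t ≤ N) : bE E Q.ent n t = ∑ p ∈ Finset.range N, if mB E Q.ent p t ∧ 4 ^ (n+1) ≤ (E.str p).length then E.wt p else 0 := by
  unfold bE
  refine Finset.sum_subset (by simpa using h) fun p _ hp => ?_
  rw [if_neg]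
  rintro ⟨h, _⟩
  simp only [Finset.mem_range] at hp
  exact hp h.1
theorem sum_acts_aux {t : ℕ} (hc : ∀ r < t, ∀ n, cntE Q.ent n r ≤ 4 ^ n) :
    ∑ r ∈ Finset.range t, (if Q.ent r ≠ 0 then bE E Q.ent (Q.ent r - 1) r else 0) ≤ 1 := by
  have : ∑ r ∈ Finset.range t, (if Q.ent r ≠ 0 then bE E Q.ent (Q.ent r - 1) r else 0)
      = ∑ x ∈ (Finset.range t ×ˢ Finset.range t).filter (fun x => Q.ent x.1 ≠ 0 ∧ mB E Q.ent x.2 x.1 ∧ 4 ^ (Q.ent x.1 - 1 + 1) ≤ (E.str x.2).length), E.wt x.2 := by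
    rw [Finset.sum_filter, Finset.sum_product]
    refine Finset.sum_congr rfl fun r hr => ?_
    by_cases h0 : Q.ent r ≠ 0
    · rw [if_pos h0, Q.bE_eq (N := t) (by simp at hr; omega)]
      refine Finset.sum_congr rfl fun p _ => ?_
      simp [h0]
    · rw [if_neg h0]; symm; apply Finset.sum_eq_zero; intro p _; rw [if_neg]; tauto
  rw [this]
  apply E.sum_filter_le
  intro x hx y hy hxy
  simp only [Finset.mem_filter, Finset.mem_product, Finset.mem_range] at hx hy
  obtain ⟨⟨hx1, _⟩, hx2, hx3, hx4⟩ := hx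
  obtain ⟨⟨hy1, _⟩, hy2, hy3, hy4⟩ := hy
  rcases lt_trichotomy x.1 y.1 with h | h | h
  · rw [← hxy] at hy3
    exact (Q.not_mB_later (hc x.1 hx1) (n := Q.ent x.1 - 1) (by omega) h hx4 hx3 hy3).elim
  · exact Prod.ext h hxy
  · rw [hxy] at hx3
    exact (Q.not_mB_later (hc y.1 hy1) (n := Q.ent y.1 - 1) (by omega) h hy4 hy3 hx3).elim
theorem cnt_le (t : ℕ) : ∀ n, cntE Q.ent n t ≤ 4 ^ n := by
  induction t using Nat.strong_induction_on with
  | _ t ih =>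
    intro n
    have h := Q.sum_acts_aux ih
    have h2 : (cntE Q.ent n t : ℝ) * (1/2) ^ (2*n) ≤ ∑ r ∈ Finset.range t, (if Q.ent r ≠ 0 then bE E Q.ent (Q.ent r - 1) r else 0) := by
      unfold cntE
      push_cast
      rw [Finset.sum_mul]
      refine Finset.sum_le_sum fun r _ => ?_
      by_cases hr : Q.ent r = n + 1
      · rw [if_pos hr, if_pos (by omega), hr]
        simpa using (Q.act hr).1
      · rw [if_neg hr]; simp only [zero_mul]
        split_ifs
        · unfold bE; exact Finset.sum_nonneg fun p _ => by split_ifs; exacts [E.wt_nonneg p, le_rfl]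
        · exact le_rfl
    have h3 := h2.trans h
    have h4 : ((1:ℝ)/2) ^ (2*n) * 4 ^ n = 1 := by rw [pow_mul, ← mul_pow]; norm_num
    have h5 : (0:ℝ) < 4 ^ n := by positivity
    have : (cntE Q.ent n t : ℝ) ≤ 4 ^ n := by nlinarith
    exact_mod_cast this
theorem sum_acts (t : ℕ) : ∑ r ∈ Finset.range t, (if Q.ent r ≠ 0 then bE E Q.ent (Q.ent r - 1) r else 0) ≤ 1 :=
  Q.sum_acts_aux fun r _ => Q.cnt_le r
/-- the constructed sequence -/
noncomputable def B : ℕ → Bool := fun x => decide (∃ t, Bs Q.ent t x = true)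
theorem cBs : Computable (fun p : ℕ × ℕ => Bs Q.ent p.1 p.2) := by
  have := Q.cent
  unfold Bs BE cntE; fun_prop
theorem ceB : CEReal Q.B :=
  (cereal_of_ce (fun t x => Bs Q.ent t x) Q.cBs (fun t x => Bs_mono _ (Nat.le_succ t) x) (fun x => by simp [B])).1
theorem no_acts (n : ℕ) : ∃ T, ∀ t ≥ T, ∀ m ≤ n, Q.ent t ≠ m + 1 := by
  have : ∀ m, ∃ T, ∀ t ≥ T, Q.ent t ≠ m + 1 := by
    intro m
    by_contra hc; push Not at hc
    have : ∀ k, ∃ t, k ≤ cntE Q.ent m t := by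
      intro k
      induction k with
      | zero => exact ⟨0, Nat.zero_le _⟩
      | succ k ih =>
        obtain ⟨t, ht⟩ := ih
        obtain ⟨u, hu, he⟩ := hc t
        refine ⟨u+1, ?_⟩
        have : cntE Q.ent m (u+1) = cntE Q.ent m u + 1 := by rw [cntE, Finset.sum_range_succ, if_pos he]; rfl
        have := cntE_mono Q.ent m hu; omega
    obtain ⟨t, ht⟩ := this (4 ^ m + 1)
    have := Q.cnt_le t m
    omega
  choose T hT using this
  exact ⟨(Finset.range (n+1)).sup T, fun t ht m hm => hT m t (le_trans (Finset.le_sup (f := T) (by simp; omega)) ht)⟩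
theorem Bs_stable {t k : ℕ} (h : ∀ m, Q.ent t = m + 1 → k ≤ 4 ^ m) : restrSeq (fun i => Bs Q.ent (t+1) i) k = restrSeq (fun i => Bs Q.ent t i) k := by
  apply restrSeq_congr
  intro x hx
  unfold Bs
  congr 1
  apply propext
  unfold BE bEx
  refine exists_congr fun n => and_congr_right fun _ => and_congr_right fun h2 => ?_
  have : cntE Q.ent n (t+1) = cntE Q.ent n t := by
    unfold cntE
    rw [Finset.sum_range_succ, if_neg, add_zero]
    intro hc
    have := h n hc
    omega
  rw [this]
theorem Bs_conv (k : ℕ) : ∃ T, ∀ t ≥ T, restrSeq (fun i => Bs Q.ent t i) k = restrSeq Q.B k := by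
  obtain ⟨T, hT⟩ := Q.no_acts k
  have hs : ∀ t ≥ T, restrSeq (fun i => Bs Q.ent t i) k = restrSeq (fun i => Bs Q.ent T i) k := by
    intro t ht
    induction t, ht using Nat.le_induction with
    | base => rfl
    | succ t ht ih =>
      rw [← ih]; apply Q.Bs_stable
      intro m hm
      by_contra hc
      have : m < 4 ^ m := Nat.lt_pow_self (by norm_num)
      exact hT t ht m (by omega) hm
  refine ⟨T, fun t ht => restrSeq_congr fun i hi => ?_⟩
  by_cases h : Q.B i = true
  · rw [h]; simp only [B, decide_eq_true_eq] at h
    obtain ⟨u, hu⟩ := h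
    have h1 := Bs_mono Q.ent (le_max_left u T) i hu
    have h2 := restrSeq_inj (hs (max u T) (le_max_right _ _)) i hi
    have h3 := restrSeq_inj (hs t ht) i hi
    rw [h3, ← h2, h1]
  · have : ¬ Bs Q.ent t i = true := fun h1 => h (by simp only [B, decide_eq_true_eq]; exact ⟨t, h1⟩)
    simp at h this; rw [h, this]
theorem mB_conv {p : ℕ} (hp : E.ok p) (hs : E.str p = restrSeq Q.B (E.str p).length) : ∃ T, ∀ t ≥ T, mB E Q.ent p t := by
  obtain ⟨T, hT⟩ := Q.Bs_conv (E.str p).length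
  refine ⟨max T (p+1), fun t ht => ⟨?_, hp, ?_⟩⟩
  · have := le_trans (le_max_right _ _) ht; omega
  · rw [hT t (le_trans (le_max_left _ _) ht), ← hs]
end BProc
end

theorem al_eq {U : Str →. Str} (E : UEnum U) {A : ℕ → Bool} (P : Apx A) {n t N : ℕ} (h : t ≤ N) :
    al E P n t = ∑ p ∈ Finset.range N, if mat E P p t ∧ 4 ^ n ≤ (E.str p).length then E.wt p else 0 := by
  unfold al
  refine Finset.sum_subset (by simpa using h) fun p _ hp => ?_
  rw [if_neg]
  rintro ⟨h, _⟩
  simp only [Finset.mem_range] at hp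
  exact hp h.1
section
variable {U : Str →. Str} {E : UEnum U} {A₀ A₁ : ℕ → Bool} {P₀ : Apx A₀} {P₁ : Apx A₁} (Q : BProc E P₀ P₁)
namespace BProc
def okB {A : ℕ → Bool} (P : Apx A) (t p : ℕ) : Prop := mat E P p (t+1) ∧ (¬ mat E P p t ∨ (Q.ent t ≠ 0 ∧ 4 ^ (Q.ent t - 1) < (E.str p).length))
theorem kle (hU : OptimalPF U) {A : ℕ → Bool} (P : Apx A) (hP : ∀ n t, al E P n t ≤ al E P₀ n t + al E P₁ n t) : KLeSeq U Q.B A := by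
  have h1 := E.cok; have h2 := E.clen; have h3 := E.cstr; have h4 := Q.cBs; have h5 := Q.cent
  let ok := Q.okB P
  obtain ⟨c, hc⟩ := kc_pair hU ok (by show CP (fun x : ℕ × ℕ => Q.okB P x.1 x.2); show CP (fun x : ℕ × ℕ => mat E P x.2 (x.1+1) ∧ (¬ mat E P x.2 x.1 ∨ (Q.ent x.1 ≠ 0 ∧ 4 ^ (Q.ent x.1 - 1) < (E.str x.2).length))); fun_prop)
    (fun t p => E.len p + 1) (by fun_prop) (fun t p => restrSeq (fun i => Bs Q.ent (t+1) i) (E.str p).length)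
    (by refine crestr (by fun_prop) ?_
        exact ccomp (g := fun x : (ℕ × ℕ) × ℕ => (x.1.1 + 1, x.2)) h4 (by fun_prop)) (by
    intro n
    have key : ∀ t ∈ Finset.range n, ∀ p ∈ Finset.range n, (if ok t p then (1/2:ℝ) ^ (E.len p + 1) else 0) ≤
        1/2 * (if mat E P p (t+1) ∧ ¬ mat E P p t then E.wt p else 0) + 1/2 * (if Q.ent t ≠ 0 then (if mat E P p t ∧ 4 ^ (Q.ent t - 1) ≤ (E.str p).length then E.wt p else 0) else 0) := by
      intro t _ p _
      have hnn := E.wt_nonneg p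
      by_cases h : ok t p
      · have hw : E.wt p = (1/2:ℝ) ^ (E.len p) := by simp [UEnum.wt, rw_, h.1.2.1]
        rw [if_pos h, pow_succ, ← hw]
        obtain ⟨h1, h2⟩ := h
        by_cases h3 : mat E P p t
        · have h2' : Q.ent t ≠ 0 ∧ 4 ^ (Q.ent t - 1) < (E.str p).length := by tauto
          rw [if_neg (by tauto), if_pos h2'.1, if_pos ⟨h3, h2'.2.le⟩]; linarith
        · rw [if_pos ⟨h1, h3⟩]
          have : 0 ≤ (if Q.ent t ≠ 0 then (if mat E P p t ∧ 4 ^ (Q.ent t - 1) ≤ (E.str p).length then E.wt p else 0) else 0) := by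
            split_ifs <;> simp [hnn]
          linarith
      · rw [if_neg h]
        split_ifs <;> linarith
    refine (Finset.sum_le_sum fun t ht => Finset.sum_le_sum (key t ht)).trans ?_
    simp only [Finset.sum_add_distrib, ← Finset.mul_sum]
    have a : ∑ t ∈ Finset.range n, ∑ p ∈ Finset.range n, (if mat E P p (t+1) ∧ ¬ mat E P p t then E.wt p else 0) ≤ 1 := by
      rw [← Finset.sum_product', ← Finset.sum_filter]
      apply E.sum_filter_le
      intro x hx y hy hxy
      simp only [Finset.mem_filter] at hx hy
      rw [← hxy] at hy
      rcases lt_trichotomy x.1 y.1 with h | h | h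
      · exact (hy.2.2 (mat_interval E P hx.2.1 h (Nat.le_succ _) hy.2.1)).elim
      · exact Prod.ext h hxy
      · exact (hx.2.2 (mat_interval E P hy.2.1 h (Nat.le_succ _) hx.2.1)).elim
    have b : ∑ t ∈ Finset.range n, ∑ p ∈ Finset.range n, (if Q.ent t ≠ 0 then (if mat E P p t ∧ 4 ^ (Q.ent t - 1) ≤ (E.str p).length then E.wt p else 0) else 0) ≤ 1 := by
      refine le_trans (Finset.sum_le_sum fun t ht => ?_) (Q.sum_acts n)
      by_cases h0 : Q.ent t ≠ 0
      · simp only [if_pos h0]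
        rw [← al_eq E P (by simp at ht; omega)]
        exact (hP _ _).trans (Q.act (n := Q.ent t - 1) (by omega)).2
      · simp [h0]
    linarith)
  have hreq : ∀ t p, mat E P p t → ∃ t', ok t' p ∧ restrSeq (fun i => Bs Q.ent (t'+1) i) (E.str p).length = restrSeq (fun i => Bs Q.ent t i) (E.str p).length := by
    intro t p
    induction t with
    | zero => intro h; exact absurd h.1 (by omega)
    | succ t ih =>
      intro h
      by_cases ho : ok t p
      · exact ⟨t, ho, rfl⟩
      · have : mat E P p t ∧ ¬ (Q.ent t ≠ 0 ∧ 4 ^ (Q.ent t - 1) < (E.str p).length) := by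
          by_contra hcc; exact ho ⟨h, by tauto⟩
        obtain ⟨t', h1, h2⟩ := ih this.1
        refine ⟨t', h1, h2.trans ?_⟩
        symm; apply Q.Bs_stable
        intro m hm
        by_contra hlt
        apply this.2
        rw [hm]; simp; omega
  refine ⟨c + 1, fun n => KC_le_of_enum E fun p hp hs => ?_⟩
  have hlen : (E.str p).length = n := by rw [hs]; simp
  obtain ⟨T, hT⟩ := mat_eventually E P hp
  obtain ⟨T', hT'⟩ := Q.Bs_conv n
  obtain ⟨t', h6, h7⟩ := hreq (max T T') p ((hT _ (le_max_left _ _)).2 (by rw [hlen, hs]))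
  have := hc t' p h6
  rw [h7, hlen, hT' _ (le_max_right _ _)] at this
  rw [show E.len p + (c+1) = E.len p + 1 + c by ring]
  exact this
end BProc
/-- the hypothesis extracted from K-triviality of the common lower bound -/
def HH (E : UEnum U) (P₀ : Apx A₀) (P₁ : Apx A₁) : Prop :=
  ∃ e n1 : ℕ, ∀ n ≥ n1, ∀ (t : ℕ) (D : ℕ → ℕ) (supp : ℕ → Prop), (∀ r, supp r → KC U (zeroStr (4 ^ (r+1))) ≤ D r) →
    ∃ S, ∀ s ≥ S, ∑ r ∈ Finset.Ico n t, (if supp r then (1/2:ℝ) ^ (D r) else 0) ≤ 2 ^ e * (al E P₀ n s + al E P₁ n s)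
theorem BProc.hh (hU : OptimalPF U) (h : KTrivialSeq U Q.B) : HH E P₀ P₁ := by
  obtain ⟨e, he⟩ := h
  obtain ⟨C, hC⟩ := KC_zero_pow hU
  refine ⟨e, C + e + 1, fun n hn t D supp hD => ?_⟩
  have hp : ∀ r, ∃ p, supp r → E.ok p ∧ E.str p = restrSeq Q.B (4 ^ (r+1)) ∧ E.len p ≤ D r + e := by
    intro r
    by_cases hr : supp r
    · have : KC U (restrSeq Q.B (4 ^ (r+1))) ≤ (D r + e : ℕ) := (he _).trans (by push_cast; gcongr; exact hD r hr)
      obtain ⟨p, h1, h2, h3⟩ := E.complete _ _ this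
      exact ⟨p, fun _ => ⟨h1, h2, h3⟩⟩
    · exact ⟨0, fun h => absurd h hr⟩
  choose p hp using hp
  obtain ⟨p', h1, h2, h3⟩ := E.complete (restrSeq Q.B (4 ^ (n+1))) (n + C + e) ((he _).trans (by push_cast; gcongr; exact_mod_cast hC n))
  have hm : ∀ r, ∃ T, ∀ s ≥ T, supp r → mB E Q.ent (p r) s := by
    intro r
    by_cases hr : supp r
    · obtain ⟨T, hT⟩ := Q.mB_conv (hp r hr).1 (by rw [(hp r hr).2.1]; simp)
      exact ⟨T, fun s hs _ => hT s hs⟩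
    · exact ⟨0, fun s _ h => absurd h hr⟩
  choose T hT using hm
  obtain ⟨T', hT'⟩ := Q.mB_conv h1 (by rw [h2]; simp)
  obtain ⟨T'', hT''⟩ := Q.no_acts n
  refine ⟨max (max T' T'') (max (n+1) ((Finset.range t).sup T)), fun s hs => ?_⟩
  have hs1 : T' ≤ s := by omega
  have hs2 : T'' ≤ s := by omega
  have hs3 : n < s := by omega
  have hs4 : ∀ r < t, T r ≤ s := fun r hr => le_trans (Finset.le_sup (s := Finset.range t) (f := T) (by simpa using hr)) (by omega)
  have hb1 : (1/2:ℝ) ^ (2*n) ≤ bE E Q.ent n s := by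
    have hm := hT' s hs1
    have : E.wt p' ≤ bE E Q.ent n s := by
      refine le_trans ?_ (Finset.single_le_sum (f := fun p => if mB E Q.ent p s ∧ 4 ^ (n+1) ≤ (E.str p).length then E.wt p else 0) (fun p _ => by split_ifs; exacts [E.wt_nonneg p, le_rfl]) (Finset.mem_range.2 hm.1))
      rw [if_pos ⟨hm, by rw [h2]; simp⟩]
    refine le_trans ?_ this
    simp only [UEnum.wt, rw_, h1, if_true]
    exact pow_le_pow_of_le_one (by norm_num) (by norm_num) (by omega)
  have hb2 : bE E Q.ent n s < al E P₀ n s + al E P₁ n s := by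
    by_contra hc; push Not at hc
    obtain ⟨m, hm, h⟩ := Q.act' hs3 ⟨hb1, hc⟩
    exact hT'' s hs2 m hm h
  have hb3 : ∑ r ∈ Finset.Ico n t, (if supp r then E.wt (p r) else 0) ≤ bE E Q.ent n s := by
    unfold bE
    rw [← Finset.sum_filter, ← Finset.sum_filter]
    have e1 : ∑ r ∈ (Finset.Ico n t).filter supp, E.wt (p r) = ∑ x ∈ ((Finset.Ico n t).filter supp).image p, E.wt x := by
      rw [Finset.sum_image]
      intro a ha b hb hab
      simp only [Finset.coe_filter, Set.mem_ofPred_eq] at ha hb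
      have h4 := (hp a ha.2).2.1; have h5 := (hp b hb.2).2.1
      rw [hab, h5] at h4
      have := congrArg List.length h4
      simp only [restrSeq_length] at this
      have := Nat.pow_right_injective (le_refl 2 |>.trans (by norm_num) : 2 ≤ 4) this
      omega
    rw [e1]
    refine Finset.sum_le_sum_of_subset_of_nonneg ?_ (fun i _ _ => E.wt_nonneg i)
    intro x hx
    simp only [Finset.mem_image, Finset.mem_filter, Finset.mem_Ico] at hx
    obtain ⟨r, ⟨hr1, hr2⟩, rfl⟩ := hx
    have hm := hT r s (hs4 r hr1.2) hr2
    simp only [Finset.mem_filter, Finset.mem_range]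
    refine ⟨hm.1, hm, ?_⟩
    rw [(hp r hr2).2.1]; simp
    exact Nat.pow_le_pow_right (by norm_num) (by omega)
  have hb4 : ∑ r ∈ Finset.Ico n t, (if supp r then (1/2:ℝ) ^ (D r) else 0) ≤ 2 ^ e * ∑ r ∈ Finset.Ico n t, (if supp r then E.wt (p r) else 0) := by
    rw [Finset.mul_sum]
    refine Finset.sum_le_sum fun r _ => ?_
    by_cases hr : supp r
    · simp only [if_pos hr, UEnum.wt, rw_, (hp r hr).1, if_true]
      have : (1/2:ℝ) ^ (D r + e) ≤ (1/2) ^ (E.len (p r)) := pow_le_pow_of_le_one (by norm_num) (by norm_num) (hp r hr).2.2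
      calc (1/2:ℝ) ^ (D r) = 2 ^ e * (1/2:ℝ) ^ (D r + e) := by rw [pow_add, mul_left_comm, ← mul_pow]; norm_num
        _ ≤ _ := by gcongr
    · simp [hr]
  refine hb4.trans ?_
  have : (0:ℝ) < 2 ^ e := by positivity
  gcongr
  linarith
end


/-! ### rounding down to a power of two -/
noncomputable def rndc (x : ℝ) : ℕ := if h : ∃ k : ℕ, (1/2:ℝ) ^ k ≤ x then Nat.find h + 1 else 0
noncomputable def pw (d : ℕ) : ℝ := if d = 0 then 0 else (1/2) ^ (d - 1)
theorem pw_nonneg (d) : 0 ≤ pw d := by unfold pw; split_ifs <;> positivity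
theorem pw_rnd_le {x : ℝ} (hx : 0 ≤ x) : pw (rndc x) ≤ x := by
  unfold rndc
  split_ifs with h
  · simpa [pw] using Nat.find_spec h
  · simpa [pw] using hx
theorem lt_pw_rnd {x : ℝ} (h0 : 0 < x) (h2 : x < 2) : x < 2 * pw (rndc x) := by
  have h : ∃ k : ℕ, (1/2:ℝ) ^ k ≤ x := by
    obtain ⟨k, hk⟩ := exists_pow_lt_of_lt_one h0 (by norm_num : (1/2:ℝ) < 1)
    exact ⟨k, hk.le⟩
  unfold rndc
  rw [dif_pos h]
  simp only [pw, Nat.succ_ne_zero, if_false, Nat.add_sub_cancel]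
  rcases Nat.eq_zero_or_pos (Nat.find h) with h1 | h1
  · rw [h1]; simpa using h2
  · have := Nat.find_min h (m := Nat.find h - 1) (by omega)
    push Not at this
    refine lt_of_lt_of_eq this ?_
    conv_rhs => rw [show Nat.find h = (Nat.find h - 1) + 1 by omega, pow_succ]
    ring
theorem le_pw_rnd {x : ℝ} (h0 : 0 ≤ x) (h2 : x < 2) : x ≤ 2 * pw (rndc x) := by
  rcases h0.eq_or_lt with h | h
  · rw [← h]; have := pw_nonneg (rndc 0); linarith
  · exact (lt_pw_rnd h h2).le
@[fun_prop] theorem crnd {α} [Primcodable α] {x : α → ℝ} (hx : CR x) : Computable (fun a => rndc (x a)) := by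
  obtain ⟨d, hd, he⟩ := id hx
  have hc : Computable (fun a => if (d a).1 = 0 then 0 else mu ((d a).2 + 1) (fun k => (1/2:ℝ) ^ k ≤ x a) + 1) := by fun_prop
  refine hc.of_eq fun a => ?_
  by_cases h : (d a).1 = 0
  · rw [if_pos h, rndc, dif_neg]
    rw [he a, h]
    push Not; intro k; simp
  · have hk : (1/2:ℝ) ^ (d a).2 ≤ x a := by
      rw [he a, one_div, inv_pow, inv_eq_one_div]
      gcongr
      have : 1 ≤ (d a).1 := Nat.one_le_iff_ne_zero.2 h
      exact_mod_cast this
    have hex : ∃ k : ℕ, (1/2:ℝ) ^ k ≤ x a := ⟨_, hk⟩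
    rw [if_neg h, rndc, dif_pos hex]
    congr 1
    rcases mu_spec ((d a).2 + 1) (fun k => (1/2:ℝ) ^ k ≤ x a) with h1 | h1
    · symm; rw [Nat.find_eq_iff]; exact ⟨h1.2.1, fun n hn => h1.2.2 n hn⟩
    · exact absurd hk (h1.2 _ (Nat.lt_succ_self _))
@[fun_prop] theorem cpw {α} [Primcodable α] {x : α → ℕ} (hx : Computable x) : CR (fun a => pw (x a)) := by
  unfold pw; fun_prop

section
abbrev Ent := ℕ × ℕ × Bool
noncomputable def we (e : ℕ → Ent) (r : ℕ) : ℝ := pw (e r).1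
def lev (e : ℕ → Ent) (r : ℕ) : ℕ := (e r).2.1
def gd (e : ℕ → Ent) (r : ℕ) : Prop := (e r).2.2 = true
noncomputable def ms (e : ℕ → Ent) (n t : ℕ) : ℝ := ∑ r ∈ Finset.range t, if n ≤ r then we e r else 0
def LL (q : ℕ) : ℕ := 4 ^ (q+1)
def inC (e : ℕ → Ent) (i b t : ℕ) : Prop := b < t ∧ lev e b ≤ i ∧ bAll t (fun b' => b' ≤ b ∨ i ≤ lev e b')
noncomputable def br (e : ℕ → Ent) (i t : ℕ) : ℕ := t - 1 - mu t (fun k => lev e (t - 1 - k) ≤ i)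
noncomputable def Nb (q : ℕ) (e : ℕ → Ent) (t : ℕ) : ℕ := ∑ r ∈ Finset.range t, if lev e r < LL q then 1 else 0
noncomputable def gct (e : ℕ → Ent) (t : ℕ) : ℕ := ∑ r ∈ Finset.range t, if gd e r then 1 else 0
variable {U : Str →. Str} (E : UEnum U) {A₀ A₁ : ℕ → Bool} (P₀ : Apx A₀) (P₁ : Apx A₁)
noncomputable def alI (i n t : ℕ) : ℝ := if i % 2 = 0 then al E P₀ n t else al E P₁ n t
def goodP (q : ℕ) (e : ℕ → Ent) (t : ℕ) : Prop := bAll t (fun n => ms e n t ≤ 4 ^ q * (al E P₀ n t + al E P₁ n t))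
def bad (q : ℕ) (e : ℕ → Ent) (i b t : ℕ) : Prop := (LL q : ℕ) * alI E P₀ P₁ i b t < ms e b t
noncomputable def i0 (q : ℕ) (e : ℕ → Ent) (t : ℕ) : ℕ := mu (LL q) (fun i => ¬ bEx t (fun b => inC e i b t ∧ bad E P₀ P₁ q e i b t))
noncomputable def target (q : ℕ) (e : ℕ → Ent) (t : ℕ) : ℝ :=
  E.wt (gct e t) + if i0 E P₀ P₁ q e t < LL q then (1/2:ℝ) ^ (2*q+4) * ms e (br e (i0 E P₀ P₁ q e t) t) t else (1/2:ℝ) ^ (2*q+4 + Nb q e t)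
noncomputable def stepT (q : ℕ) (e : ℕ → Ent) (t : ℕ) : Ent :=
  if goodP E P₀ P₁ q e t then (rndc (target E P₀ P₁ q e t), i0 E P₀ P₁ q e t, true) else (0, LL q, false)

theorem ms_congr {e e' : ℕ → Ent} {t : ℕ} (h : ∀ r < t, e r = e' r) (n : ℕ) : ms e n t = ms e' n t := by
  refine Finset.sum_congr rfl fun r hr => ?_
  simp [we, h r (by simpa using hr)]
theorem stepT_congr {e e' : ℕ → Ent} {t : ℕ} (h : ∀ r < t, e r = e' r) (q : ℕ) : stepT E P₀ P₁ q e t = stepT E P₀ P₁ q e' t := by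
  have hl : ∀ r < t, lev e r = lev e' r := fun r hr => by simp [lev, h r hr]
  have h1 := ms_congr h
  have h2 : goodP E P₀ P₁ q e t = goodP E P₀ P₁ q e' t := by simp only [goodP, h1]
  have h3 : ∀ i b, inC e i b t = inC e' i b t := by
    intro i b; apply propext; unfold inC bAll
    constructor
    · rintro ⟨a, b, c⟩; exact ⟨a, by rwa [← hl _ a], fun x hx => by beta_reduce; rw [← hl x hx]; exact c x hx⟩
    · rintro ⟨a, b, c⟩; exact ⟨a, by rwa [hl _ a], fun x hx => by beta_reduce; rw [hl x hx]; exact c x hx⟩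
  have h4 : i0 E P₀ P₁ q e t = i0 E P₀ P₁ q e' t := by simp only [i0, h3, bad, h1]
  have h5 : ∀ i, br e i t = br e' i t := by
    intro i; unfold br; congr 1; apply mu_congr; intro k hk; rw [hl _ (by omega)]
  have h6 : gct e t = gct e' t := Finset.sum_congr rfl fun r hr => by
    have : gd e r ↔ gd e' r := by simp [gd, h r (by simpa using hr)]
    simp only [this]
  have h7 : Nb q e t = Nb q e' t := Finset.sum_congr rfl fun r hr => by simp [hl r (by simpa using hr)]
  simp only [stepT, target, h1, h2, h4, h5, h6, h7]
theorem exists_T : ∃ F : ℕ → ℕ → Ent, Computable (fun p : ℕ × ℕ => F p.1 p.2) ∧ ∀ q t, F q t = stepT E P₀ P₁ q (F q) t := by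
  have h1 := E.cok; have h2 := E.clen; have h3 := E.cstr; have h4 := E.cwt
  obtain ⟨F, hF, h⟩ := exists_rec (β := ℕ) ((0, 0, false) : Ent) (fun q => stepT E P₀ P₁ q) (by
    unfold stepT target i0 bad goodP alI gct Nb br inC ms we lev gd LL
    fun_prop)
  refine ⟨F, hF, fun q t => ?_⟩
  rw [h]; apply stepT_congr
  intro r hr; simp [trunc, hr]
end

section
variable {U : Str →. Str} (E : UEnum U) {A₀ A₁ : ℕ → Bool} (P₀ : Apx A₀) (P₁ : Apx A₁)
def AI (A₀ A₁ : ℕ → Bool) (i : ℕ) : ℕ → Bool := if i % 2 = 0 then A₀ else A₁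
def matI (i p t : ℕ) : Prop := if i % 2 = 0 then mat E P₀ p t else mat E P₁ p t
theorem matI_lt {i p t} (h : matI E P₀ P₁ i p t) : p < t := by
  unfold matI at h; split_ifs at h; exacts [h.1, h.1]
theorem matI_interval {i p r s t : ℕ} (h : matI E P₀ P₁ i p r) (hrs : r ≤ s) (hst : s ≤ t) (h2 : matI E P₀ P₁ i p t) : matI E P₀ P₁ i p s := by
  unfold matI at *; split_ifs at *; exacts [mat_interval E P₀ h hrs hst h2, mat_interval E P₁ h hrs hst h2]
theorem alI_eq {i n t N : ℕ} (h : t ≤ N) : alI E P₀ P₁ i n t = ∑ p ∈ Finset.range N, if matI E P₀ P₁ i p t ∧ 4 ^ n ≤ (E.str p).length then E.wt p else 0 := by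
  unfold matI alI; split_ifs; exacts [al_eq E P₀ h, al_eq E P₁ h]
theorem alI_nonneg (i n t : ℕ) : 0 ≤ alI E P₀ P₁ i n t := by
  unfold alI; split_ifs; exacts [al_nonneg _ _ _ _, al_nonneg _ _ _ _]
theorem alI_add (i n t : ℕ) : alI E P₀ P₁ i n t + alI E P₀ P₁ (i+1) n t = al E P₀ n t + al E P₁ n t := by
  unfold alI
  rcases Nat.mod_two_eq_zero_or_one i with h | h
  · rw [if_pos h, if_neg (by omega)]
  · rw [if_neg (by omega), if_pos (by omega)]; ring
def ever (i p t : ℕ) : Prop := ∃ s ≤ t, matI E P₀ P₁ i p s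
theorem ever_mono {i p s t : ℕ} (h : s ≤ t) (he : ever E P₀ P₁ i p s) : ever E P₀ P₁ i p t := by
  obtain ⟨u, hu, hm⟩ := he; exact ⟨u, hu.trans h, hm⟩
theorem ever_of {i p t : ℕ} (h : matI E P₀ P₁ i p t) : ever E P₀ P₁ i p t := ⟨t, le_rfl, h⟩
theorem ever_lt {i p t : ℕ} (h : ever E P₀ P₁ i p t) : p < t := by
  obtain ⟨s, hs, hm⟩ := h; exact lt_of_lt_of_le (matI_lt E P₀ P₁ hm) hs
theorem ever_add_two (i p t : ℕ) : ever E P₀ P₁ (i+2) p t ↔ ever E P₀ P₁ i p t := by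
  unfold ever matI; simp
/-- payment used by level `i` -/
noncomputable def dterm (i p t : ℕ) : ℝ := (if ever E P₀ P₁ (i+1) p t then 1 else 0) + (if ever E P₀ P₁ i p t ∧ ¬ matI E P₀ P₁ i p t then 1 else 0)
noncomputable def DD (i n t : ℕ) : ℝ := ∑ p ∈ Finset.range t, if 4 ^ n ≤ (E.str p).length then E.wt p * dterm E P₀ P₁ i p t else 0
theorem dterm_nonneg (i p t : ℕ) : 0 ≤ dterm E P₀ P₁ i p t := by unfold dterm; positivity
theorem dterm_le (i p t : ℕ) : dterm E P₀ P₁ i p t ≤ 2 := by unfold dterm; split_ifs <;> norm_num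
theorem dterm_zero {i p t : ℕ} (h : t ≤ p) : dterm E P₀ P₁ i p t = 0 := by
  unfold dterm
  rw [if_neg (fun hc => by have := ever_lt E P₀ P₁ hc; omega), if_neg (fun hc => by have := ever_lt E P₀ P₁ hc.1; omega)]; norm_num
theorem dterm_mono {i p s t : ℕ} (h : s ≤ t) : dterm E P₀ P₁ i p s ≤ dterm E P₀ P₁ i p t := by
  have h1 : (if ever E P₀ P₁ (i+1) p s then (1:ℝ) else 0) ≤ if ever E P₀ P₁ (i+1) p t then 1 else 0 := by
    by_cases hc : ever E P₀ P₁ (i+1) p s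
    · rw [if_pos hc, if_pos (ever_mono _ _ _ h hc)]
    · rw [if_neg hc]; positivity
  have h2 : (if ever E P₀ P₁ i p s ∧ ¬ matI E P₀ P₁ i p s then (1:ℝ) else 0) ≤ if ever E P₀ P₁ i p t ∧ ¬ matI E P₀ P₁ i p t then 1 else 0 := by
    by_cases hc : ever E P₀ P₁ i p s ∧ ¬ matI E P₀ P₁ i p s
    · have : ¬ matI E P₀ P₁ i p t := fun hm => by
        obtain ⟨u, hu, hmu⟩ := hc.1
        exact hc.2 (matI_interval E P₀ P₁ hmu hu h hm)
      rw [if_pos hc, if_pos ⟨ever_mono _ _ _ h hc.1, this⟩]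
    · rw [if_neg hc]; positivity
  unfold dterm; linarith
theorem DD_eq {i n t N : ℕ} (h : t ≤ N) : DD E P₀ P₁ i n t = ∑ p ∈ Finset.range N, if 4 ^ n ≤ (E.str p).length then E.wt p * dterm E P₀ P₁ i p t else 0 := by
  unfold DD
  refine Finset.sum_subset (by simpa using h) fun p _ hp => ?_
  simp only [Finset.mem_range] at hp
  rw [dterm_zero E P₀ P₁ (by omega)]; simp
theorem DD_nonneg (i n t : ℕ) : 0 ≤ DD E P₀ P₁ i n t :=
  Finset.sum_nonneg fun p _ => by
    split_ifs; exacts [mul_nonneg (E.wt_nonneg p) (dterm_nonneg _ _ _ _ _ _), le_rfl]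
theorem DD_le (i n t : ℕ) : DD E P₀ P₁ i n t ≤ 2 := by
  have : DD E P₀ P₁ i n t ≤ ∑ p ∈ Finset.range t, E.wt p * 2 := Finset.sum_le_sum fun p _ => by
    have h1 := E.wt_nonneg p; have h2 := dterm_le E P₀ P₁ i p t
    split_ifs
    · exact mul_le_mul_of_nonneg_left h2 h1
    · linarith
  rw [← Finset.sum_mul] at this
  have h2 := E.kraft t
  have h3 : ∑ p ∈ Finset.range t, E.wt p ≤ 1 := h2
  linarith
theorem DD_mono {i n s t : ℕ} (h : s ≤ t) : DD E P₀ P₁ i n s ≤ DD E P₀ P₁ i n t := by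
  rw [DD_eq E P₀ P₁ h]
  refine Finset.sum_le_sum fun p _ => ?_
  split_ifs
  · exact mul_le_mul_of_nonneg_left (dterm_mono E P₀ P₁ h) (E.wt_nonneg p)
  · exact le_rfl
theorem DD_super {i n b t : ℕ} (hn : n ≤ b) (h : b ≤ t) : DD E P₀ P₁ i n b + DD E P₀ P₁ i b t ≤ DD E P₀ P₁ i n t := by
  rw [DD_eq E P₀ P₁ h, DD, DD, ← Finset.sum_add_distrib]
  refine Finset.sum_le_sum fun p _ => ?_
  have h4 : 4 ^ n ≤ 4 ^ b := Nat.pow_le_pow_right (by norm_num) hn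
  have hw := E.wt_nonneg p
  by_cases hb : 4 ^ b ≤ (E.str p).length
  · have h5 : b < 4 ^ b := Nat.lt_pow_self (by norm_num)
    by_cases hok : E.ok p
    swap
    · have : E.wt p = 0 := by simp [UEnum.wt, rw_, hok]
      simp [this]
    have h6 := E.str_le p hok
    rw [if_pos hb, if_pos (h4.trans hb), dterm_zero E P₀ P₁ (t := b) (by omega), if_pos (h4.trans hb)]; simp
  · rw [if_neg hb, add_zero]
    split_ifs
    · exact mul_le_mul_of_nonneg_left (dterm_mono E P₀ P₁ h) hw
    · exact le_rfl
theorem DD_step (i n t : ℕ) : DD E P₀ P₁ i n t = DD E P₀ P₁ (i+1) n t + alI E P₀ P₁ (i+1) n t - alI E P₀ P₁ i n t := by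
  rw [alI_eq E P₀ P₁ le_rfl, alI_eq E P₀ P₁ le_rfl, DD, DD, ← Finset.sum_add_distrib, ← Finset.sum_sub_distrib]
  refine Finset.sum_congr rfl fun p _ => ?_
  by_cases hn : 4 ^ n ≤ (E.str p).length
  · simp only [hn, if_true, and_true]
    unfold dterm
    simp only [show i + 1 + 1 = i + 2 from rfl, ever_add_two]
    have h1 := ever_of E P₀ P₁ (i := i) (p := p) (t := t)
    have h2 := ever_of E P₀ P₁ (i := i+1) (p := p) (t := t)
    by_cases a : matI E P₀ P₁ i p t <;> by_cases b : matI E P₀ P₁ (i+1) p t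
    · simp [a, b, h1 a, h2 b]
    · simp only [a, b, h1 a, if_true, if_false, not_true, not_false_iff, and_true, and_false]; ring
    · simp only [a, b, h2 b, if_true, if_false, not_true, not_false_iff, and_true, and_false]; ring
    · simp only [a, b, if_true, if_false, not_true, not_false_iff, and_true, and_false]; ring
  · simp [hn]

/-! ### mass lemmas -/
variable (e : ℕ → Ent)
theorem we_nonneg (r) : 0 ≤ we e r := pw_nonneg _
theorem ms_nonneg (n t) : 0 ≤ ms e n t := Finset.sum_nonneg fun r _ => by split_ifs; exacts [we_nonneg e r, le_rfl]
theorem ms_self {n t : ℕ} (h : t ≤ n) : ms e n t = 0 := Finset.sum_eq_zero fun r hr => by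
  simp only [Finset.mem_range] at hr; rw [if_neg (by omega)]
theorem ms_succ {n t : ℕ} (h : n ≤ t) : ms e n (t+1) = ms e n t + we e t := by
  unfold ms; rw [Finset.sum_range_succ, if_pos h]
theorem ms_split {n b t : ℕ} (h1 : n ≤ b) (h2 : b ≤ t) : ms e n t = ms e n b + ms e b t := by
  induction t, h2 using Nat.le_induction with
  | base => rw [ms_self e le_rfl, add_zero]
  | succ t h ih => rw [ms_succ e (h1.trans h), ms_succ e h, ih]; ring
theorem ms_mono (n : ℕ) {s t : ℕ} (h : s ≤ t) : ms e n s ≤ ms e n t :=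
  Finset.sum_le_sum_of_subset_of_nonneg (by simpa using h) fun r _ _ => by split_ifs; exacts [we_nonneg e r, le_rfl]
theorem ms_anti {m n : ℕ} (t : ℕ) (h : m ≤ n) : ms e n t ≤ ms e m t := by
  refine Finset.sum_le_sum fun r _ => ?_
  have := we_nonneg e r
  split_ifs <;> first | exact le_rfl | omega
theorem ms_zero (t : ℕ) : ms e 0 t = ∑ r ∈ Finset.range t, we e r := by simp [ms]

theorem br_lt {i t : ℕ} (h : ∃ b < t, lev e b ≤ i) : br e i t < t ∧ lev e (br e i t) ≤ i ∧ ∀ b, br e i t < b → b < t → i < lev e b := by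
  obtain ⟨b, hb, hl⟩ := h
  unfold br
  rcases mu_spec t (fun k => lev e (t - 1 - k) ≤ i) with h1 | h1
  · refine ⟨by omega, h1.2.1, fun b' h2 h3 => ?_⟩
    have := h1.2.2 (t - 1 - b') (by omega)
    rw [show t - 1 - (t - 1 - b') = b' by omega] at this
    omega
  · have := h1.2 (t-1-b) (by omega)
    rw [show t - 1 - (t - 1 - b) = b by omega] at this
    exact absurd hl this
theorem br_none {i t : ℕ} (h : ¬ ∃ b < t, lev e b ≤ i) : br e i t = 0 := by
  unfold br
  rcases mu_spec t (fun k => lev e (t - 1 - k) ≤ i) with h1 | h1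
  · exact absurd ⟨t - 1 - _, by omega, h1.2.1⟩ h
  · omega
theorem br_le (i t : ℕ) : br e i t ≤ t := by unfold br; omega
theorem le_br {i b t : ℕ} (hb : b < t) (h : lev e b ≤ i) : b ≤ br e i t := by
  by_contra hc
  have := (br_lt e ⟨b, hb, h⟩).2.2 b (by omega) hb
  omega
theorem br_succ_of_le {i t : ℕ} (h : lev e t ≤ i) : br e i (t+1) = t := by
  have h1 := le_br e (Nat.lt_add_one t) h
  have h2 := (br_lt e ⟨t, Nat.lt_add_one t, h⟩).1
  omega
theorem br_succ_of_gt {i t : ℕ} (h : i < lev e t) : br e i (t+1) = br e i t := by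
  by_cases hx : ∃ b < t, lev e b ≤ i
  · obtain ⟨h1, h2, h3⟩ := br_lt e hx
    have h4 := le_br e (lt_trans h1 (Nat.lt_add_one t)) h2
    obtain ⟨h5, h6, h7⟩ := br_lt e (i := i) (t := t+1) ⟨_, lt_trans h1 (Nat.lt_add_one t), h2⟩
    rcases Nat.lt_succ_iff_lt_or_eq.1 h5 with h8 | h8
    · have := le_br e h8 h6; omega
    · rw [h8] at h6; omega
  · rw [br_none e hx, br_none]
    rintro ⟨b, hb, hl⟩
    rcases Nat.lt_succ_iff_lt_or_eq.1 hb with h8 | h8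
    · exact hx ⟨b, h8, hl⟩
    · subst h8; omega
theorem pads_le (i T : ℕ) : ∑ t ∈ Finset.range T, (if lev e t = i then ms e (br e i t) t else 0) ≤ ms e 0 (br e i T) := by
  induction T with
  | zero => simpa using ms_nonneg e 0 _
  | succ t ih =>
    rw [Finset.sum_range_succ]
    rcases lt_trichotomy (lev e t) i with h | h | h
    · rw [if_neg (by omega), add_zero, br_succ_of_le e (by omega)]
      exact ih.trans (ms_mono e 0 (br_le e i t))
    · rw [if_pos h, br_succ_of_le e (by omega), ms_split e (Nat.zero_le _) (br_le e i t)]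
      linarith
    · rw [if_neg (by omega), add_zero, br_succ_of_gt e h]; exact ih
end

section
variable {U : Str →. Str} (E : UEnum U) {A₀ A₁ : ℕ → Bool} (P₀ : Apx A₀) (P₁ : Apx A₁)
structure TProc (q : ℕ) where
  ent : ℕ → Ent
  cent : Computable ent
  spec : ∀ t, ent t = stepT E P₀ P₁ q ent t
variable {E P₀ P₁} {q : ℕ} (X : TProc E P₀ P₁ q)
namespace TProc
theorem gd_iff (t) : gd X.ent t ↔ goodP E P₀ P₁ q X.ent t := by
  unfold gd; rw [X.spec t]; unfold stepT; split_ifs with h <;> simp [h]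
theorem ent_gd {t} (h : gd X.ent t) : X.ent t = (rndc (target E P₀ P₁ q X.ent t), i0 E P₀ P₁ q X.ent t, true) := by
  conv_lhs => rw [X.spec t]
  unfold stepT; rw [if_pos ((X.gd_iff t).1 h)]
theorem ent_ngd {t} (h : ¬ gd X.ent t) : X.ent t = (0, LL q, false) := by
  conv_lhs => rw [X.spec t]
  unfold stepT; rw [if_neg (fun hc => h ((X.gd_iff t).2 hc))]
theorem lev_gd {t} (h : gd X.ent t) : lev X.ent t = i0 E P₀ P₁ q X.ent t := by unfold lev; rw [X.ent_gd h]
theorem lev_ngd {t} (h : ¬ gd X.ent t) : lev X.ent t = LL q := by unfold lev; rw [X.ent_ngd h]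
theorem we_ngd {t} (h : ¬ gd X.ent t) : we X.ent t = 0 := by unfold we; rw [X.ent_ngd h]; simp [pw]
theorem we_gd {t} (h : gd X.ent t) : we X.ent t = pw (rndc (target E P₀ P₁ q X.ent t)) := by unfold we; rw [X.ent_gd h]
theorem lev_le (t) : lev X.ent t ≤ LL q := by
  by_cases h : gd X.ent t
  · rw [X.lev_gd h]; exact mu_le _ _
  · rw [X.lev_ngd h]
theorem bd_gd {t} (h : lev X.ent t < LL q) : gd X.ent t := by
  by_contra hc; rw [X.lev_ngd hc] at h; omega
theorem bd_spec {t b : ℕ} (h : lev X.ent t < LL q) (hb : inC X.ent (lev X.ent t) b t) : ms X.ent b t ≤ (LL q : ℕ) * alI E P₀ P₁ (lev X.ent t) b t := by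
  have hl := X.lev_gd (X.bd_gd h)
  rcases mu_spec (LL q) (fun i => ¬ bEx t (fun b => inC X.ent i b t ∧ bad E P₀ P₁ q X.ent i b t)) with h1 | h1
  · by_contra hc
    push Not at hc
    refine h1.2.1 ⟨b, hb.1, ?_, ?_⟩
    · unfold i0 at hl; rw [← hl]; exact hb
    · unfold i0 at hl; rw [← hl]; exact hc
  · unfold i0 at hl; omega
def valid (t : ℕ) : Prop := gd X.ent t ∧ lev X.ent t = LL q
theorem val_spec {t i : ℕ} (h : X.valid t) (hi : i < LL q) : ∃ b, inC X.ent i b t ∧ bad E P₀ P₁ q X.ent i b t := by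
  have hl := X.lev_gd h.1
  rw [h.2] at hl
  rcases mu_spec (LL q) (fun i => ¬ bEx t (fun b => inC X.ent i b t ∧ bad E P₀ P₁ q X.ent i b t)) with h1 | h1
  · unfold i0 at hl; omega
  · have := h1.2 i hi
    push Not at this
    obtain ⟨b, _, hb⟩ := this
    exact ⟨b, hb⟩
theorem good_spec {t n : ℕ} (h : gd X.ent t) (hn : n < t) : ms X.ent n t ≤ 4 ^ q * (al E P₀ n t + al E P₁ n t) :=
  (X.gd_iff t).1 h n hn
noncomputable def ph (t : ℕ) : ℝ := (1/2:ℝ) ^ (2*q+4 + Nb q X.ent t)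
theorem ph_pos (t) : 0 < X.ph t := by unfold ph; positivity
theorem ph_le (t) : X.ph t ≤ 1/16 := by
  unfold ph
  calc (1/2:ℝ) ^ (2*q+4 + Nb q X.ent t) ≤ (1/2) ^ 4 := pow_le_pow_of_le_one (by norm_num) (by norm_num) (by omega)
    _ = _ := by norm_num
theorem target_valid {t} (h : X.valid t) : target E P₀ P₁ q X.ent t = E.wt (gct X.ent t) + X.ph t := by
  unfold target ph
  rw [← X.lev_gd h.1, h.2, if_neg (lt_irrefl _)]
theorem target_bd {t} (h : lev X.ent t < LL q) : target E P₀ P₁ q X.ent t = E.wt (gct X.ent t) + (1/2:ℝ) ^ (2*q+4) * ms X.ent (br X.ent (lev X.ent t) t) t := by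
  unfold target
  rw [← X.lev_gd (X.bd_gd h), if_pos h]
end TProc
theorem UEnum.wt_le_one (E : UEnum U) (p : ℕ) : E.wt p ≤ 1 := by
  unfold UEnum.wt rw_; split_ifs
  · exact pow_le_one₀ (by norm_num) (by norm_num)
  · norm_num
namespace TProc
theorem target_nonneg (t) : 0 ≤ target E P₀ P₁ q X.ent t := by
  unfold target
  have := E.wt_nonneg (gct X.ent t)
  have h2 := ms_nonneg X.ent (br X.ent (i0 E P₀ P₁ q X.ent t) t) t
  split_ifs <;> positivity
theorem ph_le_we {t} (h : X.valid t) : X.ph t ≤ 2 * we X.ent t := by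
  rw [X.we_gd h.1]
  have h1 := le_pw_rnd (X.target_nonneg t) (by rw [X.target_valid h]; have := X.ph_le t; have := E.wt_le_one (gct X.ent t); linarith)
  refine le_trans ?_ h1
  rw [X.target_valid h]; have := E.wt_nonneg (gct X.ent t); linarith
def succ' (t r : ℕ) : Prop := X.valid r ∧ ∃ s, r < s ∧ s ≤ t ∧ X.valid s ∧ ∀ b, r < b → b < s → ¬ lev X.ent b < LL q
noncomputable def F (n t : ℕ) : ℝ := ∑ r ∈ Finset.range t, if n ≤ r ∧ X.succ' t r then X.ph r else 0
theorem succ_lt {t r} (h : X.succ' t r) : r < t := by obtain ⟨_, s, h1, h2, _⟩ := h; omega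
theorem F_eq {n t N : ℕ} (h : t ≤ N) : X.F n t = ∑ r ∈ Finset.range N, if n ≤ r ∧ X.succ' t r then X.ph r else 0 := by
  refine Finset.sum_subset (by simpa using h) fun p _ hp => ?_
  rw [if_neg]; rintro ⟨_, hs⟩; exact hp (by simpa using X.succ_lt hs)
theorem F_le_ms (n t : ℕ) : X.F n t ≤ 2 * ms X.ent n t := by
  unfold F ms; rw [Finset.mul_sum]
  refine Finset.sum_le_sum fun r _ => ?_
  have := we_nonneg X.ent r
  by_cases h : n ≤ r ∧ X.succ' t r
  · rw [if_pos h, if_pos h.1]; exact X.ph_le_we h.2.1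
  · rw [if_neg h]; split_ifs <;> linarith
theorem claim (k : ℕ) (hk : k ≤ LL q) : ∀ t n, (n = 0 ∨ lev X.ent n < LL q - k) → k * X.F n t ≤ 4 * 4 ^ q * DD E P₀ P₁ (LL q - k) n t := by
  induction k with
  | zero => intro t n _; have := DD_nonneg E P₀ P₁ (LL q - 0) n t; push_cast; rw [zero_mul]; positivity
  | succ k ihk =>
    intro t
    induction t using Nat.strong_induction_on with
    | _ t iht =>
    intro n hn
    have hDn := DD_nonneg E P₀ P₁ (LL q - (k+1)) n t
    by_cases hv : ∃ s, (n < s ∧ s ≤ t) ∧ X.valid s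
    swap
    · have : X.F n t = 0 := Finset.sum_eq_zero fun r _ => by
        rw [if_neg]; rintro ⟨h1, _, s, h2, h3, h4, _⟩; exact hv ⟨s, ⟨by omega, h3⟩, h4⟩
      rw [this, mul_zero]; positivity
    -- last valid stage
    obtain ⟨s, ⟨⟨hns, hst⟩, hs⟩, hlast⟩ : ∃ s, ((n < s ∧ s ≤ t) ∧ X.valid s) ∧ ∀ s', ((n < s' ∧ s' ≤ t) ∧ X.valid s') → s' ≤ s := by
      have hb : ∀ s, ((n < s ∧ s ≤ t) ∧ X.valid s) → s ≤ t := fun s h => h.1.2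
      obtain ⟨s0, hs0⟩ := hv
      exact ⟨Nat.findGreatest (fun s => (n < s ∧ s ≤ t) ∧ X.valid s) t, Nat.findGreatest_spec (P := fun s => (n < s ∧ s ≤ t) ∧ X.valid s) (hb _ hs0) hs0,
        fun s' h => Nat.le_findGreatest (hb _ h) h⟩
    set i := LL q - (k+1) with hi
    have hi1 : LL q - k = i + 1 := by omega
    obtain ⟨b, hb, hbad⟩ := X.val_spec hs (i := i) (by omega)
    have hnb : n ≤ b := by
      rcases hn with rfl | hn
      · omega
      · by_contra hc
        have := hb.2.2 n hns
        rcases this with h | h <;> omega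
    have h1 := ihk (by omega) s b (Or.inr (by rw [hi1]; have := hb.2.1; omega))
    rw [hi1] at h1
    have h2 := DD_step E P₀ P₁ i b s
    have h3 := X.good_spec hs.1 hb.1
    rw [← alI_add E P₀ P₁ i] at h3
    have h4 : (LL q : ℝ) * alI E P₀ P₁ i b s < ms X.ent b s := hbad
    have h5 := X.F_le_ms b s
    have h6 := iht b (lt_of_lt_of_le hb.1 hst) n hn
    have h7 := DD_super E P₀ P₁ (i := i) hnb hb.1.le
    have h8 := DD_mono E P₀ P₁ (i := i) (n := n) hst
    have h9 : X.F n t ≤ X.F n b + X.F b s := by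
      rw [X.F_eq (hb.1.le.trans hst), X.F_eq hst, F, ← Finset.sum_add_distrib]
      refine Finset.sum_le_sum fun r _ => ?_
      have hp := (X.ph_pos r).le
      by_cases h : n ≤ r ∧ X.succ' t r
      · rw [if_pos h]
        obtain ⟨h10, hvr, s', h11, h12, h13, h14⟩ := h
        have h15 := hlast s' ⟨⟨by omega, h12⟩, h13⟩
        by_cases hrb : b ≤ r
        · rw [if_pos (c := b ≤ r ∧ X.succ' s r) ⟨hrb, hvr, s', h11, h15, h13, h14⟩]
          split_ifs <;> linarith
        · have h16 : s' ≤ b := by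
            by_contra hc
            exact h14 b (by omega) (by omega) (by have := hb.2.1; omega)
          rw [if_pos (c := n ≤ r ∧ X.succ' b r) ⟨h10, hvr, s', h11, h16, h13, h14⟩]
          split_ifs <;> linarith
      · rw [if_neg h]; split_ifs <;> linarith
    have hL : (LL q : ℝ) = 4 * 4 ^ q := by unfold LL; push_cast; ring
    rw [hL] at h4
    have h4q : (0:ℝ) < 4 ^ q := by positivity
    push_cast at h6 ⊢
    have hk0 : (0:ℝ) ≤ k + 1 := by positivity
    have h10 : (k + 1 : ℝ) * X.F b s ≤ 4 * 4 ^ q * DD E P₀ P₁ i b s := by rw [h2]; nlinarith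
    calc (k + 1 : ℝ) * X.F n t ≤ (k + 1 : ℝ) * (X.F n b + X.F b s) := by gcongr
      _ ≤ 4 * 4 ^ q * (DD E P₀ P₁ i n b + DD E P₀ P₁ i b s) := by linarith
      _ ≤ 4 * 4 ^ q * DD E P₀ P₁ i n t := by gcongr; linarith
theorem F_le_two (t : ℕ) : X.F 0 t ≤ 2 := by
  have h := X.claim (LL q) le_rfl t 0 (Or.inl rfl)
  have h2 := DD_le E P₀ P₁ (LL q - LL q) 0 t
  have hL : (LL q : ℝ) = 4 * 4 ^ q := by unfold LL; push_cast; ring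
  rw [hL] at h
  have h4q : (0:ℝ) < 4 * 4 ^ q := by positivity
  exact (le_of_mul_le_mul_left h h4q).trans h2
theorem sum_beta (T : ℕ) : ∑ t ∈ Finset.range T, (if gd X.ent t then E.wt (gct X.ent t) else 0) = ∑ p ∈ Finset.range (gct X.ent T), E.wt p := by
  induction T with
  | zero => simp [gct]
  | succ T ih =>
    rw [Finset.sum_range_succ, ih]
    have : gct X.ent (T+1) = gct X.ent T + if gd X.ent T then 1 else 0 := by unfold gct; rw [Finset.sum_range_succ]
    rw [this]
    split_ifs
    · rw [Finset.sum_range_succ]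
    · simp
theorem Nb_succ (t : ℕ) : Nb q X.ent (t+1) = Nb q X.ent t + if lev X.ent t < LL q then 1 else 0 := by unfold Nb; rw [Finset.sum_range_succ]
theorem Nb_mono {s t : ℕ} (h : s ≤ t) : Nb q X.ent s ≤ Nb q X.ent t := Finset.sum_le_sum_of_subset (by simpa using h)
theorem Nb_lt {r b t : ℕ} (h1 : r ≤ b) (h2 : b < t) (hb : lev X.ent b < LL q) : Nb q X.ent r < Nb q X.ent t := by
  have h3 := X.Nb_mono h1
  have h4 := X.Nb_mono (Nat.succ_le_of_lt h2)
  have h5 := X.Nb_succ b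
  rw [if_pos hb] at h5
  simp only [Nat.succ_eq_add_one] at h4
  omega
theorem sum_fail (T : ℕ) : ∑ r ∈ Finset.range T, (if X.valid r ∧ ¬ X.succ' T r then X.ph r else 0) ≤ 1/8 := by
  rw [← Finset.sum_filter]
  have e1 : ∑ r ∈ (Finset.range T).filter (fun r => X.valid r ∧ ¬ X.succ' T r), X.ph r = ∑ x ∈ ((Finset.range T).filter (fun r => X.valid r ∧ ¬ X.succ' T r)).image (Nb q X.ent), (1/2:ℝ) ^ (2*q+4 + x) := by
    rw [Finset.sum_image]
    · rfl
    have key : ∀ a b, a < b → b < T → X.valid a → ¬ X.succ' T a → X.valid b → Nb q X.ent a ≠ Nb q X.ent b := by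
      intro a b hab hbT hva hsa hvb
      by_contra hc
      apply hsa
      refine ⟨hva, b, hab, hbT.le, hvb, fun c h1 h2 h3 => ?_⟩
      have := X.Nb_lt h1.le h2 h3
      omega
    intro a ha b hb hab
    simp only [Finset.coe_filter, Finset.mem_range, Set.mem_ofPred_eq] at ha hb
    rcases lt_trichotomy a b with h | h | h
    · exact absurd hab (key a b h hb.1 ha.2.1 ha.2.2 hb.2.1)
    · exact h
    · exact absurd hab.symm (key b a h ha.1 hb.2.1 hb.2.2 ha.2.1)
  rw [e1]
  set S := ((Finset.range T).filter (fun r => X.valid r ∧ ¬ X.succ' T r)).image (Nb q X.ent)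
  obtain ⟨n, hn⟩ : ∃ n, S ⊆ Finset.range n := ⟨S.sup id + 1, fun x hx => by
    simp only [Finset.mem_range]; exact Nat.lt_succ_of_le (Finset.le_sup (f := id) hx)⟩
  refine (Finset.sum_le_sum_of_subset_of_nonneg hn (fun i _ _ => by positivity)).trans ?_
  have : ∀ x ∈ Finset.range n, (1/2:ℝ) ^ (2*q+4 + x) ≤ 1/8 * (1/2) ^ (x+1) := by
    intro x _
    calc (1/2:ℝ) ^ (2*q+4 + x) ≤ (1/2) ^ (3 + (x+1)) := pow_le_pow_of_le_one (by norm_num) (by norm_num) (by omega)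
      _ = _ := by rw [pow_add]; norm_num
  refine (Finset.sum_le_sum this).trans ?_
  rw [← Finset.mul_sum]
  have := sum_half_le n
  linarith
theorem we_le (t : ℕ) : we X.ent t ≤ (if gd X.ent t then E.wt (gct X.ent t) else 0) +
    (∑ i ∈ Finset.range (LL q), (1/2:ℝ) ^ (2*q+4) * if lev X.ent t = i then ms X.ent (br X.ent i t) t else 0) + (if X.valid t then X.ph t else 0) := by
  have hpad : 0 ≤ ∑ i ∈ Finset.range (LL q), (1/2:ℝ) ^ (2*q+4) * if lev X.ent t = i then ms X.ent (br X.ent i t) t else 0 :=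
    Finset.sum_nonneg fun i _ => by have := ms_nonneg X.ent (br X.ent i t) t; positivity
  by_cases h : gd X.ent t
  · rw [if_pos h]
    have h1 : we X.ent t ≤ target E P₀ P₁ q X.ent t := by rw [X.we_gd h]; exact pw_rnd_le (X.target_nonneg t)
    refine h1.trans ?_
    by_cases hl : lev X.ent t < LL q
    · rw [X.target_bd hl, if_neg (c := X.valid t) (fun hc => by have := hc.2; omega), add_zero]
      rw [← Finset.mul_sum, Finset.sum_ite_eq, if_pos (by simpa using hl)]
    · have hv : X.valid t := ⟨h, by have := X.lev_le t; omega⟩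
      rw [X.target_valid hv, if_pos hv]; linarith
  · rw [if_neg h, if_neg (c := X.valid t) (fun hc => h hc.1), X.we_ngd h]; linarith
theorem ms_le_five (T : ℕ) : ms X.ent 0 T ≤ 5 := by
  have h0 := Finset.sum_le_sum (s := Finset.range T) fun t _ => X.we_le t
  rw [← ms_zero, Finset.sum_add_distrib, Finset.sum_add_distrib, X.sum_beta, Finset.sum_comm] at h0
  have h1 : ∑ p ∈ Finset.range (gct X.ent T), E.wt p ≤ 1 := E.kraft _
  have h2 : ∑ i ∈ Finset.range (LL q), ∑ t ∈ Finset.range T, ((1/2:ℝ) ^ (2*q+4) * if lev X.ent t = i then ms X.ent (br X.ent i t) t else 0) ≤ ms X.ent 0 T / 4 := by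
    have : ∀ i ∈ Finset.range (LL q), ∑ t ∈ Finset.range T, ((1/2:ℝ) ^ (2*q+4) * if lev X.ent t = i then ms X.ent (br X.ent i t) t else 0) ≤ (1/2:ℝ) ^ (2*q+4) * ms X.ent 0 T := by
      intro i _
      rw [← Finset.mul_sum]
      gcongr
      exact (pads_le X.ent i T).trans (ms_mono _ _ (br_le _ _ _))
    refine (Finset.sum_le_sum this).trans ?_
    rw [Finset.sum_const, Finset.card_range, nsmul_eq_mul]
    have : (LL q : ℝ) * ((1/2:ℝ) ^ (2*q+4) * ms X.ent 0 T) = ((4 * (1/2)^2) ^ q) * ms X.ent 0 T / 4 := by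
      unfold LL; push_cast; rw [mul_pow, ← pow_mul, pow_add]; ring
    rw [this]; norm_num
  have h3 : ∑ t ∈ Finset.range T, (if X.valid t then X.ph t else 0) ≤ X.F 0 T + ∑ r ∈ Finset.range T, (if X.valid r ∧ ¬ X.succ' T r then X.ph r else 0) := by
    unfold F; rw [← Finset.sum_add_distrib]
    refine Finset.sum_le_sum fun r _ => ?_
    have hp := (X.ph_pos r).le
    by_cases hv : X.valid r
    · by_cases hs : X.succ' T r
      · simp [hv, hs]
      · simp [hv, hs]
    · rw [if_neg hv]; split_ifs <;> linarith
  have h4 := X.F_le_two T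
  have h5 := X.sum_fail T
  linarith
end TProc
end

section
variable {U : Str →. Str} {E : UEnum U} {A₀ A₁ : ℕ → Bool} {P₀ : Apx A₀} {P₁ : Apx A₁}
theorem UEnum.sum_uniq (E : UEnum U) {R : ℕ → ℕ → Prop} (h : ∀ p t t', R t p → R t' p → t = t') (n m : ℕ) :
    ∑ t ∈ Finset.range n, ∑ p ∈ Finset.range m, (if R t p then E.wt p else 0) ≤ 1 := by
  rw [Finset.sum_comm]
  refine le_trans (Finset.sum_le_sum (g := fun p => E.wt p) fun p _ => ?_) (E.kraft m)
  by_cases hx : ∃ t, R t p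
  · obtain ⟨t, ht⟩ := hx
    have : ∀ t' ∈ Finset.range n, (if R t' p then E.wt p else 0) ≤ if t' = t then E.wt p else 0 := by
      intro t' _
      by_cases h2 : R t' p
      · rw [if_pos h2, if_pos (h p _ _ h2 ht)]
      · rw [if_neg h2]; split_ifs; exacts [E.wt_nonneg p, le_rfl]
    refine (Finset.sum_le_sum this).trans ?_
    rw [Finset.sum_ite_eq']; split_ifs; exacts [le_rfl, E.wt_nonneg p]
  · push Not at hx
    rw [Finset.sum_eq_zero fun t _ => by rw [if_neg (hx t)]]
    exact E.wt_nonneg p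
namespace TProc
variable {q : ℕ} (X : TProc E P₀ P₁ q)
theorem gct_succ (t : ℕ) : gct X.ent (t+1) = gct X.ent t + if gd X.ent t then 1 else 0 := by unfold gct; rw [Finset.sum_range_succ]
theorem gct_mono {s t : ℕ} (h : s ≤ t) : gct X.ent s ≤ gct X.ent t := Finset.sum_le_sum_of_subset (by simpa using h)
theorem gct_le (t : ℕ) : gct X.ent t ≤ t := by
  induction t with
  | zero => simp [gct]
  | succ t ih => rw [X.gct_succ]; split_ifs <;> omega
theorem ms_le5 (n t : ℕ) : ms X.ent n t ≤ 5 := (ms_anti _ _ (Nat.zero_le n)).trans (X.ms_le_five t)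
theorem target_lt (t) : target E P₀ P₁ q X.ent t < 2 := by
  unfold target
  have h1 := E.wt_le_one (gct X.ent t)
  have h2 := X.ms_le5 (br X.ent (i0 E P₀ P₁ q X.ent t) t) t
  have h2' := ms_nonneg X.ent (br X.ent (i0 E P₀ P₁ q X.ent t) t) t
  have h3 : (1/2:ℝ) ^ (2*q+4) ≤ 1/16 := by
    calc (1/2:ℝ) ^ (2*q+4) ≤ (1/2) ^ 4 := pow_le_pow_of_le_one (by norm_num) (by norm_num) (by omega)
      _ = _ := by norm_num
  have h4 := X.ph_le t
  unfold ph at h4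
  have h5 : (1/2:ℝ) ^ (2*q+4) * ms X.ent (br X.ent (i0 E P₀ P₁ q X.ent t) t) t ≤ 1/16 * 5 := by gcongr
  split_ifs <;> linarith
theorem target_le_we {t} (h : gd X.ent t) : target E P₀ P₁ q X.ent t ≤ 2 * we X.ent t := by
  rw [X.we_gd h]; exact le_pw_rnd (X.target_nonneg t) (X.target_lt t)
theorem wt_le_we {t} (h : gd X.ent t) : E.wt (gct X.ent t) ≤ 2 * we X.ent t := by
  refine le_trans ?_ (X.target_le_we h)
  unfold target
  have h2' := ms_nonneg X.ent (br X.ent (i0 E P₀ P₁ q X.ent t) t) t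
  split_ifs
  · have : 0 ≤ (1/2:ℝ) ^ (2*q+4) * ms X.ent (br X.ent (i0 E P₀ P₁ q X.ent t) t) t := by positivity
    linarith
  · have : 0 ≤ (1/2:ℝ) ^ (2*q+4+ Nb q X.ent t) := by positivity
    linarith
theorem place {s0 s1 : ℕ} (h : s0 ≤ s1) : ∑ p ∈ Finset.Ico (gct X.ent s0) (gct X.ent s1), E.wt p ≤ 2 * ms X.ent s0 s1 := by
  induction s1, h using Nat.le_induction with
  | base => simp [ms_self X.ent le_rfl]
  | succ t h ih =>
    rw [ms_succ _ h, X.gct_succ]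
    have := we_nonneg X.ent t
    split_ifs with hg
    · rw [Finset.sum_Ico_succ_top (X.gct_mono h)]
      have := X.wt_le_we hg
      linarith
    · rw [add_zero]; linarith
section fin
variable {A : ℕ → Bool} (P : Apx A) {i T : ℕ}
def chg (P : Apx A) (i T : ℕ) (t p : ℕ) : Prop := (T < t ∧ lev X.ent t = i ∧ T < br X.ent i t) ∧ gct X.ent T ≤ p ∧ p < gct X.ent (br X.ent i (br X.ent i t)) ∧ E.ok p ∧
  E.str p = zeroStr (E.str p).length ∧ P.V (br X.ent i t) (E.str p).length ≠ P.V t (E.str p).length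
def abd (P : Apx A) (i T : ℕ) (t p : ℕ) : Prop := (T < t ∧ lev X.ent t = i) ∧ mat E P p (br X.ent i t) ∧ ¬ mat E P p t
def frs (i T : ℕ) (t p : ℕ) : Prop := (T < t ∧ lev X.ent t = i ∧ T < br X.ent i t) ∧ gct X.ent (br X.ent i (br X.ent i t)) ≤ p ∧ p < gct X.ent (br X.ent i t) ∧ E.ok p ∧ gct X.ent T ≤ p ∧
  E.str p = zeroStr (E.str p).length
theorem isb_br (hT : lev X.ent T = i) (hTi : ∀ t ≥ T, i ≤ lev X.ent t) {t : ℕ} (ht : T < t) : T ≤ br X.ent i t ∧ br X.ent i t < t ∧ lev X.ent (br X.ent i t) = i := by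
  have h1 := le_br X.ent ht hT.le
  have h2 := br_lt X.ent ⟨T, ht, hT.le⟩
  exact ⟨h1, h2.1, le_antisymm h2.2.1 (hTi _ h1)⟩
theorem chg_le (hi : i < LL q) (hT : lev X.ent T = i) (hTi : ∀ t ≥ T, i ≤ lev X.ent t) (hP : ∀ n t, alI E P₀ P₁ i n t = al E P n t) (t N : ℕ) :
    ∑ p ∈ Finset.range N, (if X.chg P i T t p then E.wt p else 0) ≤ (2 * (2 * 4 ^ (q+2) + 1) * 4 ^ (q+1)) * ∑ p ∈ Finset.range t, (if X.abd P i T t p then E.wt p else 0) := by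
  have hR : 0 ≤ (2 * (2 * 4 ^ (q+2) + 1) * 4 ^ (q+1) : ℝ) * ∑ p ∈ Finset.range t, (if X.abd P i T t p then E.wt p else 0) := by
    refine mul_nonneg (by positivity) (Finset.sum_nonneg fun p _ => ?_)
    split_ifs; exacts [E.wt_nonneg p, le_rfl]
  by_cases hx : ∃ p, X.chg P i T t p
  swap
  · push Not at hx
    rw [Finset.sum_eq_zero fun p _ => by rw [if_neg (hx p)]]
    exact hR
  have hpc := Nat.find_spec hx
  have hmin : ∀ p, X.chg P i T t p → Nat.find hx ≤ p := fun p hp => Nat.find_min' hx hp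
  set p0 := Nat.find hx
  obtain ⟨⟨hTt, hlt, hTb⟩, hp1, hp2, hok, hz, hV⟩ := hpc
  set b := br X.ent i t with hb
  obtain ⟨-, hbt, hlb⟩ := X.isb_br hT hTi hTt
  rw [← hb] at hbt hlb
  set b' := br X.ent i b with hb'
  obtain ⟨hTb', hbb, hlb'⟩ := X.isb_br hT hTi hTb
  rw [← hb'] at hTb' hbb hlb'
  -- the good stage with place p0
  obtain ⟨s0, hTs, hsb, hs1, hs2⟩ : ∃ s0, T ≤ s0 ∧ s0 < b' ∧ gct X.ent s0 = p0 ∧ gct X.ent (s0+1) = p0 + 1 := by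
    have hex : ∃ s, p0 < gct X.ent s := ⟨b', hp2⟩
    have h1 := Nat.find_spec hex
    have h2 : Nat.find hex ≤ b' := Nat.find_min' hex hp2
    have h3 : T < Nat.find hex := by
      by_contra hc; have := X.gct_mono (not_lt.1 hc); omega
    obtain ⟨s0, hs0⟩ := Nat.exists_eq_succ_of_ne_zero (n := Nat.find hex) (by omega)
    have h4 := Nat.find_min hex (m := s0) (by omega)
    rw [hs0] at h1
    have h5 := X.gct_succ s0
    simp only [Nat.succ_eq_add_one] at *
    refine ⟨s0, by omega, by omega, ?_, ?_⟩ <;> split_ifs at h5 <;> omega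
  obtain ⟨y, ⟨hsy, hly⟩, hymin⟩ : ∃ y, (s0 < y ∧ lev X.ent y = i) ∧ ∀ y', (s0 < y' ∧ lev X.ent y' = i) → y ≤ y' := by
    have hex : ∃ y, s0 < y ∧ lev X.ent y = i := ⟨b', hsb, hlb'⟩
    exact ⟨Nat.find hex, Nat.find_spec hex, fun y' h => Nat.find_min' hex h⟩
  have hyb := hymin b' ⟨hsb, hlb'⟩
  obtain ⟨hy1, hy2, hy3⟩ := X.isb_br hT hTi (t := y) (by omega)
  set y0 := br X.ent i y with hy0
  have hys : y0 ≤ s0 := by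
    by_contra hc
    have := hymin y0 ⟨by omega, hy3⟩
    omega
  have e1 : ∑ p ∈ Finset.range N, (if X.chg P i T t p then E.wt p else 0) ≤ ∑ p ∈ Finset.Ico (gct X.ent s0) (gct X.ent b'), E.wt p := by
    rw [← Finset.sum_filter]
    refine Finset.sum_le_sum_of_subset_of_nonneg ?_ fun p _ _ => E.wt_nonneg p
    intro p hp
    simp only [Finset.mem_filter, Finset.mem_Ico] at hp ⊢
    rw [hs1]
    exact ⟨hmin p hp.2, hp.2.2.2.1⟩
  have e2 := X.place hsb.le
  have e3 : ms X.ent s0 b' ≤ ms X.ent y0 b := (ms_anti _ _ hys).trans (ms_mono _ _ hbb.le)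
  have e4 := ms_split X.ent (n := y0) (b := y) (t := b) hy2.le (by omega)
  have hyl : lev X.ent y < LL q := by omega
  have e5 : (1/2:ℝ) ^ (2*q+4) * ms X.ent y0 y ≤ 2 * we X.ent y := by
    have h1 := X.target_le_we (X.bd_gd hyl)
    rw [X.target_bd hyl, hly, ← hy0] at h1
    have := E.wt_nonneg (gct X.ent y)
    linarith
  have e6 : we X.ent y ≤ ms X.ent y b := by
    have h1 := ms_succ X.ent (n := y) (t := y) le_rfl
    rw [ms_self _ le_rfl, zero_add] at h1
    rw [← h1]; exact ms_mono _ _ (by omega)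
  have e7 : ms X.ent y0 y ≤ 4 ^ (q+2) * (2 * ms X.ent y b) := by
    have h1 : (4:ℝ) ^ (q+2) * (1/2:ℝ) ^ (2*q+4) = 1 := by
      rw [show 2*q+4 = 2*(q+2) by ring, pow_mul, ← mul_pow]; norm_num
    calc ms X.ent y0 y = 4 ^ (q+2) * ((1/2:ℝ) ^ (2*q+4) * ms X.ent y0 y) := by rw [← mul_assoc, h1, one_mul]
      _ ≤ _ := mul_le_mul_of_nonneg_left (by linarith) (by positivity)
  have e8 : ms X.ent y b ≤ 4 ^ (q+1) * al E P y b := by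
    have h1 := X.bd_spec (t := b) (b := y) (by omega) ⟨by omega, by omega, fun z hz => by
      by_cases h : z ≤ y
      · exact Or.inl h
      · right; rw [hlb]; exact hTi z (by omega)⟩
    rw [hlb, hP] at h1
    unfold LL at h1; push_cast at h1; exact h1
  have e9 : al E P y b ≤ ∑ p ∈ Finset.range t, (if X.abd P i T t p then E.wt p else 0) := by
    rw [al_eq E P hbt.le]
    refine Finset.sum_le_sum fun p _ => ?_
    by_cases h : mat E P p b ∧ 4 ^ y ≤ (E.str p).length
    · rw [if_pos h, if_pos]
      refine ⟨⟨hTt, hlt⟩, h.1, fun hc => ?_⟩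
      have h1 := h.1.2.2; have h2 := hc.2.2
      refine P.ne_up (j := (E.str p).length) ?_ hV (by rw [← h1, ← h2])
      have h3 := E.str_le p0 hok
      have h4 := X.gct_le s0
      have h5 : y < 4 ^ y := Nat.lt_pow_self (by norm_num)
      omega
    · rw [if_neg h]; split_ifs; exacts [E.wt_nonneg p, le_rfl]
  calc _ ≤ 2 * ms X.ent y0 b := by linarith
    _ ≤ 2 * ((2 * 4 ^ (q+2) + 1) * ms X.ent y b) := by linarith
    _ ≤ 2 * ((2 * 4 ^ (q+2) + 1) * (4 ^ (q+1) * ∑ p ∈ Finset.range t, (if X.abd P i T t p then E.wt p else 0))) := by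
        gcongr; exact e8.trans (by gcongr)
    _ = _ := by ring
theorem abd_uniq (hT : lev X.ent T = i) (hTi : ∀ t ≥ T, i ≤ lev X.ent t) (p t t' : ℕ) (h : X.abd P i T t p) (h' : X.abd P i T t' p) : t = t' := by
  have key : ∀ t t', t < t' → X.abd P i T t p → X.abd P i T t' p → False := by
    intro t t' htt h h'
    have h1 := le_br X.ent htt h.1.2.le
    exact h.2.2 (mat_interval E P h.2.1 (br_le _ _ _) h1 h'.2.1)
  rcases lt_trichotomy t t' with hl | hl | hl
  exacts [(key _ _ hl h h').elim, hl, (key _ _ hl h' h).elim]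
theorem frs_uniq (hT : lev X.ent T = i) (hTi : ∀ t ≥ T, i ≤ lev X.ent t) (p t t' : ℕ) (h : X.frs i T t p) (h' : X.frs i T t' p) : t = t' := by
  have key : ∀ t t', t < t' → X.frs i T t p → X.frs i T t' p → False := by
    intro t t' htt h h'
    have h1 := le_br X.ent htt h.1.2.1.le
    obtain ⟨h2, h3, h4⟩ := X.isb_br hT hTi h.1.1
    have h5 := le_br X.ent (lt_of_lt_of_le h3 h1) h4.le
    have h6 := X.gct_mono h5
    have h7 := h.2.2.1; have h8 := h'.2.1
    omega
  rcases lt_trichotomy t t' with hl | hl | hl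
  exacts [(key _ _ hl h h').elim, hl, (key _ _ hl h' h).elim]
def okR (P : Apx A) (i T : ℕ) (t p : ℕ) : Prop := X.frs i T t p ∨ X.chg P i T t p
theorem cokR : CP (fun x : ℕ × ℕ => X.okR P i T x.1 x.2) := by
  have h1 := X.cent; have h2 := E.cok; have h3 := E.cstr; have h4 := P.cV
  have hbr : Computable (fun t => br X.ent i t) := by unfold br lev; fun_prop
  have hg : Computable (fun t => gct X.ent t) := by unfold gct gd; fun_prop
  unfold okR frs chg lev
  fun_prop
theorem ktriv (hU : OptimalPF U) (hi : i < LL q) (hT : lev X.ent T = i) (hTi : ∀ t ≥ T, i ≤ lev X.ent t) (hinf : ∀ n, ∃ t ≥ n, lev X.ent t = i)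
    (hP : ∀ n t, alI E P₀ P₁ i n t = al E P n t) : KTrivialSeq U A := by
  obtain ⟨K, hK⟩ : ∃ K : ℕ, (1 + 2 * (2 * 4 ^ (q+2) + 1) * 4 ^ (q+1) : ℝ) ≤ 2 ^ K := 
    (pow_unbounded_of_one_lt (1 + 2 * (2 * 4 ^ (q+2) + 1) * 4 ^ (q+1) : ℝ) (by norm_num : (1:ℝ) < 2)).imp fun _ h => h.le
  have h2 := E.clen; have h3 := E.cstr; have h4 := P.cV
  obtain ⟨c, hc⟩ := kc_pair hU (X.okR P i T) (X.cokR P) (fun _ p => E.len p + K) (by fun_prop)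
    (fun t p => strOf (P.V t (E.str p).length) (E.str p).length) (by fun_prop) (fun n => by
      have : ∀ t ∈ Finset.range n, ∑ p ∈ Finset.range n, (if X.okR P i T t p then (1/2:ℝ) ^ (E.len p + K) else 0) ≤
          (1/2) ^ K * (∑ p ∈ Finset.range n, (if X.frs i T t p then E.wt p else 0) + (2 * (2 * 4 ^ (q+2) + 1) * 4 ^ (q+1)) * ∑ p ∈ Finset.range n, (if X.abd P i T t p then E.wt p else 0)) := by
        intro t ht
        have h1 := X.chg_le P hi hT hTi hP t n
        have h2 : ∑ p ∈ Finset.range t, (if X.abd P i T t p then E.wt p else 0) ≤ ∑ p ∈ Finset.range n, (if X.abd P i T t p then E.wt p else 0) := by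
          refine Finset.sum_le_sum_of_subset_of_nonneg ?_ fun p _ _ => ?_
          · simp only [Finset.mem_range] at ht; simpa using ht.le
          · split_ifs; exacts [E.wt_nonneg p, le_rfl]
        have h3 : ∑ p ∈ Finset.range n, (if X.okR P i T t p then (1/2:ℝ) ^ (E.len p + K) else 0) ≤ (1/2) ^ K * (∑ p ∈ Finset.range n, (if X.frs i T t p then E.wt p else 0) + ∑ p ∈ Finset.range n, (if X.chg P i T t p then E.wt p else 0)) := by
          rw [← Finset.sum_add_distrib, Finset.mul_sum]
          refine Finset.sum_le_sum fun p _ => ?_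
          have hw := E.wt_nonneg p
          have hk : (0:ℝ) ≤ (1/2) ^ K := by positivity
          have hwo : E.ok p → (1/2:ℝ) ^ (E.len p + K) = (1/2) ^ K * E.wt p := fun ho => by
            unfold UEnum.wt rw_; rw [if_pos ho, pow_add]; ring
          by_cases hf : X.frs i T t p
          · rw [if_pos (c := X.okR P i T t p) (Or.inl hf), if_pos hf, hwo hf.2.2.2.1]
            gcongr; split_ifs <;> linarith
          · by_cases hg : X.chg P i T t p
            · rw [if_pos (c := X.okR P i T t p) (Or.inr hg), if_pos hg, if_neg hf, hwo hg.2.2.2.1, zero_add]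
            · rw [if_neg (c := X.okR P i T t p) (by rintro (h | h); exacts [hf h, hg h]), if_neg hf, if_neg hg]; simp
        refine h3.trans ?_
        gcongr
        exact h1.trans (by gcongr)
      refine (Finset.sum_le_sum this).trans ?_
      rw [← Finset.mul_sum, Finset.sum_add_distrib, ← Finset.mul_sum]
      have h5 := E.sum_uniq (X.frs_uniq (i := i) (T := T) hT hTi) n n
      have h6 := E.sum_uniq (X.abd_uniq P (i := i) (T := T) hT hTi) n n
      calc (1/2:ℝ) ^ K * _ ≤ (1/2) ^ K * (1 + (2 * (2 * 4 ^ (q+2) + 1) * 4 ^ (q+1)) * 1) := by gcongr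
        _ ≤ (1/2) ^ K * 2 ^ K := by gcongr; linarith
        _ = 1 := by rw [← mul_pow]; norm_num)
  have main : ∀ p, E.ok p → E.str p = zeroStr (E.str p).length → gct X.ent T ≤ p → ∀ t, T < t → lev X.ent t = i → T < br X.ent i t → p < gct X.ent (br X.ent i t) →
      KC U (strOf (P.V t (E.str p).length) (E.str p).length) ≤ (E.len p + K + c : ℕ) := by
    intro p hp hz hTp t
    induction t using Nat.strong_induction_on with
    | _ t ih =>
    intro h1 h2 h3 h4
    by_cases h5 : X.okR P i T t p
    · exact hc t p h5
    · obtain ⟨-, hbt, hlb⟩ := X.isb_br hT hTi h1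
      obtain ⟨hTb', hbb, hlb'⟩ := X.isb_br hT hTi h3
      have h6 : p < gct X.ent (br X.ent i (br X.ent i t)) := by
        by_contra hcc
        exact h5 (Or.inl ⟨⟨h1, h2, h3⟩, not_lt.1 hcc, h4, hp, hTp, hz⟩)
      have h7 : P.V (br X.ent i t) (E.str p).length = P.V t (E.str p).length := by
        by_contra hcc
        exact h5 (Or.inr ⟨⟨h1, h2, h3⟩, hTp, h6, hp, hz, hcc⟩)
      rw [← h7]
      refine ih _ hbt h3 hlb ?_ h6
      rcases hTb'.lt_or_eq with h | h
      · exact h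
      · rw [← h] at h6; omega
  have hgu : ∀ p, ∃ t, p < gct X.ent t := by
    intro p
    induction p with
    | zero =>
      obtain ⟨t, -, ht⟩ := hinf 0
      refine ⟨t+1, ?_⟩
      rw [X.gct_succ, if_pos (X.bd_gd (by omega))]; omega
    | succ p ih =>
      obtain ⟨t0, ht0⟩ := ih
      obtain ⟨t, ht1, ht⟩ := hinf t0
      refine ⟨t+1, ?_⟩
      have := X.gct_mono ht1
      rw [X.gct_succ, if_pos (X.bd_gd (by omega))]; omega
  have hfinal : ∀ p, E.ok p → E.str p = zeroStr (E.str p).length → gct X.ent T ≤ p → KC U (restrSeq A (E.str p).length) ≤ (E.len p + K + c : ℕ) := by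
    intro p hp hz hTp
    obtain ⟨S, hS⟩ := P.conv (E.str p).length
    obtain ⟨t0, ht0⟩ := hgu p
    obtain ⟨b, hb, hlb⟩ := hinf (max t0 (T+1))
    obtain ⟨t, ht, hlt⟩ := hinf (max S (b+1))
    simp only [ge_iff_le, max_le_iff] at hb ht
    have h1 := le_br X.ent (show b < t by omega) hlb.le
    have h2 := main p hp hz hTp t (by omega) hlt (by omega) (lt_of_lt_of_le ht0 (X.gct_mono (by omega)))
    rwa [hS t ht.1, strOf_eq] at h2
  -- small lengths
  choose dd hdd using fun n => KC_finite hU (restrSeq A n)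
  refine ⟨K + c + ∑ n ∈ Finset.range (gct X.ent T), dd n, fun n => ?_⟩
  obtain ⟨d, hd⟩ : ∃ d : ℕ, KC U (zeroStr n) = d := by
    obtain ⟨d, hd⟩ := KC_finite hU (zeroStr n)
    exact ⟨_, (ENat.coe_toNat (ne_top_of_le_ne_top (ENat.coe_ne_top d) hd)).symm⟩
  rw [hd]
  obtain ⟨p, hp, hs, hl⟩ := E.complete (zeroStr n) d hd.le
  have hlen : (E.str p).length = n := by rw [hs]; simp [zeroStr]
  by_cases h : gct X.ent T ≤ p
  · have h1 := hfinal p hp (by rw [hlen, hs]) h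
    rw [hlen] at h1
    refine h1.trans ?_
    norm_cast; omega
  · have h1 := E.str_le p hp
    refine (hdd n).trans ?_
    have := Finset.single_le_sum (f := dd) (fun _ _ => Nat.zero_le _) (show n ∈ Finset.range (gct X.ent T) by simp; omega)
    norm_cast; omega
end fin
end TProc
end

section
variable {U : Str →. Str} {E : UEnum U} {A₀ A₁ : ℕ → Bool} {P₀ : Apx A₀} {P₁ : Apx A₁}
def okN (e : ℕ → Ent) (r : ℕ) : Prop := (e r).1 ≠ 0
namespace TProc
variable {q : ℕ} (X : TProc E P₀ P₁ q)
theorem inf_good (e n1 C1 : ℕ) (hHH : ∀ n ≥ n1, ∀ (t : ℕ) (D : ℕ → ℕ) (supp : ℕ → Prop), (∀ r, supp r → KC U (zeroStr (4 ^ (r+1))) ≤ D r) →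
    ∃ S, ∀ s ≥ S, ∑ r ∈ Finset.Ico n t, (if supp r then (1/2:ℝ) ^ (D r) else 0) ≤ 2 ^ e * (al E P₀ n s + al E P₁ n s))
    (hC : ∀ r, (X.ent r).1 ≠ 0 → KC U (zeroStr (4 ^ (r+1))) ≤ ((X.ent r).1 - 1 + (q + 4) + C1 : ℕ))
    (p : ℕ) (hp : E.ok p) (hs : E.str p = restrSeq A₀ (4 ^ n1)) (hq : E.len p ≤ q) (hq3 : 3 ≤ q) (hqe : 4 + C1 + e ≤ q) (T : ℕ) : ∃ t ≥ T, gd X.ent t := by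
  by_contra hcon
  push Not at hcon
  have hz : ∀ s, ms X.ent T s = 0 := fun s => Finset.sum_eq_zero fun r _ => by
    split_ifs with h
    · exact X.we_ngd (hcon r h)
    · rfl
  have hS : ∀ n, ∃ S, ∀ s ≥ S, ms X.ent n T ≤ 4 ^ q * (al E P₀ n s + al E P₁ n s) := by
    intro n
    by_cases hn : n1 ≤ n
    · obtain ⟨S, hS⟩ := hHH n hn T (fun r => (X.ent r).1 - 1 + (q + 4) + C1) (okN X.ent) hC
      refine ⟨S, fun s hs => ?_⟩
      have h1 := hS s hs
      have h2 : ∑ r ∈ Finset.Ico n T, (if okN X.ent r then (1/2:ℝ) ^ ((X.ent r).1 - 1 + (q + 4) + C1) else 0) = (1/2) ^ (q+4+C1) * ms X.ent n T := by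
        unfold ms
        rw [Finset.mul_sum]
        have : Finset.Ico n T = (Finset.range T).filter (fun r => n ≤ r) := by
          ext r; simp only [Finset.mem_Ico, Finset.mem_filter, Finset.mem_range]; tauto
        rw [this, Finset.sum_filter]
        refine Finset.sum_congr rfl fun r _ => ?_
        split_ifs with h3 h4
        · unfold we pw; rw [if_neg h4, ← pow_add]; congr 1; ring
        · unfold we pw; rw [if_pos (c := (X.ent r).1 = 0) (not_not.1 h4), mul_zero]
        · rw [mul_zero]
      rw [h2] at h1
      have h3 := al_nonneg E P₀ n s; have h4 := al_nonneg E P₁ n s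
      calc ms X.ent n T = 2 ^ (q+4+C1) * ((1/2) ^ (q+4+C1) * ms X.ent n T) := by
            rw [← mul_assoc, ← mul_pow]; norm_num
        _ ≤ 2 ^ (q+4+C1) * (2 ^ e * (al E P₀ n s + al E P₁ n s)) := by gcongr
        _ = 2 ^ (q+4+C1+e) * (al E P₀ n s + al E P₁ n s) := by rw [pow_add _ _ e]; ring
        _ ≤ 2 ^ (2 * q) * (al E P₀ n s + al E P₁ n s) := by
            gcongr
            · norm_num
            · omega
        _ = _ := by rw [pow_mul]; norm_num
    · obtain ⟨S, hS⟩ := mat_eventually E P₀ hp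
      refine ⟨max S (p+1), fun s hs' => ?_⟩
      have hlen : (E.str p).length = 4 ^ n1 := by rw [hs]; simp
      have h1 : mat E P₀ p s := (hS s (le_trans (le_max_left _ _) hs')).2 (by rw [hlen, hs])
      have h2 : E.wt p ≤ al E P₀ n s := by
        unfold al
        have h3 : (if mat E P₀ p s ∧ 4 ^ n ≤ (E.str p).length then E.wt p else 0) = E.wt p := by
          rw [if_pos ⟨h1, by rw [hlen]; exact Nat.pow_le_pow_right (by norm_num) (by omega)⟩]
        rw [← h3]
        refine Finset.single_le_sum (f := fun p => if mat E P₀ p s ∧ 4 ^ n ≤ (E.str p).length then E.wt p else 0) (fun i _ => ?_) (by simpa using h1.1)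
        split_ifs; exacts [E.wt_nonneg i, le_rfl]
      have h3 := al_nonneg E P₁ n s
      have h4 := X.ms_le5 n T
      have h5 : E.wt p = (1/2) ^ (E.len p) := by unfold UEnum.wt rw_; rw [if_pos hp]
      calc ms X.ent n T ≤ 2 ^ 3 := by linarith
        _ ≤ 2 ^ q := by gcongr; norm_num
        _ = 4 ^ q * (1/2) ^ q := by rw [← mul_pow]; norm_num
        _ ≤ 4 ^ q * E.wt p := by
            rw [h5]; gcongr ?_ * ?_
            exact pow_le_pow_of_le_one (by norm_num) (by norm_num) hq
        _ ≤ _ := by gcongr; linarith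
  choose S hS using hS
  set s := T + ∑ n ∈ Finset.range T, S n
  refine hcon s (by omega) ((X.gd_iff s).2 fun n hn => ?_)
  show ms X.ent n s ≤ 4 ^ q * (al E P₀ n s + al E P₁ n s)
  by_cases hnT : n < T
  · rw [ms_split X.ent (b := T) hnT.le (by omega), hz, add_zero]
    refine hS n s ?_
    have := Finset.single_le_sum (f := S) (fun _ _ => Nat.zero_le _) (show n ∈ Finset.range T by simpa using hnT)
    simp only [s]; omega
  · have h1 := ms_anti X.ent s (not_lt.1 hnT)
    rw [hz] at h1
    have h3 := al_nonneg E P₀ n s; have h4 := al_nonneg E P₁ n s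
    exact h1.trans (by positivity)
theorem lev_ev (hU : OptimalPF U) (h0 : ¬ KTrivialSeq U A₀) (h1 : ¬ KTrivialSeq U A₁) (k : ℕ) (hk : k ≤ LL q) : ∃ T, ∀ t ≥ T, k ≤ lev X.ent t := by
  induction k with
  | zero => exact ⟨0, fun _ _ => Nat.zero_le _⟩
  | succ k ih =>
    obtain ⟨T, hT⟩ := ih (by omega)
    by_contra hc
    push Not at hc
    have hinf : ∀ n, ∃ t ≥ n, T ≤ t ∧ lev X.ent t = k := by
      intro n
      obtain ⟨t, ht, hl⟩ := hc (max n T)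
      simp only [ge_iff_le, max_le_iff] at ht
      have := hT t ht.2
      exact ⟨t, ht.1, ht.2, by omega⟩
    obtain ⟨T', _, hTT, hl⟩ := hinf 0
    have hTi : ∀ t ≥ T', k ≤ lev X.ent t := fun t ht => hT t (by omega)
    have hinf' : ∀ n, ∃ t ≥ n, lev X.ent t = k := fun n => by
      obtain ⟨t, a, _, b⟩ := hinf n; exact ⟨t, a, b⟩
    by_cases hpar : k % 2 = 0
    · exact h0 (X.ktriv P₀ hU (by omega) hl hTi hinf' (fun n t => by unfold alI; rw [if_pos hpar]))
    · exact h1 (X.ktriv P₁ hU (by omega) hl hTi hinf' (fun n t => by unfold alI; rw [if_neg hpar]))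
theorem contra (hU : OptimalPF U) (h0 : ¬ KTrivialSeq U A₀) (h1 : ¬ KTrivialSeq U A₁) (hg : ∀ T, ∃ t ≥ T, gd X.ent t) : False := by
  obtain ⟨T, hT⟩ := X.lev_ev hU h0 h1 (LL q) le_rfl
  have hNb : ∀ t ≥ T, Nb q X.ent t = Nb q X.ent T := by
    intro t ht
    induction t, ht using Nat.le_induction with
    | base => rfl
    | succ t ht ih => rw [X.Nb_succ, ih, if_neg (by have := hT t ht; omega)]; rfl
  have key : ∀ m : ℕ, ∃ t, m * (X.ph T / 2) ≤ ms X.ent 0 t := by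
    intro m
    induction m with
    | zero => exact ⟨0, by simpa using ms_nonneg _ _ _⟩
    | succ m ih =>
      obtain ⟨t0, ht0⟩ := ih
      obtain ⟨t, ht, hgt⟩ := hg (max t0 T)
      simp only [ge_iff_le, max_le_iff] at ht
      refine ⟨t+1, ?_⟩
      rw [ms_succ _ (Nat.zero_le t)]
      have h2 := ms_mono X.ent 0 ht.1
      have h3 := X.ph_le_we (t := t) ⟨hgt, le_antisymm (X.lev_le t) (hT t ht.2)⟩
      have h4 : X.ph t = X.ph T := by unfold ph; rw [hNb t ht.2]
      rw [h4] at h3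
      push_cast; linarith
  have hp : 0 < X.ph T / 2 := by have := X.ph_pos T; positivity
  obtain ⟨m, hm⟩ := exists_nat_gt (5 / (X.ph T / 2))
  obtain ⟨t, ht⟩ := key m
  rw [div_lt_iff₀ hp] at hm
  have := X.ms_le5 0 t
  linarith
end TProc
def okM (F : ℕ → ℕ → Ent) (q r : ℕ) : Prop := (F q r).1 ≠ 0
theorem HH_false (hU : OptimalPF U) (h0 : ¬ KTrivialSeq U A₀) (h1 : ¬ KTrivialSeq U A₁) (h : HH E P₀ P₁) : False := by
  obtain ⟨e, n1, hHH⟩ := h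
  obtain ⟨F, cF, hF⟩ := exists_T E P₀ P₁
  let X : ∀ q, TProc E P₀ P₁ q := fun q => ⟨F q, ccomp (g := fun x => (q, x)) cF (by fun_prop), hF q⟩
  obtain ⟨C1, hC1⟩ := kc_pair hU (okM F) (by unfold okM; fun_prop) (fun q r => (F q r).1 - 1 + (q + 4)) (by fun_prop) (fun q r => zeroStr (4 ^ (r+1))) (by fun_prop) (fun n => by
    have : ∀ q ∈ Finset.range n, ∑ r ∈ Finset.range n, (if okM F q r then (1/2:ℝ) ^ ((F q r).1 - 1 + (q + 4)) else 0) ≤ (1/2) ^ (q+1) := by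
      intro q _
      have h5 := (X q).ms_le_five n
      have h6 : ∑ r ∈ Finset.range n, (if okM F q r then (1/2:ℝ) ^ ((F q r).1 - 1 + (q + 4)) else 0) = (1/2) ^ (q+4) * ms (F q) 0 n := by
        rw [ms_zero, Finset.mul_sum]
        refine Finset.sum_congr rfl fun r _ => ?_
        unfold okM we pw
        by_cases h : (F q r).1 = 0
        · rw [if_pos h, if_neg (not_not.2 h), mul_zero]
        · rw [if_neg h, if_pos h, pow_add, mul_comm]
      rw [h6]
      calc (1/2:ℝ) ^ (q+4) * ms (F q) 0 n ≤ (1/2:ℝ) ^ (q+4) * 8 := by gcongr; exact h5.trans (by norm_num)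
        _ = _ := by rw [show q + 4 = (q+1) + 3 by ring, pow_add _ (q+1) 3]; ring
    exact (Finset.sum_le_sum this).trans (sum_half_le n))
  obtain ⟨d, hd⟩ := KC_finite hU (restrSeq A₀ (4 ^ n1))
  obtain ⟨p, hp, hs, hl⟩ := E.complete _ d hd
  set q := 3 + E.len p + (4 + C1 + e) with hq
  exact (X q).contra hU h0 h1 ((X q).inf_good e n1 C1 hHH (fun r hr => hC1 q r hr) p hp hs (by omega) (by omega) (by omega))
theorem part2 (hU : OptimalPF U) : ¬ (∃ A D : ℕ → Bool, CEReal A ∧ CEReal D ∧ ¬ KTrivialSeq U A ∧ ¬ KTrivialSeq U D ∧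
        ∀ X : ℕ → Bool, CEReal X → KLeSeq U X A → KLeSeq U X D → KTrivialSeq U X) := by
  rintro ⟨A, D, hA, hD, nA, nD, h⟩
  obtain ⟨E⟩ := exists_UEnum hU.1
  obtain ⟨P₀⟩ := exists_Apx hA (fun hc => nA (ktrivial_of_computable hU A hc))
  obtain ⟨P₁⟩ := exists_Apx hD (fun hc => nD (ktrivial_of_computable hU D hc))
  obtain ⟨ent, cent, hent⟩ := exists_ent E P₀ P₁
  let Q : BProc E P₀ P₁ := ⟨ent, cent, hent⟩
  have hk := h Q.B Q.ceB (Q.kle hU P₀ fun n t => by have := al_nonneg E P₁ n t; linarith) (Q.kle hU P₁ fun n t => by have := al_nonneg E P₀ n t; linarith)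
  exact HH_false hU nA nD (Q.hh hU hk)
end


theorem toNat_div (f : ℕ → ℤ) (s : ℕ) : ((f s).toNat : ℝ) / 2 ^ s = max ((f s : ℝ) / 2 ^ s) 0 := by
  rcases le_total 0 (f s) with h | h
  · have : ((f s).toNat : ℝ) = f s := by exact_mod_cast Int.toNat_of_nonneg h
    rw [this, max_eq_left]
    have : (0:ℝ) ≤ f s := by exact_mod_cast h
    positivity
  · rw [Int.toNat_of_nonpos h, max_eq_right]; simp
    have : (f s : ℝ) ≤ 0 := by exact_mod_cast h
    exact div_nonpos_of_nonpos_of_nonneg this (by positivity)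

theorem realOfSeq_nonneg (X : ℕ → Bool) : 0 ≤ realOfSeq X := by
  have := real_lower X 0
  simpa [restrSeq] using this
theorem realOfSeq_le_one (X : ℕ → Bool) : realOfSeq X ≤ 1 := by
  have := real_upper X 0
  simpa [restrSeq] using this

theorem least_of_modulus {X : ℕ → Bool} (f : ℕ → ℕ) (hf : Computable f)
    (hm : Monotone (fun s => (f s : ℝ) / 2 ^ s))
    (hl : Tendsto (fun s => (f s : ℝ) / 2 ^ s) atTop (nhds (realOfSeq X)))
    (τ : ℕ → ℕ) (hτ : Computable τ) (C : ℕ) (h : ∀ s, realOfSeq X - (f (τ s) : ℝ) / 2 ^ (τ s) ≤ C / 2 ^ s) :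
    SolovayLeastSeq X := by
  rintro Y ⟨g, hg, hgm, hgl⟩
  have hle : ∀ s, (f s : ℝ) / 2 ^ s ≤ realOfSeq X := fun s =>
    ge_of_tendsto hl (eventually_atTop.2 ⟨s, fun t ht => hm ht⟩)
  have hgle : ∀ s, (g s : ℝ) / 2 ^ s ≤ realOfSeq Y := fun s =>
    ge_of_tendsto hgl (eventually_atTop.2 ⟨s, fun t ht =>
      monotone_nat_of_le_succ (f := fun s => (g s : ℝ) / 2 ^ s) hgm ht⟩)
  let T : ℕ → ℕ := fun s => ∑ i ∈ Finset.range (s+1), τ i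
  have hT : Computable T := by show Computable (fun s => ∑ i ∈ Finset.range (s+1), τ i); fun_prop
  have hTτ : ∀ s, τ s ≤ T s := fun s => Finset.single_le_sum (f := τ) (fun _ _ => Nat.zero_le _) (by simp)
  have hTm : ∀ s, T s ≤ T (s+1) := fun s => by
    show _ ≤ ∑ i ∈ Finset.range (s+1+1), τ i
    rw [Finset.sum_range_succ]; exact Nat.le_add_right _ _
  let F : ℕ → ℕ := fun s => f (T s) * 2 ^ s / 2 ^ (T s)
  have hF : Computable F := by show Computable (fun s => f (T s) * 2 ^ s / 2 ^ (T s)); fun_prop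
  have hFf : ∀ s, F s = ⌊(f (T s) : ℝ) / 2 ^ (T s) * 2 ^ s⌋₊ := by
    intro s
    rw [div_mul_eq_mul_div]
    have : ((f (T s) : ℝ) * 2 ^ s) = ((f (T s) * 2 ^ s : ℕ) : ℝ) := by push_cast; rfl
    rw [this]
    have : ((2:ℝ) ^ T s) = ((2 ^ T s : ℕ) : ℝ) := by push_cast; rfl
    rw [this, Nat.floor_div_natCast, Nat.floor_natCast]
  have hF1 : ∀ s, (F s : ℝ) / 2 ^ s ≤ (f (T s) : ℝ) / 2 ^ (T s) := by
    intro s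
    rw [div_le_iff₀ (by positivity), hFf]
    exact Nat.floor_le (by positivity)
  have hF2 : ∀ s, (f (T s) : ℝ) / 2 ^ (T s) ≤ (F s : ℝ) / 2 ^ s + 1 / 2 ^ s := by
    intro s
    rw [← add_div, le_div_iff₀ (by positivity), hFf]
    exact (Nat.lt_floor_add_one _).le
  have hFm : ∀ s, (F s : ℝ) / 2 ^ s ≤ (F (s+1) : ℝ) / 2 ^ (s+1) := by
    intro s
    have h1 : 2 * F s ≤ F (s+1) := by
      rw [hFf (s+1)]
      apply Nat.le_floor
      have a := hF1 s
      have b := hm (hTm s)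
      have c := a.trans b
      rw [div_le_iff₀ (by positivity)] at c
      push_cast
      rw [pow_succ]; linarith
    rw [div_le_div_iff₀ (by positivity) (by positivity), pow_succ]
    have h2 : (2 * F s : ℝ) ≤ F (s+1) := by exact_mod_cast h1
    have : (0:ℝ) < 2 ^ s := by positivity
    nlinarith
  have key : ∀ s, realOfSeq X - (F s : ℝ) / 2 ^ s ≤ ((C + 1 : ℕ) : ℝ) * (1 / 2 ^ s) := by
    intro s
    have a := hF2 s
    have b := hm (hTτ s)
    have c := h s
    push_cast
    have : ((C:ℝ) + 1) * (1 / 2 ^ s) = C / 2 ^ s + 1 / 2 ^ s := by ring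
    rw [this]
    simp only at b
    linarith
  refine ⟨C + 1, fun s => (F s : ℤ), fun s => if 0 < (g s).toNat then (((g s).toNat - 1 : ℕ) : ℤ) else - (((- g s).toNat + 1 : ℕ) : ℤ),
    by fun_prop, by fun_prop, by simpa using hFm, ?_, ?_, ?_, ?_⟩
  all_goals
    have hgg : ∀ s, (if 0 < (g s).toNat then (((g s).toNat - 1 : ℕ) : ℤ) else - (((- g s).toNat + 1 : ℕ) : ℤ)) = g s - 1 := by
      intro s
      split_ifs <;> omega
    simp only [hgg]
  · intro s
    have a := hgm s
    rw [div_le_div_iff₀ (by positivity) (by positivity), pow_succ] at a ⊢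
    push_cast
    have : (0:ℝ) < 2 ^ s := by positivity
    nlinarith
  · have : Tendsto (fun s : ℕ => realOfSeq X - ((C + 1 : ℕ) : ℝ) * (1 / 2) ^ s) atTop (nhds (realOfSeq X)) := by
      have := (tendsto_pow_atTop_nhds_zero_of_lt_one (r := (1/2:ℝ)) (by norm_num) (by norm_num)).const_mul ((C + 1 : ℕ) : ℝ)
      simpa using this.const_sub (realOfSeq X)
    refine tendsto_of_tendsto_of_tendsto_of_le_of_le this tendsto_const_nhds ?_ ?_
    · intro s; have := key s; simp only [one_div, inv_pow] at this ⊢; push_cast at this ⊢; linarith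
    · intro s; have := (hF1 s).trans (hle _); simpa using this
  · have h1 : Tendsto (fun s : ℕ => (1/2:ℝ) ^ s) atTop (nhds 0) := tendsto_pow_atTop_nhds_zero_of_lt_one (by norm_num) (by norm_num)
    have := hgl.sub h1
    rw [sub_zero] at this
    refine this.congr fun s => ?_
    push_cast; rw [sub_div]; simp
  · intro s
    have a := key s
    have b := hgle s
    have a' : realOfSeq X - (((F s : ℕ) : ℤ) : ℝ) / 2 ^ s ≤ ((C + 1 : ℕ) : ℝ) * (1 / 2 ^ s) := by simpa using a
    refine le_trans a' (mul_le_mul_of_nonneg_left ?_ (by positivity))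
    have e : ((g s - 1 : ℤ) : ℝ) / 2 ^ s = (g s : ℝ) / 2 ^ s - 1 / 2 ^ s := by push_cast; rw [sub_div]
    rw [e]; linarith

theorem solovay_nf {X A : ℕ → Bool} (h : SolovayLe X A) (hA : 0 < realOfSeq A) :
    ∃ (c : ℕ) (f g : ℕ → ℕ), Computable f ∧ Computable g ∧
    Monotone (fun s => (f s : ℝ) / 2 ^ s) ∧ Monotone (fun s => (g s : ℝ) / 2 ^ s) ∧
    Tendsto (fun s => (f s : ℝ) / 2 ^ s) atTop (nhds (realOfSeq X)) ∧
    Tendsto (fun s => (g s : ℝ) / 2 ^ s) atTop (nhds (realOfSeq A)) ∧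
    ∀ s, realOfSeq X - (f s : ℝ) / 2 ^ s ≤ (c : ℝ) * (realOfSeq A - (g s : ℝ) / 2 ^ s) := by
  obtain ⟨c, f, g, hf, hg, hfm, hgm, hfl, hgl, h⟩ := h
  have hfm' : Monotone (fun s => (f s : ℝ) / 2 ^ s) := monotone_nat_of_le_succ hfm
  have hgm' : Monotone (fun s => (g s : ℝ) / 2 ^ s) := monotone_nat_of_le_succ hgm
  obtain ⟨n, hn⟩ := exists_nat_ge (1 / realOfSeq A)
  refine ⟨c + n, fun s => (f s).toNat, fun s => (g s).toNat, by fun_prop, by fun_prop, ?_, ?_, ?_, ?_, ?_⟩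
  all_goals simp only [toNat_div]
  · exact fun a b hab => max_le_max (hfm' hab) le_rfl
  · exact fun a b hab => max_le_max (hgm' hab) le_rfl
  · have := hfl.max (tendsto_const_nhds (x := (0:ℝ)))
    rwa [max_eq_left (realOfSeq_nonneg X)] at this
  · have := hgl.max (tendsto_const_nhds (x := (0:ℝ)))
    rwa [max_eq_left (realOfSeq_nonneg A)] at this
  · intro s
    have hgle : (g s : ℝ) / 2 ^ s ≤ realOfSeq A :=
      ge_of_tendsto hgl (eventually_atTop.2 ⟨s, fun t ht => hgm' ht⟩)
    have h1 := h s
    have h2 := le_max_left ((f s : ℝ) / 2 ^ s) 0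
    push_cast
    rcases le_total 0 ((g s : ℝ) / 2 ^ s) with h0 | h0
    · rw [max_eq_left h0]
      have : 0 ≤ (n:ℝ) * (realOfSeq A - (g s : ℝ) / 2 ^ s) := mul_nonneg (by positivity) (by linarith)
      linarith
    · rw [max_eq_right h0]
      have h3 := le_max_right ((f s : ℝ) / 2 ^ s) 0
      have h4 := realOfSeq_le_one X
      rw [div_le_iff₀ hA] at hn
      have : 0 ≤ (c:ℝ) * realOfSeq A := by positivity
      linarith

theorem computable_of_least {A : ℕ → Bool} (Bt : ℕ → ℕ → Bool) (hc : Computable (fun p : ℕ × ℕ => Bt p.1 p.2))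
    (hm : ∀ t x, Bt t x = true → Bt (t+1) x = true) (hB : ∀ x, A x = true ↔ ∃ t, Bt t x = true)
    (h : SolovayLeastSeq A) : Computable A := by
  obtain ⟨-, hle, hmo, hten⟩ := cereal_of_ce Bt hc hm hB
  have hz : realOfSeq (fun _ => false) = 0 := by simp [realOfSeq]
  obtain ⟨c, f, g, hf, hg, hfm, hgm, hfl, hgl, h⟩ := h (fun _ => false) ⟨fun _ => 0, by fun_prop, by simp, by simp [hz]⟩
  rw [hz] at hgl h
  have hg0 : ∀ s, (g s : ℝ) / 2 ^ s ≤ 0 := fun s =>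
    ge_of_tendsto hgl (eventually_atTop.2 ⟨s, fun t ht => monotone_nat_of_le_succ (f := fun s => (g s : ℝ) / 2 ^ s) hgm ht⟩)
  let W : ℕ → ℝ := fun s => (((f s).toNat + c * (- g s).toNat : ℕ) : ℝ) * (1/2) ^ s
  have hW : ∀ s, W s = max ((f s : ℝ) / 2 ^ s) 0 + c * - ((g s : ℝ) / 2 ^ s) := by
    intro s
    have h1 := toNat_div (fun s => - g s) s
    have h2 := toNat_div f s
    rw [max_eq_left (by push_cast; rw [neg_div]; linarith [hg0 s])] at h1
    show (((f s).toNat + c * (- g s).toNat : ℕ) : ℝ) * (1/2) ^ s = _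
    rw [← h2, ← neg_div]; push_cast at h1 ⊢; rw [← h1]
    simp only [one_div, inv_pow]; ring
  have hWA : ∀ s, realOfSeq A ≤ W s := by
    intro s
    rw [hW]
    have := h s
    have := le_max_left ((f s : ℝ) / 2 ^ s) 0
    linarith
  have hWl : Tendsto W atTop (nhds (realOfSeq A)) := by
    have h1 := (hfl.max (tendsto_const_nhds (x := (0:ℝ)))).add (hgl.neg.const_mul (c:ℝ))
    rw [max_eq_left (realOfSeq_nonneg A)] at h1
    simp only [neg_zero, mul_zero, add_zero] at h1
    exact h1.congr fun s => (hW s).symm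
  let Q : ℕ → ℕ → Prop := fun x n => W n.unpair.1 < (val (restrSeq (fun i => Bt n.unpair.2 i) n.unpair.2) : ℝ) * (1/2) ^ n.unpair.2 + (1/2) ^ (x+1) ∧ x < n.unpair.2
  have hQ : CP (fun p : ℕ × ℕ => Q p.1 p.2) := by
    have : Computable (fun p : (ℕ × ℕ) × ℕ => Bt p.1.2.unpair.2 p.2) := ccomp (g := fun p : (ℕ × ℕ) × ℕ => (p.1.2.unpair.2, p.2)) hc (by fun_prop)
    show CP (fun p : ℕ × ℕ => (((f p.2.unpair.1).toNat + c * (- g p.2.unpair.1).toNat : ℕ) : ℝ) * (1/2) ^ p.2.unpair.1 < (val (restrSeq (fun i => Bt p.2.unpair.2 i) p.2.unpair.2) : ℝ) * (1/2) ^ p.2.unpair.2 + (1/2) ^ (p.1+1) ∧ p.1 < p.2.unpair.2)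
    fun_prop
  obtain ⟨n, hn, hnQ⟩ := csearch hQ (by
    intro x
    have e1 := hWl.eventually (gt_mem_nhds (show realOfSeq A < realOfSeq A + (1/2) ^ (x+2) by linarith [show (0:ℝ) < (1/2) ^ (x+2) by positivity]))
    have e2 := hten.eventually (lt_mem_nhds (show realOfSeq A - (1/2) ^ (x+2) < realOfSeq A by linarith [show (0:ℝ) < (1/2) ^ (x+2) by positivity]))
    obtain ⟨s, hs⟩ := e1.exists
    obtain ⟨t, ht, hxt⟩ := (e2.and (eventually_gt_atTop x)).exists
    refine ⟨Nat.pair s t, ?_⟩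
    simp only [Q, Nat.unpair_pair]
    refine ⟨?_, hxt⟩
    have : (1/2:ℝ) ^ (x+1) = (1/2) ^ (x+2) + (1/2) ^ (x+2) := by ring
    rw [this]
    simp only [div_eq_mul_inv, ← inv_pow, one_mul] at hs ht ⊢
    linarith)
  have hres : Computable (fun x => Bt (n x).unpair.2 x) := ccomp (g := fun x => ((n x).unpair.2, x)) hc (by fun_prop)
  refine hres.of_eq fun x => ?_
  obtain ⟨h1, h2⟩ := hnQ x
  have hW := hWA (n x).unpair.1
  generalize (n x).unpair.2 = t at h1 h2 ⊢
  have hlow := real_lower A t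
  by_contra hne
  have hBA : ∀ y, Bt t y = true → A y = true := fun y hy => (hB y).2 ⟨t, hy⟩
  have hx1 : Bt t x = false := by
    by_contra hc; simp only [Bool.not_eq_false] at hc; rw [hc, hBA x hc] at hne; exact hne rfl
  have hx2 : A x = true := by
    by_contra hc; simp only [Bool.not_eq_true] at hc; rw [hc, hx1] at hne; exact hne rfl
  have : (val (restrSeq (Bt t) t) : ℝ) / 2 ^ t + (1/2) ^ (x+1) ≤ val (restrSeq A t) / 2 ^ t := by
    rw [← partial_real, ← partial_real, ← Finset.sum_erase_add _ _ (Finset.mem_range.2 h2), ← Finset.sum_erase_add _ _ (Finset.mem_range.2 h2), hx1, hx2]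
    simp only [cond_false, cond_true, add_zero]
    have e : ((1/2:ℝ)) ^ (x+1) = ((2:ℝ) ^ (x+1))⁻¹ := by simp
    rw [e]
    gcongr with i hi
    have := hBA i
    cases hb : Bt t i
    · cases A i <;> simp
    · rw [this hb]
  have e2 : (val (restrSeq (fun i => Bt t i) t) : ℝ) * (1/2) ^ t = val (restrSeq (Bt t) t) / 2 ^ t := by
    simp [div_eq_mul_inv]
  rw [e2] at h1
  linarith

/-- bounded evaluation of the `e`-th code -/
def ec (s e n : ℕ) : Option ℕ := Nat.Partrec.Code.evaln s (Denumerable.ofNat Nat.Partrec.Code e) n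
section
variable {α : Type*} [Primcodable α]
@[fun_prop] theorem cec {s e n : α → ℕ} (hs : Computable s) (he : Computable e) (hn : Computable n) :
    Computable (fun a => ec (s a) (e a) (n a)) :=
  Nat.Partrec.Code.primrec_evaln.to_comp.comp ((hs.pair ((Computable.ofNat _).comp he)).pair hn)
end

abbrev Hist := ℕ → Str × ℕ
def side (w : ℕ) : ℕ := w.unpair.1 % 2
noncomputable def RA (H : Hist) (i s : ℕ) : ℝ :=
  ∑ r ∈ Finset.range s, if (H r).2 ≠ 0 ∧ side ((H r).2 - 1) = i then (1/2 : ℝ) ^ (H r).2 else 0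
/-- one plus the last stage before `s` satisfying `p`, or `0` -/
noncomputable def lastS (p : ℕ → Prop) (s : ℕ) : ℕ := s - mu s (fun k => p (s - 1 - k))
def Pre (x y : Str) : Prop := y.take x.length = x
/-- `x` is to the left of `y` -/
def lft (x y : Str) : Prop := bEx y.length (fun k => x.take (k+1) = y.take k ++ [false] ∧ y.take (k+1) = y.take k ++ [true])
def vv (e s n : ℕ) : ℕ := (ec s e.unpair.2 n).getD 0
def cmp (i v : ℕ) : ℕ := if i = 0 then v.unpair.1 else v.unpair.2
noncomputable def fv (e s i t : ℕ) : ℝ := ((cmp i (vv e s t)).unpair.1 : ℝ) * (1/2) ^ t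
noncomputable def gv (e s i t : ℕ) : ℝ := ((cmp i (vv e s t)).unpair.2 : ℝ) * (1/2) ^ t
def AgT (H : Hist) (e s r t : ℕ) : Prop :=
  bAll (t+1) (fun n => (ec s e.unpair.2 n).isSome = true) ∧
  bAll 2 (fun i => RA H i s < gv e s i t + (1/2) ^ r ∧
    bAll 2 (fun i' => fv e s i t ≤ fv e s i' t + (1/2) ^ r) ∧
    bAll (t+1) (fun t1 => fv e s i t + (e.unpair.1 : ℝ) * gv e s i t1 ≤ fv e s i t1 + (e.unpair.1 : ℝ) * (RA H i s + (1/2) ^ r)))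
def Agr (H : Hist) (e s r : ℕ) : Prop := bEx (s+1) (fun t => AgT H e s r t)
noncomputable def last0 (H : Hist) (x : Str) (s : ℕ) : ℕ := lastS (fun r => Pre (x ++ [false]) (H r).1) s
noncomputable def dl (H : Hist) (s n : ℕ) : Str :=
  Nat.rec (motive := fun _ => Str) [] (fun e l => l ++ [decide (¬ Agr H e s (last0 H l s))]) n
noncomputable def iniS (H : Hist) (x : Str) (s : ℕ) : ℕ := lastS (fun r => lft (H r).1 x) s
noncomputable def wit (H : Hist) (d : Str) (s j : ℕ) : ℕ :=
  Nat.pair j (Nat.pair (Encodable.encode (d.take j)) (iniS H (d.take j) s))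
def act (H : Hist) (d : Str) (s j : ℕ) : Prop :=
  ec s (j/2) (wit H d s j) = Option.some 0 ∧ ¬ bEx s (fun r => (H r).2 = wit H d s j + 1)
noncomputable def evS (H : Hist) (d : Str) (s : ℕ) : ℕ :=
  if mu s (fun j => act H d s j) < s then wit H d s (mu s (fun j => act H d s j)) + 1 else 0
noncomputable def stp (H : Hist) (s : ℕ) : Str × ℕ := (dl H s s, evS H (dl H s s) s)

def hist (l : List (Str × ℕ)) : Hist := fun r => l.getD r ([], 0)
section
variable {α : Type*} [Primcodable α] {l : α → List (Str × ℕ)} {s i e r t j : α → ℕ} {x y d : α → Str}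
@[fun_prop] theorem chist (hl : Computable l) (hr : Computable r) : Computable (fun a => hist (l a) (r a)) := by
  unfold hist; fun_prop
@[fun_prop] theorem cRA (hl : Computable l) (hi : Computable i) (hs : Computable s) : CR (fun a => RA (hist (l a)) (i a) (s a)) := by
  unfold RA side; fun_prop
@[fun_prop] theorem clastS {p : α → ℕ → Prop} (hp : CP (fun q : α × ℕ => p q.1 q.2)) (hs : Computable s) :
    Computable (fun a => lastS (fun n => p a n) (s a)) := by
  have : CP (fun q : α × ℕ => p q.1 (s q.1 - 1 - q.2)) := CP.comp (g := fun q : α × ℕ => (q.1, s q.1 - 1 - q.2)) hp (by fun_prop)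
  unfold lastS; fun_prop
@[fun_prop] theorem cPre (hx : Computable x) (hy : Computable y) : CP (fun a => Pre (x a) (y a)) := by
  unfold Pre; fun_prop
@[fun_prop] theorem clft (hx : Computable x) (hy : Computable y) : CP (fun a => lft (x a) (y a)) := by
  unfold lft; fun_prop
@[fun_prop] theorem cfv (he : Computable e) (hs : Computable s) (hi : Computable i) (ht : Computable t) :
    CR (fun a => fv (e a) (s a) (i a) (t a)) := by unfold fv cmp vv; fun_prop
@[fun_prop] theorem cgv (he : Computable e) (hs : Computable s) (hi : Computable i) (ht : Computable t) :
    CR (fun a => gv (e a) (s a) (i a) (t a)) := by unfold gv cmp vv; fun_prop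
@[fun_prop] theorem cAgT (hl : Computable l) (he : Computable e) (hs : Computable s) (hr : Computable r) (ht : Computable t) :
    CP (fun a => AgT (hist (l a)) (e a) (s a) (r a) (t a)) := by unfold AgT; fun_prop
@[fun_prop] theorem cAgr (hl : Computable l) (he : Computable e) (hs : Computable s) (hr : Computable r) :
    CP (fun a => Agr (hist (l a)) (e a) (s a) (r a)) := by unfold Agr; fun_prop
@[fun_prop] theorem clast0 (hl : Computable l) (hx : Computable x) (hs : Computable s) :
    Computable (fun a => last0 (hist (l a)) (x a) (s a)) := by unfold last0; fun_prop
@[fun_prop] theorem cdl (hl : Computable l) (hs : Computable s) (hr : Computable r) :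
    Computable (fun a => dl (hist (l a)) (s a) (r a)) :=
  cnrec (f := r) (g := fun _ => ([] : Str)) (h := fun a e (k : Str) => k ++ [decide (¬ Agr (hist (l a)) e (s a) (last0 (hist (l a)) k (s a)))])
    hr (by fun_prop) (by fun_prop)
@[fun_prop] theorem ciniS (hl : Computable l) (hx : Computable x) (hs : Computable s) :
    Computable (fun a => iniS (hist (l a)) (x a) (s a)) := by unfold iniS; fun_prop
@[fun_prop] theorem cwit (hl : Computable l) (hd : Computable d) (hs : Computable s) (hj : Computable j) :
    Computable (fun a => wit (hist (l a)) (d a) (s a) (j a)) := by unfold wit; fun_prop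
@[fun_prop] theorem cact (hl : Computable l) (hd : Computable d) (hs : Computable s) (hj : Computable j) :
    CP (fun a => act (hist (l a)) (d a) (s a) (j a)) := by unfold act; fun_prop
@[fun_prop] theorem cevS (hl : Computable l) (hd : Computable d) (hs : Computable s) :
    Computable (fun a => evS (hist (l a)) (d a) (s a)) := by unfold evS; fun_prop
@[fun_prop] theorem cstp (hl : Computable l) (hs : Computable s) :
    Computable (fun a => stp (hist (l a)) (s a)) := by unfold stp; fun_prop
end

section
variable {H H' : Hist} {s : ℕ}
theorem lastS_congr {p q : ℕ → Prop} {s : ℕ} (h : ∀ r < s, p r ↔ q r) : lastS p s = lastS q s := by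
  unfold lastS; congr 1; exact mu_congr fun i hi => h _ (by omega)
theorem RA_congr (h : ∀ r < s, H r = H' r) (i : ℕ) : RA H i s = RA H' i s := 
  Finset.sum_congr rfl fun r hr => by simp [h r (by simpa using hr)]
theorem Agr_congr (h : ∀ r < s, H r = H' r) (e r : ℕ) : Agr H e s r = Agr H' e s r := by
  unfold Agr AgT; simp only [RA_congr h]
theorem last0_congr (h : ∀ r < s, H r = H' r) (x : Str) : last0 H x s = last0 H' x s := lastS_congr fun r hr => by rw [h r hr]
theorem iniS_congr (h : ∀ r < s, H r = H' r) (x : Str) : iniS H x s = iniS H' x s := lastS_congr fun r hr => by rw [h r hr]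
theorem dl_congr (h : ∀ r < s, H r = H' r) (n : ℕ) : dl H s n = dl H' s n := by
  unfold dl; simp only [Agr_congr h, last0_congr h]
theorem wit_congr (h : ∀ r < s, H r = H' r) (d : Str) (j : ℕ) : wit H d s j = wit H' d s j := by
  unfold wit; rw [iniS_congr h]
theorem act_congr (h : ∀ r < s, H r = H' r) (d : Str) (j : ℕ) : act H d s j = act H' d s j := by
  unfold act; rw [wit_congr h]; congr 2
  unfold bEx; apply propext
  exact exists_congr fun r => and_congr_right fun hr => by simp only [h r hr]
theorem stp_congr (h : ∀ r < s, H r = H' r) : stp H s = stp H' s := by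
  unfold stp evS; simp only [dl_congr h, act_congr h, wit_congr h]
end

theorem exists_H : ∃ H : Hist, Computable H ∧ ∀ s, H s = stp H s := by
  obtain ⟨F, hF, h⟩ := exists_rec (β := Unit) (([], 0) : Str × ℕ) (fun _ => stp)
    (cstp (α := Unit × List (Str × ℕ)) (l := fun p => p.2) (s := fun p => p.2.length) (by fun_prop) (by fun_prop))
  refine ⟨F (), ccomp (g := fun n : ℕ => ((), n)) hF (by fun_prop), fun s => ?_⟩
  rw [h]; apply stp_congr
  intro r hr; simp [trunc, hr]

theorem lastS_spec (p : ℕ → Prop) (s : ℕ) : (lastS p s = 0 ∧ ∀ r < s, ¬ p r) ∨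
    ∃ σ < s, lastS p s = σ + 1 ∧ p σ ∧ ∀ r, σ < r → r < s → ¬ p r := by
  unfold lastS
  rcases mu_spec s (fun k => p (s - 1 - k)) with ⟨h1, h2, h3⟩ | ⟨h1, h2⟩
  · right
    refine ⟨s - 1 - mu s (fun k => p (s - 1 - k)), by omega, by omega, h2, fun r hr hrs hp => ?_⟩
    refine h3 (s - 1 - r) (by omega) ?_
    rwa [show s - 1 - (s - 1 - r) = r by omega]
  · left
    refine ⟨by omega, fun r hr hp => h2 (s - 1 - r) (by omega) ?_⟩
    rwa [show s - 1 - (s - 1 - r) = r by omega]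
theorem lastS_gt {p : ℕ → Prop} {s r : ℕ} (hr : r < s) (hp : p r) : r < lastS p s := by
  rcases lastS_spec p s with ⟨_, h⟩ | ⟨σ, h1, h2, h3, h4⟩
  · exact absurd hp (h r hr)
  · by_contra hc
    exact h4 r (by omega) hr hp
theorem lastS_le (p : ℕ → Prop) (s : ℕ) : lastS p s ≤ s := Nat.sub_le _ _
/-- the value stabilises when `p` fails from some point on -/
theorem lastS_const {p : ℕ → Prop} {n : ℕ} (h : ∀ r ≥ n, ¬ p r) {s : ℕ} (hs : n ≤ s) : lastS p s = lastS p n := by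
  rcases lastS_spec p s with ⟨h1, h2⟩ | ⟨σ, h1, h2, h3, h4⟩ <;> rcases lastS_spec p n with ⟨k1, k2⟩ | ⟨σ', k1, k2, k3, k4⟩
  · omega
  · exact absurd k3 (h2 _ (by omega))
  · have : σ < n := by by_contra hc; exact h σ (by omega) h3
    exact absurd h3 (k2 _ this)
  · have : σ < n := by by_contra hc; exact h σ (by omega) h3
    rcases lt_trichotomy σ σ' with hh | hh | hh
    · exact absurd k3 (h4 _ hh (by omega))
    · omega
    · exact absurd h3 (k4 _ hh (by omega))

theorem Pre_iff {x y : Str} : Pre x y ↔ x <+: y := by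
  unfold Pre; rw [List.prefix_iff_eq_take]; exact eq_comm
theorem lft_iff {x y : Str} : lft x y ↔ ∃ z, (z ++ [false]) <+: x ∧ (z ++ [true]) <+: y := by
  unfold lft bEx
  constructor
  · rintro ⟨k, hk, h1, h2⟩
    refine ⟨y.take k, ?_, ?_⟩
    · rw [← h1]; exact ⟨_, List.take_append_drop _ _⟩
    · rw [← h2]; exact ⟨_, List.take_append_drop _ _⟩
  · rintro ⟨z, h1, h2⟩
    have hl := h2.length_le
    simp only [List.length_append, List.length_singleton] at hl
    have hz : z <+: y := (List.prefix_append _ _).trans h2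
    have e : y.take z.length = z := (List.prefix_iff_eq_take.1 hz).symm
    refine ⟨z.length, by omega, ?_, ?_⟩
    · rw [e]; have := (List.prefix_iff_eq_take.1 h1).symm; simpa using this
    · rw [e]; have := (List.prefix_iff_eq_take.1 h2).symm; simpa using this
theorem lft_mono {x x' y y' : Str} (h : lft x y) (hx : x <+: x') (hy : y <+: y') : lft x' y' := by
  rw [lft_iff] at *
  obtain ⟨z, h1, h2⟩ := h
  exact ⟨z, h1.trans hx, h2.trans hy⟩
theorem tricho (x y : Str) : x <+: y ∨ y <+: x ∨ lft x y ∨ lft y x := by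
  simp only [lft_iff]
  induction x generalizing y with
  | nil => left; exact ⟨_, List.nil_append _⟩
  | cons a x ih =>
    cases y with
    | nil => right; left; exact ⟨_, List.nil_append _⟩
    | cons b y =>
      by_cases hab : a = b
      · subst hab
        rcases ih y with h | h | ⟨z, h1, h2⟩ | ⟨z, h1, h2⟩
        · left; simpa using h
        · right; left; simpa using h
        · right; right; left; exact ⟨a :: z, by simpa using h1, by simpa using h2⟩
        · right; right; right; exact ⟨a :: z, by simpa using h1, by simpa using h2⟩
      · right; right
        cases a <;> cases b <;> simp at hab
        · left; exact ⟨[], by simp, by simp⟩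
        · right; exact ⟨[], by simp, by simp⟩
theorem lft_irrefl (x : Str) : ¬ lft x x := by
  rw [lft_iff]
  rintro ⟨z, h1, h2⟩
  have := List.prefix_of_prefix_length_le h1 h2 (by simp)
  rw [List.prefix_append_right_inj] at this
  simp at this

structure Con where
  H : ℕ → Str × ℕ
  comp : Computable H
  eq : ∀ s, H s = stp H s
namespace Con
variable (K : Con)
def δ (s : ℕ) : Str := (K.H s).1
def ev (s : ℕ) : ℕ := (K.H s).2
theorem dl_succ (H : Hist) (s n : ℕ) : dl H s (n+1) = dl H s n ++ [decide (¬ Agr H n s (last0 H (dl H s n) s))] := rfl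
theorem dl_len (H : Hist) (s n : ℕ) : (dl H s n).length = n := by
  induction n with
  | zero => rfl
  | succ n ih => rw [dl_succ]; simp [ih]
theorem dl_pre (H : Hist) (s : ℕ) {m n : ℕ} (h : m ≤ n) : dl H s m <+: dl H s n := by
  induction n, h using Nat.le_induction with
  | base => exact List.prefix_rfl
  | succ n h ih => rw [dl_succ]; exact ih.trans (List.prefix_append _ _)
theorem δ_eq (s : ℕ) : K.δ s = dl K.H s s := by unfold δ; rw [K.eq]; rfl
theorem ev_eq (s : ℕ) : K.ev s = evS K.H (K.δ s) s := by rw [δ_eq]; unfold ev; rw [K.eq]; rfl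
theorem δ_len (s : ℕ) : (K.δ s).length = s := by rw [δ_eq, dl_len]
theorem δ_dl {x : Str} {s : ℕ} (h : x <+: K.δ s) : dl K.H s x.length = x := by
  have h1 : x.length ≤ s := by have := h.length_le; rwa [δ_len] at this
  rw [δ_eq] at h
  have h2 := dl_pre K.H s h1
  have := List.prefix_of_prefix_length_le h2 h (by rw [dl_len])
  exact this.eq_of_length (by rw [dl_len])
theorem δ_ext {x : Str} {s : ℕ} (h : x <+: K.δ s) (hl : x.length < s) :
    (x ++ [decide (¬ Agr K.H x.length s (last0 K.H x s))]) <+: K.δ s := by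
  have h1 := K.δ_dl h
  have := dl_pre K.H s (show x.length + 1 ≤ s from hl)
  rw [dl_succ, h1, ← δ_eq] at this
  exact this
theorem δ_false {x : Str} {s : ℕ} (h : (x ++ [false]) <+: K.δ s) : Agr K.H x.length s (last0 K.H x s) := by
  have h1 := (List.prefix_append x [false]).trans h
  have hl : x.length < s := by have := h.length_le; rw [δ_len] at this; simp at this; omega
  have h2 := K.δ_ext h1 hl
  have h3 := List.prefix_of_prefix_length_le h2 h (by simp)
  rw [List.prefix_append_right_inj] at h3
  simpa using h3
theorem δ_true {x : Str} {s : ℕ} (h : x <+: K.δ s) (hl : x.length < s) (h2 : ¬ (x ++ [false]) <+: K.δ s) : (x ++ [true]) <+: K.δ s := by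
  have h1 := K.δ_ext h hl
  cases hb : decide (¬ Agr K.H x.length s (last0 K.H x s))
  · rw [hb] at h1; exact absurd h1 h2
  · rw [hb] at h1; exact h1

/-! events -/
theorem ev_spec {s w : ℕ} (h : K.ev s = w + 1) : w.unpair.1 < s ∧ w = wit K.H (K.δ s) s w.unpair.1 ∧ act K.H (K.δ s) s w.unpair.1 := by
  rw [ev_eq, evS] at h
  rcases mu_spec s (fun j => act K.H (K.δ s) s j) with ⟨h1, h2, h3⟩ | ⟨h1, h2⟩
  · rw [if_pos h1] at h
    have hw : w = wit K.H (K.δ s) s (mu s (fun j => act K.H (K.δ s) s j)) := by omega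
    have : w.unpair.1 = mu s (fun j => act K.H (K.δ s) s j) := by rw [hw, wit]; simp
    rw [this]
    exact ⟨h1, hw, h2⟩
  · rw [if_neg (by omega)] at h; omega
theorem ev_of_act {s j : ℕ} (hj : j < s) (h : act K.H (K.δ s) s j) : ∃ j' ≤ j, K.ev s = wit K.H (K.δ s) s j' + 1 := by
  rcases mu_spec s (fun j => act K.H (K.δ s) s j) with ⟨h1, h2, h3⟩ | ⟨h1, h2⟩
  · refine ⟨mu s (fun j => act K.H (K.δ s) s j), ?_, ?_⟩
    · by_contra hc; exact h3 j (by omega) h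
    · rw [ev_eq, evS, if_pos h1]
  · exact absurd h (h2 j hj)
theorem ev_ne {r s w : ℕ} (hrs : r < s) (h : K.ev s = w + 1) : K.ev r ≠ w + 1 := by
  obtain ⟨h1, h2, h3, h4⟩ := K.ev_spec h
  intro hr
  exact h4 ⟨r, hrs, by rw [← h2]; exact hr⟩
theorem ev_inj {r s : ℕ} (h : K.ev r ≠ 0) (h2 : K.ev r = K.ev s) : r = s := by
  obtain ⟨w, hw⟩ := Nat.exists_eq_succ_of_ne_zero h
  rcases lt_trichotomy r s with hh | hh | hh
  · exact absurd hw (K.ev_ne hh (h2 ▸ hw))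
  · exact hh
  · exact absurd (h2 ▸ hw) (K.ev_ne hh hw)
theorem ev_iniS {s w : ℕ} (h : K.ev s = w + 1) : iniS K.H ((K.δ s).take w.unpair.1) s ≤ w := by
  obtain ⟨h1, h2, h3⟩ := K.ev_spec h
  conv_rhs => rw [h2, wit]
  exact (Nat.right_le_pair _ _).trans (Nat.right_le_pair _ _)

/-! the true path -/
noncomputable def tp : ℕ → Str
  | 0 => []
  | e+1 => tp e ++ [decide (¬ ∀ n, ∃ s ≥ n, (tp e ++ [false]) <+: K.δ s)]
theorem tp_len (e : ℕ) : (K.tp e).length = e := by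
  induction e with
  | zero => rfl
  | succ e ih => rw [tp]; simp [ih]
theorem tp_pre {m n : ℕ} (h : m ≤ n) : K.tp m <+: K.tp n := by
  induction n, h using Nat.le_induction with
  | base => exact List.prefix_rfl
  | succ n h ih => rw [tp]; exact ih.trans (List.prefix_append _ _)
theorem tp_false {e : ℕ} (h : ∀ n, ∃ s ≥ n, (K.tp e ++ [false]) <+: K.δ s) : K.tp (e+1) = K.tp e ++ [false] := by
  rw [tp]; congr 2; simpa using h
theorem tp_true {e : ℕ} (h : ¬ ∀ n, ∃ s ≥ n, (K.tp e ++ [false]) <+: K.δ s) : K.tp (e+1) = K.tp e ++ [true] := by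
  rw [tp]; congr 2; simpa using h
theorem tp_inf (e n : ℕ) : ∃ s ≥ n, K.tp e <+: K.δ s := by
  induction e generalizing n with
  | zero => exact ⟨n, le_rfl, ⟨_, List.nil_append _⟩⟩
  | succ e ih =>
    by_cases h : ∀ n, ∃ s ≥ n, (K.tp e ++ [false]) <+: K.δ s
    · rw [K.tp_false h]; exact h n
    · rw [K.tp_true h]
      push Not at h
      obtain ⟨m, hm⟩ := h
      obtain ⟨s, hs, h1⟩ := ih (n + m + e + 1)
      exact ⟨s, by omega, K.δ_true h1 (by rw [tp_len]; omega) (hm s (by omega))⟩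
theorem tp_left (e : ℕ) : ∃ n, ∀ s ≥ n, ¬ lft (K.δ s) (K.tp e) := by
  induction e with
  | zero => exact ⟨0, fun s _ h => by rw [lft_iff] at h; obtain ⟨z, _, h⟩ := h; simp [tp] at h⟩
  | succ e ih =>
    obtain ⟨n, hn⟩ := ih
    have key : ∀ s b, lft (K.δ s) (K.tp e ++ [b]) → lft (K.δ s) (K.tp e) ∨ (b = true ∧ (K.tp e ++ [false]) <+: K.δ s) := by
      intro s b h
      rw [lft_iff] at h
      obtain ⟨z, h1, h2⟩ := h
      rw [List.prefix_concat_iff] at h2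
      rcases h2 with h2 | h2
      · right
        have := List.append_inj' h2 rfl
        obtain ⟨rfl, h3⟩ := this
        exact ⟨by simpa using h3.symm, h1⟩
      · left; rw [lft_iff]; exact ⟨z, h1, h2⟩
    by_cases h : ∀ n, ∃ s ≥ n, (K.tp e ++ [false]) <+: K.δ s
    · rw [K.tp_false h]
      refine ⟨n, fun s hs hl => ?_⟩
      rcases key s _ hl with h | h
      · exact hn s hs h
      · simp at h
    · rw [K.tp_true h]
      push Not at h
      obtain ⟨m, hm⟩ := h
      refine ⟨n + m, fun s hs hl => ?_⟩
      rcases key s _ hl with h | h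
      · exact hn s (by omega) h
      · exact hm s (by omega) h.2

theorem take_of_tp {j s : ℕ} (h : K.tp j <+: K.δ s) : (K.δ s).take j = K.tp j := by
  have := List.prefix_iff_eq_take.1 h; rw [tp_len] at this; exact this.symm
theorem exists_wit (j : ℕ) : ∃ w n, w.unpair.1 = j ∧ ∀ s ≥ n, K.tp j <+: K.δ s → wit K.H (K.δ s) s j = w := by
  obtain ⟨n, hn⟩ := K.tp_left j
  refine ⟨Nat.pair j (Nat.pair (Encodable.encode (K.tp j)) (iniS K.H (K.tp j) n)), n, by simp, fun s hs h => ?_⟩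
  rw [wit, K.take_of_tp h]
  have : iniS K.H (K.tp j) s = iniS K.H (K.tp j) n := lastS_const (fun r hr => hn r hr) hs
  rw [this]
theorem quiet (j : ℕ) : ∃ n, ∀ s ≥ n, K.tp j <+: K.δ s → ∀ w, K.ev s = w + 1 → w.unpair.1 ≠ j := by
  obtain ⟨w0, n, h0, hw⟩ := K.exists_wit j
  by_cases hx : ∃ r, K.ev r = w0 + 1
  · obtain ⟨r, hr⟩ := hx
    refine ⟨n + r + 1, fun s hs h w hev hj => ?_⟩
    have h1 := (K.ev_spec hev).2.1
    rw [hj, hw s (by omega) h] at h1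
    subst h1
    exact K.ev_ne (show r < s by omega) hev hr
  · refine ⟨n, fun s hs h w hev hj => hx ⟨s, ?_⟩⟩
    have h1 := (K.ev_spec hev).2.1
    rw [hj, hw s (by omega) h] at h1
    rw [hev, h1]
theorem quiet_le (e : ℕ) : ∃ n, ∀ s ≥ n, ∀ j ≤ e, K.tp j <+: K.δ s → ∀ w, K.ev s = w + 1 → w.unpair.1 ≠ j := by
  choose n hn using K.quiet
  refine ⟨∑ j ∈ Finset.range (e+1), n j, fun s hs j hj => hn j s (le_trans ?_ hs)⟩
  exact Finset.single_le_sum (f := n) (fun _ _ => Nat.zero_le _) (by simp; omega)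

theorem diag (j : ℕ) : ∃ w, w.unpair.1 = j ∧ ((0 ∈ (Denumerable.ofNat Nat.Partrec.Code (j/2)).eval w) ↔ ∃ s, K.ev s = w + 1) := by
  obtain ⟨w, n, hj, hw⟩ := K.exists_wit j
  refine ⟨w, hj, ?_, ?_⟩
  · intro h0
    by_contra hx
    obtain ⟨k, hk⟩ := Nat.Partrec.Code.evaln_complete.1 h0
    obtain ⟨m, hm⟩ := K.quiet_le j
    obtain ⟨s, hs, h⟩ := K.tp_inf j (n + k + m + j + 1)
    have hws := hw s (by omega) h
    have hact : act K.H (K.δ s) s j := by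
      rw [act, hws]
      refine ⟨?_, ?_⟩
      · have := Nat.Partrec.Code.evaln_mono (show k ≤ s by omega) hk
        exact this
      · rintro ⟨r, _, hr⟩
        exact hx ⟨r, hr⟩
    obtain ⟨j', hj', hev⟩ := K.ev_of_act (by omega) hact
    refine hm s (by omega) j' hj' ((K.tp_pre hj').trans h) _ hev ?_
    rw [wit]; simp
  · rintro ⟨s, hs⟩
    obtain ⟨h1, h2, h3, h4⟩ := K.ev_spec hs
    rw [← h2, hj] at h3
    exact Nat.Partrec.Code.evaln_sound h3

/-! the two sets -/
noncomputable def A (i : ℕ) : ℕ → Bool := fun w => decide (side w = i ∧ ∃ s, K.ev s = w + 1)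
noncomputable def At (i t : ℕ) : ℕ → Bool := fun w => decide (side w = i ∧ bEx t (fun s => K.ev s = w + 1))
theorem cAt (i : ℕ) : Computable (fun p : ℕ × ℕ => K.At i p.1 p.2) := by
  have := K.comp
  unfold At side ev; fun_prop
theorem At_mono (i t w : ℕ) (h : K.At i t w = true) : K.At i (t+1) w = true := by
  simp only [At, decide_eq_true_eq] at *
  obtain ⟨h1, r, h2, h3⟩ := h
  exact ⟨h1, r, by omega, h3⟩
theorem A_iff (i w : ℕ) : K.A i w = true ↔ ∃ t, K.At i t w = true := by
  simp only [A, At, decide_eq_true_eq]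
  constructor
  · rintro ⟨h1, s, h2⟩; exact ⟨s+1, h1, s, by omega, h2⟩
  · rintro ⟨t, h1, s, _, h2⟩; exact ⟨h1, s, h2⟩
theorem ceA (i : ℕ) : CEReal (K.A i) := (cereal_of_ce (K.At i) (K.cAt i) (K.At_mono i) (K.A_iff i)).1
theorem ncA {i : ℕ} (hi : i < 2) : ¬ Computable (K.A i) := by
  intro h
  have hc : Computable (fun x => if K.A i x = true then 1 else 0) := by fun_prop
  obtain ⟨c, hc⟩ := Nat.Partrec.Code.exists_code.1 (Partrec.nat_iff.1 hc)
  obtain ⟨w, hw, h2⟩ := K.diag (2 * Encodable.encode c + i)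
  rw [show (2 * Encodable.encode c + i) / 2 = Encodable.encode c by omega, Denumerable.ofNat_encode, hc] at h2
  have hA : K.A i w = true ↔ ∃ s, K.ev s = w + 1 := by
    simp only [A, decide_eq_true_eq, side, hw, and_iff_right_iff_imp]
    intro _; omega
  rw [← hA] at h2
  by_cases hh : K.A i w = true
  · have := h2.2 hh; simp [hh] at this
  · exact hh (h2.1 (by simp [hh]))
theorem nlA {i : ℕ} (hi : i < 2) : ¬ SolovayLeastSeq (K.A i) := fun h =>
  K.ncA hi (computable_of_least (K.At i) (K.cAt i) (K.At_mono i) (K.A_iff i) h)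
theorem posA {i : ℕ} (hi : i < 2) : 0 < realOfSeq (K.A i) := by
  have h : ∃ x ≥ 0, K.A i x = true := by
    by_contra hc; push Not at hc
    exact K.ncA hi (computable_of_eventually (b := false) (N := 0) fun j hj => by simpa using hc j hj)
  have := real_lower_strict _ 0 h
  simpa [restrSeq] using this

def isE (i s : ℕ) : Prop := K.ev s ≠ 0 ∧ side (K.ev s - 1) = i
noncomputable def trm (i s : ℕ) : ℝ := if K.isE i s then (1/2) ^ K.ev s else 0
theorem trm_nonneg (i s : ℕ) : 0 ≤ K.trm i s := by unfold trm; split_ifs <;> positivity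
theorem RA_eq (i s : ℕ) : RA K.H i s = ∑ r ∈ Finset.range s, K.trm i r := by
  unfold RA trm isE ev; refine Finset.sum_congr rfl fun r _ => ?_; congr
theorem RA_mono (i : ℕ) : Monotone (RA K.H i) := by
  refine monotone_nat_of_le_succ fun n => ?_
  rw [RA_eq, RA_eq, Finset.sum_range_succ]
  linarith [K.trm_nonneg i n]
theorem RA_tendsto (i : ℕ) : Tendsto (RA K.H i) atTop (nhds (realOfSeq (K.A i))) := by
  have hsum := (summ_real (K.A i)).hasSum
  let m : {s // K.isE i s} → ℕ := fun s => K.ev s - 1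
  have hm : Function.Injective m := by
    rintro ⟨r, hr⟩ ⟨s, hs⟩ h
    have h1 : K.ev r - 1 = K.ev s - 1 := h
    have a := hr.1; have b := hs.1
    have h2 : K.ev r = K.ev s := by omega
    exact Subtype.ext (K.ev_inj a h2)
  have h1 := (hm.hasSum_iff (f := fun w => cond (K.A i w) ((2 : ℝ) ^ (w + 1))⁻¹ 0) (a := realOfSeq (K.A i)) (by
    intro w hw
    have : K.A i w = false := by
      by_contra hc
      simp only [A, Bool.not_eq_false, decide_eq_true_eq] at hc
      obtain ⟨h1, s, h2⟩ := hc
      exact hw ⟨⟨s, by omega, by rw [h2]; exact h1⟩, by simp [m, h2]⟩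
    simp [this])).2 hsum
  have h2 : HasSum (K.trm i) (realOfSeq (K.A i)) := by
    have e : K.trm i = Set.indicator {s | K.isE i s} (fun s => (1/2:ℝ) ^ K.ev s) := by
      funext s
      by_cases h : K.isE i s
      · rw [Set.indicator_of_mem (by exact h)]; simp [trm, h]
      · rw [Set.indicator_of_notMem (by exact h)]; simp [trm, h]
    rw [e, ← hasSum_subtype_iff_indicator]
    have e2 : ((fun s => (1/2:ℝ) ^ K.ev s) ∘ (Subtype.val : {s // K.isE i s} → ℕ)) = (fun w => cond (K.A i w) ((2 : ℝ) ^ (w + 1))⁻¹ 0) ∘ m := ?_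
    · exact e2 ▸ h1
    funext s
    obtain ⟨s, hs⟩ := s
    have : K.A i (K.ev s - 1) = true := by
      simp only [A, decide_eq_true_eq]
      exact ⟨hs.2, s, by have := hs.1; omega⟩
    simp only [Function.comp, m, this, cond_true]
    rw [Nat.sub_add_cancel (Nat.one_le_iff_ne_zero.2 hs.1)]
    simp
  have := h2.tendsto_sum_nat
  refine this.congr fun s => (K.RA_eq i s).symm
theorem RA_le (i s : ℕ) : RA K.H i s ≤ realOfSeq (K.A i) :=
  ge_of_tendsto (K.RA_tendsto i) (eventually_atTop.2 ⟨s, fun t ht => K.RA_mono i ht⟩)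
theorem sum_tail (i m : ℕ) (S : Finset ℕ) (h : ∀ s ∈ S, ∀ w, K.ev s = w + 1 → m ≤ w) : ∑ s ∈ S, K.trm i s ≤ (1/2) ^ m := by
  have hg : ∀ k, ∑ x ∈ Finset.range k, (1/2:ℝ) ^ (m + 1 + x) ≤ (1/2) ^ m := by
    intro k
    have : ∑ x ∈ Finset.range k, (1/2:ℝ) ^ (m + 1 + x) = (1/2) ^ m * ∑ x ∈ Finset.range k, (1/2:ℝ) ^ (x + 1) := by
      rw [Finset.mul_sum]; refine Finset.sum_congr rfl fun x _ => ?_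
      rw [← pow_add]; congr 1; omega
    rw [this]
    calc _ ≤ (1/2:ℝ) ^ m * 1 := mul_le_mul_of_nonneg_left (sum_half_le k) (by positivity)
      _ = _ := mul_one _
  unfold trm
  rw [← Finset.sum_filter]
  have hinj : ∀ r ∈ S.filter (fun s => K.isE i s), ∀ s ∈ S.filter (fun s => K.isE i s), K.ev r - (m+1) = K.ev s - (m+1) → r = s := by
    intro r hr s hs hrs
    rw [Finset.mem_filter] at hr hs
    have a := hr.2.1; have b := hs.2.1
    have a' := h r hr.1 (K.ev r - 1) (by omega)
    have b' := h s hs.1 (K.ev s - 1) (by omega)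
    exact K.ev_inj a (by omega)
  have hz : ∑ s ∈ S.filter (fun s => K.isE i s), (1/2:ℝ) ^ K.ev s = ∑ x ∈ (S.filter (fun s => K.isE i s)).image (fun s => K.ev s - (m+1)), (1/2:ℝ) ^ (m + 1 + x) := by
    rw [Finset.sum_image (by intro r hr s hs; exact hinj r hr s hs)]
    refine Finset.sum_congr rfl fun s hs => ?_
    rw [Finset.mem_filter] at hs
    have a := hs.2.1
    have a' := h s hs.1 (K.ev s - 1) (by omega)
    congr 1; omega
  rw [hz]
  obtain ⟨k, hk⟩ := ((S.filter (fun s => K.isE i s)).image (fun s => K.ev s - (m+1))).exists_nat_subset_range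
  exact (Finset.sum_le_sum_of_subset_of_nonneg hk fun _ _ _ => by positivity).trans (hg k)
end Con

namespace Con
variable (K : Con)

/-- between consecutive expansionary stages one side hardly changes -/
theorem one_side {e : ℕ} {n : ℕ} (hL : ∀ s ≥ n, ¬ lft (K.δ s) (K.tp (e+1)))
    (hQ : ∀ s ≥ n, ∀ j ≤ e, K.tp j <+: K.δ s → ∀ w, K.ev s = w + 1 → w.unpair.1 ≠ j)
    {σ σ' : ℕ} (hn : n ≤ σ) (hσ : σ < σ') (h1 : K.tp (e+1) <+: K.δ σ)
    (h2 : ∀ r, σ < r → r < σ' → ¬ K.tp (e+1) <+: K.δ r) :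
    ∃ i < 2, RA K.H i σ' ≤ RA K.H i σ + (1/2) ^ (σ+1) := by
  have hw : ∀ s ∈ Finset.Ico (σ+1) σ', ∀ w, K.ev s = w + 1 → σ + 1 ≤ w := by
    intro s hs w hev
    rw [Finset.mem_Ico] at hs
    have hns := h2 s (by omega) hs.2
    obtain ⟨hj, -, -⟩ := K.ev_spec hev
    set j := w.unpair.1 with hjd
    have hlen : ((K.δ s).take j).length = j := by rw [List.length_take, K.δ_len]; omega
    have hpre : (K.δ s).take j <+: K.δ s := ⟨_, List.take_append_drop _ _⟩
    rcases tricho ((K.δ s).take j) (K.tp (e+1)) with h | h | h | h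
    · exfalso
      have hje : j ≤ e + 1 := by have := h.length_le; rwa [hlen, K.tp_len] at this
      have heq : (K.δ s).take j = K.tp j := by
        have := List.prefix_of_prefix_length_le h (K.tp_pre hje) (by rw [hlen, K.tp_len])
        exact this.eq_of_length (by rw [hlen, K.tp_len])
      rw [heq] at hpre
      rcases Nat.lt_or_ge e j with hh | hh
      · have : j = e + 1 := by omega
        rw [this] at hpre; exact hns hpre
      · exact hQ s (by omega) j hh hpre w hev rfl
    · exact absurd (h.trans hpre) hns
    · exact absurd (lft_mono h hpre List.prefix_rfl) (hL s (by omega))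
    · have h3 : lft (K.δ σ) ((K.δ s).take j) := lft_mono h h1 List.prefix_rfl
      have h4 : σ < iniS K.H ((K.δ s).take j) s := lastS_gt (p := fun r => lft (K.H r).1 ((K.δ s).take j)) (by omega) h3
      exact lt_of_lt_of_le h4 (K.ev_iniS hev)
  have hi : ∃ i < 2, K.trm i σ = 0 := by
    by_cases h0 : side (K.ev σ - 1) = 0
    · refine ⟨1, by omega, ?_⟩
      have : ¬ K.isE 1 σ := by rintro ⟨_, h⟩; omega
      simp [trm, this]
    · refine ⟨0, by omega, ?_⟩
      have : ¬ K.isE 0 σ := by rintro ⟨_, h⟩; omega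
      simp [trm, this]
  obtain ⟨i, hi2, hi0⟩ := hi
  refine ⟨i, hi2, ?_⟩
  have h3 := K.sum_tail i (σ+1) _ hw
  have h4 := Finset.sum_Ico_eq_sub (K.trm i) hσ.le
  rw [Finset.sum_eq_sum_Ico_succ_bot hσ, hi0, zero_add] at h4
  rw [K.RA_eq, K.RA_eq]
  linarith

/-- data of a negative requirement -/
structure Neg (X : ℕ → Bool) (e : ℕ) where
  F : ℕ → ℕ → ℕ
  G : ℕ → ℕ → ℕ
  hφ : ∀ s t v, ec s e.unpair.2 t = Option.some v → ∀ i < 2, cmp i v = Nat.pair (F i t) (G i t)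
  conv : ∀ t, ∃ s0, ∀ s ≥ s0, (ec s e.unpair.2 t).isSome = true
  hF0 : Computable (F 0)
  mono : ∀ i < 2, Monotone (fun t => (F i t : ℝ) * (1/2) ^ t)
  limF : ∀ i < 2, Tendsto (fun t => (F i t : ℝ) * (1/2) ^ t) atTop (nhds (realOfSeq X))
  limG : ∀ i < 2, Tendsto (fun t => (G i t : ℝ) * (1/2) ^ t) atTop (nhds (realOfSeq (K.A i)))
  ineq : ∀ i < 2, ∀ t, realOfSeq X - (F i t : ℝ) * (1/2) ^ t ≤ (e.unpair.1 : ℝ) * (realOfSeq (K.A i) - (G i t : ℝ) * (1/2) ^ t)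
namespace Neg
variable {K} {X : ℕ → Bool} {e : ℕ} (N : Neg K X e)
noncomputable def f (i t : ℕ) : ℝ := (N.F i t : ℝ) * (1/2) ^ t
noncomputable def g (i t : ℕ) : ℝ := (N.G i t : ℝ) * (1/2) ^ t
theorem fv_eq {s t i : ℕ} (h : (ec s e.unpair.2 t).isSome = true) (hi : i < 2) : fv e s i t = N.f i t ∧ gv e s i t = N.g i t := by
  obtain ⟨v, hv⟩ := Option.isSome_iff_exists.1 h
  have := N.hφ s t v hv i hi
  unfold fv gv f g vv
  rw [hv, Option.getD_some, this]
  simp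
theorem f_le {i : ℕ} (hi : i < 2) (t : ℕ) : N.f i t ≤ realOfSeq X :=
  ge_of_tendsto (N.limF i hi) (eventually_atTop.2 ⟨t, fun _ hu => N.mono i hi hu⟩)
theorem AgT_iff {s r t : ℕ} (h : ∀ n ≤ t, (ec s e.unpair.2 n).isSome = true) : AgT K.H e s r t ↔
    ∀ i < 2, RA K.H i s < N.g i t + (1/2) ^ r ∧ (∀ i' < 2, N.f i t ≤ N.f i' t + (1/2) ^ r) ∧
      ∀ t1 ≤ t, N.f i t + (e.unpair.1 : ℝ) * N.g i t1 ≤ N.f i t1 + (e.unpair.1 : ℝ) * (RA K.H i s + (1/2) ^ r) := by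
  unfold AgT bAll
  constructor
  · rintro ⟨_, h2⟩ i hi
    obtain ⟨a, b, c⟩ := h2 i hi
    rw [(N.fv_eq (h t le_rfl) hi).2] at a
    refine ⟨a, fun i' hi' => ?_, fun t1 ht1 => ?_⟩
    · have := b i' hi'
      rwa [(N.fv_eq (h t le_rfl) hi).1, (N.fv_eq (h t le_rfl) hi').1] at this
    · have := c t1 (by omega)
      rwa [(N.fv_eq (h t le_rfl) hi).1, (N.fv_eq (h t1 ht1) hi).1, (N.fv_eq (h t1 ht1) hi).2] at this
  · intro h2
    refine ⟨fun n hn => h n (by omega), fun i hi => ?_⟩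
    obtain ⟨a, b, c⟩ := h2 i hi
    rw [(N.fv_eq (h t le_rfl) hi).2]
    refine ⟨a, fun i' hi' => ?_, fun t1 ht1 => ?_⟩
    · beta_reduce; rw [(N.fv_eq (h t le_rfl) hi).1, (N.fv_eq (h t le_rfl) hi').1]; exact b i' hi'
    · beta_reduce; rw [(N.fv_eq (h t le_rfl) hi).1, (N.fv_eq (h t1 (by omega)) hi).1, (N.fv_eq (h t1 (by omega)) hi).2]
      exact c t1 (by omega)
theorem AgT_imp {s r t : ℕ} (h : AgT K.H e s r t) : 
    ∀ i < 2, RA K.H i s < N.g i t + (1/2) ^ r ∧ (∀ i' < 2, N.f i t ≤ N.f i' t + (1/2) ^ r) ∧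
      ∀ t1 ≤ t, N.f i t + (e.unpair.1 : ℝ) * N.g i t1 ≤ N.f i t1 + (e.unpair.1 : ℝ) * (RA K.H i s + (1/2) ^ r) :=
  (N.AgT_iff (fun n hn => h.1 n (by omega))).1 h
theorem conv_le (N : Neg K X e) (t : ℕ) : ∃ s0, ∀ s ≥ s0, ∀ n ≤ t, (ec s e.unpair.2 n).isSome = true := by
  choose k hk using N.conv
  refine ⟨∑ j ∈ Finset.range (t+1), k j, fun s hs j hj => hk j s (le_trans ?_ hs)⟩
  exact Finset.single_le_sum (f := k) (fun _ _ => Nat.zero_le _) (by simp; omega)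

theorem agr_eventually (N : Neg K X e) (r : ℕ) : ∃ s0, ∀ s ≥ s0, Agr K.H e s r := by
  have hp : (0:ℝ) < (1/2) ^ r := by positivity
  have E : ∀ i < 2, ∀ᶠ t in atTop, realOfSeq (K.A i) - (1/2) ^ r < N.g i t ∧ realOfSeq X - (1/2) ^ r < N.f i t := fun i hi =>
    ((N.limG i hi).eventually (lt_mem_nhds (by linarith))).and ((N.limF i hi).eventually (lt_mem_nhds (by linarith)))
  obtain ⟨t, h0, h1⟩ := ((E 0 (by omega)).and (E 1 (by omega))).exists
  have ht : ∀ i < 2, realOfSeq (K.A i) - (1/2) ^ r < N.g i t ∧ realOfSeq X - (1/2) ^ r < N.f i t := by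
    intro i hi
    interval_cases i
    · exact h0
    · exact h1
  have E2 : ∀ i < 2, ∀ᶠ s in atTop, realOfSeq (K.A i) - (1/2) ^ r < RA K.H i s := fun i hi =>
    (K.RA_tendsto i).eventually (lt_mem_nhds (by linarith))
  obtain ⟨k, hk⟩ := N.conv_le t
  obtain ⟨m0, hm0⟩ := eventually_atTop.1 (E2 0 (by omega))
  obtain ⟨m1, hm1⟩ := eventually_atTop.1 (E2 1 (by omega))
  refine ⟨k + m0 + m1 + t, fun s hs => ⟨t, by omega, (N.AgT_iff (hk s (by omega))).2 fun i hi => ?_⟩⟩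
  have hR : realOfSeq (K.A i) - (1/2) ^ r < RA K.H i s := by
    interval_cases i
    · exact hm0 s (by omega)
    · exact hm1 s (by omega)
  refine ⟨?_, fun i' hi' => ?_, fun t1 _ => ?_⟩
  · have := K.RA_le i s
    have := (ht i hi).1
    linarith
  · have := (ht i' hi').2
    have := N.f_le hi t
    linarith
  · have a := N.ineq i hi t1
    have b := N.f_le hi t
    have c : (e.unpair.1 : ℝ) * realOfSeq (K.A i) ≤ (e.unpair.1 : ℝ) * (RA K.H i s + (1/2) ^ r) :=
      mul_le_mul_of_nonneg_left (by linarith) (by positivity)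
    rw [mul_sub] at a
    change realOfSeq X - N.f i t1 ≤ _ - _ * N.g i t1 at a
    linarith

theorem inf_exp (N : Neg K X e) : ∀ n, ∃ s ≥ n, (K.tp e ++ [false]) <+: K.δ s := by
  by_contra hc
  push Not at hc
  obtain ⟨n, hn⟩ := hc
  obtain ⟨s0, hs0⟩ := N.agr_eventually (last0 K.H (K.tp e) n)
  obtain ⟨s, hs, h⟩ := K.tp_inf e (n + s0 + e + 1)
  have h1 : last0 K.H (K.tp e) s = last0 K.H (K.tp e) n :=
    lastS_const (fun r hr => by rw [Pre_iff]; exact hn r hr) (by omega)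
  have h2 := hs0 s (by omega)
  rw [← h1] at h2
  have h3 := K.δ_ext h (by rw [K.tp_len]; omega)
  rw [K.tp_len] at h3
  simp only [h2, not_true_eq_false, decide_false] at h3
  exact hn s (by omega) h3

theorem cpL (K : Con) (τ : List Bool) : Computable (fun p : ℕ × ℕ => last0 K.H τ p.2.unpair.1) := by
  have h1 := K.comp
  unfold last0; fun_prop
theorem cpA (K : Con) (e : ℕ) : CP (fun p : ℕ × ℕ × ℕ => AgT K.H e p.1 p.2.1 p.2.2) := by
  have h1 := K.comp
  unfold AgT RA side; fun_prop
theorem cpA2 (K : Con) (e : ℕ) (L : ℕ × ℕ → ℕ) (hL : Computable L) : CP (fun p : ℕ × ℕ => AgT K.H e p.2.unpair.1 (L p) p.2.unpair.2) :=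
  CP.comp (g := fun p : ℕ × ℕ => (p.2.unpair.1, L p, p.2.unpair.2)) (cpA K e) (by fun_prop)
theorem cpQ (K : Con) (e n0 : ℕ) (τ τ' : List Bool) : CP (fun p : ℕ × ℕ => n0 ≤ p.2.unpair.1 ∧ Pre τ' (K.H p.2.unpair.1).1 ∧ p.1 ≤ last0 K.H τ p.2.unpair.1 ∧
      AgT K.H e p.2.unpair.1 (last0 K.H τ p.2.unpair.1) p.2.unpair.2) := by
  have h1 := K.comp
  have h2 := cpL K τ
  have h4 := cpA2 K e _ h2
  have h5 : CP (fun p : ℕ × ℕ => p.1 ≤ last0 K.H τ p.2.unpair.1) := CP.le (by fun_prop) h2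
  have h6 : CP (fun p : ℕ × ℕ => Pre τ' (K.H p.2.unpair.1).1) := by fun_prop
  have h7 : CP (fun p : ℕ × ℕ => n0 ≤ p.2.unpair.1) := by fun_prop
  exact CP.and h7 (CP.and h6 (CP.and h5 h4))

/-- the requirement is met -/
theorem least (N : Neg K X e) : SolovayLeastSeq X := by
  have hinf := N.inf_exp
  have htp := K.tp_false hinf
  obtain ⟨n1, hn1⟩ := K.tp_left (e+1)
  obtain ⟨n2, hn2⟩ := K.quiet_le e
  let n0 := n1 + n2
  let c : ℝ := e.unpair.1
  have hc : 0 ≤ c := by positivity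
  let R : ℕ → ℕ := fun s => last0 K.H (K.tp e) s
  let Ex : ℕ → Prop := fun s => K.tp (e+1) <+: K.δ s
  have hR : ∀ s, (R s = 0 ∧ ∀ r < s, ¬ Ex r) ∨ ∃ σ < s, R s = σ + 1 ∧ Ex σ ∧ ∀ r, σ < r → r < s → ¬ Ex r := by
    intro s
    have := lastS_spec (fun r => Pre (K.tp e ++ [false]) (K.H r).1) s
    have hP : ∀ r, Pre (K.tp e ++ [false]) (K.H r).1 ↔ Ex r := fun r => by rw [Pre_iff, ← htp]; rfl
    rcases this with ⟨h1, h2⟩ | ⟨σ, h1, h2, h3, h4⟩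
    · exact Or.inl ⟨h1, fun r hr hh => h2 r hr ((hP r).2 hh)⟩
    · exact Or.inr ⟨σ, h1, h2, (hP σ).1 h3, fun r hr hr' hh => h4 r hr hr' ((hP r).2 hh)⟩
  have hR_le : ∀ s, R s ≤ s := fun s => lastS_le _ _
  have hRgt : ∀ {r s}, r < s → Ex r → r < R s := by
    intro r s hrs hr
    rcases hR s with ⟨h1, h2⟩ | ⟨σ, h1, h2, h3, h4⟩
    · exact absurd hr (h2 r hrs)
    · by_contra hcc; exact h4 r (by omega) hrs hr
  have hval : ∀ s, Ex s → ∃ t, AgT K.H e s (R s) t := by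
    intro s hs
    have : (K.tp e ++ [false]) <+: K.δ s := by rw [← htp]; exact hs
    have := K.δ_false this
    rw [K.tp_len] at this
    obtain ⟨t, _, h⟩ := this
    exact ⟨t, h⟩
  -- one step
  have step : ∀ σ σ' t t', n0 ≤ σ → Ex σ → R σ' = σ + 1 → AgT K.H e σ (R σ) t → AgT K.H e σ' (R σ') t' →
      N.f 0 t' ≤ N.f 0 t + (3 * c + 2) * (1/2) ^ (R σ) := by
    intro σ σ' t t' hn hE hRσ hA hA'
    obtain ⟨hσ, hbet⟩ : σ < σ' ∧ ∀ r, σ < r → r < σ' → ¬ Ex r := by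
      rcases hR σ' with ⟨h1, h2⟩ | ⟨σ1, h1, h2, h3, h4⟩
      · omega
      · have : σ1 = σ := by omega
        subst this; exact ⟨h1, h4⟩
    obtain ⟨i, hi, hch⟩ := K.one_side (n := n0) (fun s hs => hn1 s (by omega)) (fun s hs => hn2 s (by omega)) hn hσ hE hbet
    have hpw : (1/2:ℝ) ^ (R σ') ≤ (1/2) ^ (R σ) :=
      pow_le_pow_of_le_one (by norm_num) (by norm_num) (by have := hR_le σ; omega)
    rw [← hRσ] at hch
    obtain ⟨a1, a2, a3⟩ := N.AgT_imp hA i hi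
    obtain ⟨b1, b2, b3⟩ := N.AgT_imp hA' i hi
    have hstep : N.f i t' ≤ N.f i t + 3 * c * (1/2) ^ (R σ) := by
      have hpos : (0:ℝ) ≤ 3 * c * (1/2) ^ (R σ) := by positivity
      rcases le_total t t' with h | h
      · have h1 := b3 t h
        have h2 : c * (RA K.H i σ' + (1/2) ^ (R σ')) ≤ c * (N.g i t + 3 * (1/2) ^ (R σ)) :=
          mul_le_mul_of_nonneg_left (by linarith) hc
        rw [mul_add c (N.g i t)] at h2
        change N.f i t' + c * _ ≤ _ + c * _ at h1
        linarith
      · have := N.mono i hi h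
        change N.f i t' ≤ N.f i t at this
        linarith
    have h1 := (N.AgT_imp hA' 0 (by omega)).2.1 i hi
    have h2 := a2 0 (by omega)
    have : (3 * c + 2) * (1/2:ℝ) ^ (R σ) = 3 * c * (1/2) ^ (R σ) + 2 * (1/2) ^ (R σ) := by ring
    linarith
  let C : ℝ := 2 * (3 * c + 2)
  have hC : 0 ≤ C := by positivity
  have step2 : ∀ σ σ' t t', n0 ≤ σ → Ex σ → R σ' = σ + 1 → AgT K.H e σ (R σ) t → AgT K.H e σ' (R σ') t' →
      N.f 0 t' + C * (1/2) ^ (R σ') ≤ N.f 0 t + C * (1/2) ^ (R σ) := by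
    intro σ σ' t t' hn hE hRσ hA hA'
    have h1 := step σ σ' t t' hn hE hRσ hA hA'
    have hpw : (1/2:ℝ) ^ (R σ') ≤ (1/2) ^ (R σ + 1) :=
      pow_le_pow_of_le_one (by norm_num) (by norm_num) (by have := hR_le σ; omega)
    have h2 := mul_le_mul_of_nonneg_left hpw hC
    have : C * (1/2:ℝ) ^ (R σ + 1) = (3 * c + 2) * (1/2) ^ (R σ) := by simp only [C]; ring
    have : C * (1/2:ℝ) ^ (R σ) = (3 * c + 2) * (1/2) ^ (R σ) + (3 * c + 2) * (1/2) ^ (R σ) := by simp only [C]; ring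
    linarith
  have pot : ∀ σ t, n0 ≤ σ → Ex σ → AgT K.H e σ (R σ) t → ∀ σ', σ < σ' → Ex σ' → ∀ t', AgT K.H e σ' (R σ') t' →
      N.f 0 t' + C * (1/2) ^ (R σ') ≤ N.f 0 t + C * (1/2) ^ (R σ) := by
    intro σ t hn hE hA σ'
    induction σ' using Nat.strong_induction_on with
    | _ σ' ih =>
      intro hσ hE' t' hA'
      have hlt := hRgt hσ hE
      rcases hR σ' with ⟨h1, h2⟩ | ⟨σ1, h1, h2, h3, h4⟩
      · omega
      · rcases Nat.lt_or_ge σ σ1 with hh | hh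
        · obtain ⟨t1, ht1⟩ := hval σ1 h3
          exact (step2 σ1 σ' t1 t' (by omega) h3 h2 ht1 hA').trans (ih σ1 h1 hh h3 t1 ht1)
        · have : σ1 = σ := by omega
          subst this
          exact step2 σ1 σ' t t' hn hE h2 hA hA'
  have bound : ∀ σ t, n0 ≤ σ → Ex σ → AgT K.H e σ (R σ) t → realOfSeq X ≤ N.f 0 t + C * (1/2) ^ (R σ) := by
    intro σ t hn hE hA
    have hlim : Tendsto (fun M => N.f 0 t + C * (1/2) ^ (R σ) + c * (realOfSeq (K.A 0) - RA K.H 0 M + (1/2) ^ M)) atTop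
        (nhds (N.f 0 t + C * (1/2) ^ (R σ) + c * (realOfSeq (K.A 0) - realOfSeq (K.A 0) + 0))) := by
      refine Tendsto.const_add _ (Tendsto.const_mul _ (Tendsto.add ((K.RA_tendsto 0).const_sub _) ?_))
      exact tendsto_pow_atTop_nhds_zero_of_lt_one (by norm_num) (by norm_num)
    have := ge_of_tendsto hlim (b := realOfSeq X) (eventually_atTop.2 ⟨0, fun M _ => ?_⟩)
    · simpa using this
    · obtain ⟨s1, hs1, h1⟩ := hinf (M + σ + 1)
      obtain ⟨s2, hs2, h2⟩ := hinf (s1 + 1)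
      rw [← htp] at h1 h2
      obtain ⟨t2, ht2⟩ := hval s2 h2
      have hr := hRgt (show s1 < s2 by omega) h1
      have p1 := pot σ t hn hE hA s2 (by omega) h2 t2 ht2
      have p2 := N.ineq 0 (by omega) t2
      change realOfSeq X - N.f 0 t2 ≤ c * (_ - N.g 0 t2) at p2
      have p3 := (N.AgT_imp ht2 0 (by omega)).1
      have p4 := K.RA_mono 0 (show M ≤ s2 by omega)
      have p5 : (1/2:ℝ) ^ (R s2) ≤ (1/2) ^ M := pow_le_pow_of_le_one (by norm_num) (by norm_num) (by omega)
      have p6 : c * (realOfSeq (K.A 0) - N.g 0 t2) ≤ c * (realOfSeq (K.A 0) - RA K.H 0 M + (1/2) ^ M) :=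
        mul_le_mul_of_nonneg_left (by linarith) hc
      have p7 : 0 ≤ C * (1/2:ℝ) ^ (R s2) := by positivity
      linarith
  let Q : ℕ → ℕ → Prop := fun s m => n0 ≤ m.unpair.1 ∧ Pre (K.tp (e+1)) (K.H m.unpair.1).1 ∧ s ≤ last0 K.H (K.tp e) m.unpair.1 ∧
    AgT K.H e m.unpair.1 (last0 K.H (K.tp e) m.unpair.1) m.unpair.2
  have hQ : CP (fun p : ℕ × ℕ => Q p.1 p.2) := by
    exact cpQ K e n0 (K.tp e) (K.tp (e+1))
  obtain ⟨m, hm, hmQ⟩ := csearch hQ (by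
    intro s
    obtain ⟨s1, hs1, h1⟩ := hinf (s + n0)
    obtain ⟨s2, hs2, h2⟩ := hinf (s1 + 1)
    rw [← htp] at h1 h2
    obtain ⟨t2, ht2⟩ := hval s2 h2
    refine ⟨Nat.pair s2 t2, ?_⟩
    simp only [Q, Nat.unpair_pair, Pre_iff]
    have hr : s1 < last0 K.H (K.tp e) s2 := hRgt (show s1 < s2 by omega) h1
    exact ⟨by omega, h2, by omega, ht2⟩)
  have ediv : ∀ t, (N.F 0 t : ℝ) / 2 ^ t = N.f 0 t := fun t => by simp [f, div_eq_mul_inv]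
  refine least_of_modulus (N.F 0) N.hF0 ?_ ?_ (fun s => (m s).unpair.2) (by fun_prop) (2 * (3 * e.unpair.1 + 2)) ?_
  · simp only [ediv]; exact N.mono 0 (by omega)
  · simp only [ediv]; exact N.limF 0 (by omega)
  · intro s
    simp only [ediv]
    obtain ⟨q1, q2, q3, q4⟩ := hmQ s
    have b := bound _ _ q1 (Pre_iff.1 q2) q4
    have p5 : (1/2:ℝ) ^ (R (m s).unpair.1) ≤ (1/2) ^ s := pow_le_pow_of_le_one (by norm_num) (by norm_num) q3
    have p6 := mul_le_mul_of_nonneg_left p5 hC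
    have e1 : ((2 * (3 * e.unpair.1 + 2) : ℕ) : ℝ) / 2 ^ s = C * (1/2) ^ s := by
      simp only [C, c]; push_cast; simp [div_eq_mul_inv]
    rw [e1]; linarith
end Neg

theorem minimal {X : ℕ → Bool} (h0 : SolovayLe X (K.A 0)) (h1 : SolovayLe X (K.A 1)) : SolovayLeastSeq X := by
  obtain ⟨c0, f0, g0, hf0, hg0, mf0, mg0, lf0, lg0, i0⟩ := solovay_nf h0 (K.posA (by omega))
  obtain ⟨c1, f1, g1, hf1, hg1, mf1, mg1, lf1, lg1, i1⟩ := solovay_nf h1 (K.posA (by omega))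
  have l0 : ∀ s, (g0 s : ℝ) / 2 ^ s ≤ realOfSeq (K.A 0) := fun s => ge_of_tendsto lg0 (eventually_atTop.2 ⟨s, fun _ hu => mg0 hu⟩)
  have l1 : ∀ s, (g1 s : ℝ) / 2 ^ s ≤ realOfSeq (K.A 1) := fun s => ge_of_tendsto lg1 (eventually_atTop.2 ⟨s, fun _ hu => mg1 hu⟩)
  have hc : Computable (fun t => Nat.pair (Nat.pair (f0 t) (g0 t)) (Nat.pair (f1 t) (g1 t))) := by fun_prop
  obtain ⟨p, hp⟩ := Nat.Partrec.Code.exists_code.1 (Partrec.nat_iff.1 hc)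
  have hdiv : ∀ (a : ℕ) (t : ℕ), (a : ℝ) * (1/2) ^ t = a / 2 ^ t := fun a t => by simp [div_eq_mul_inv]
  have hev : ∀ t, Nat.pair (Nat.pair (f0 t) (g0 t)) (Nat.pair (f1 t) (g1 t)) ∈ p.eval t := by
    intro t; rw [hp]; simp
  have N : Neg K X (Nat.pair (c0 + c1) (Encodable.encode p)) := {
    F := fun i => if i = 0 then f0 else f1
    G := fun i => if i = 0 then g0 else g1
    hφ := by
      intro s t v h i hi
      simp only [ec, Nat.unpair_pair, Denumerable.ofNat_encode] at h
      have h2 := Nat.Partrec.Code.evaln_sound h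
      have h3 := Part.mem_unique h2 (hev t)
      rw [h3]
      interval_cases i <;> simp [cmp]
    conv := by
      intro t
      obtain ⟨k, hk⟩ := Nat.Partrec.Code.evaln_complete.1 (hev t)
      refine ⟨k, fun s hs => ?_⟩
      have h4 := Nat.Partrec.Code.evaln_mono hs hk
      simp only [ec, Nat.unpair_pair, Denumerable.ofNat_encode]
      rw [Option.mem_def.1 h4]; rfl
    hF0 := hf0
    mono := by
      intro i hi
      simp only [hdiv]
      interval_cases i
      · exact mf0
      · exact mf1
    limF := by
      intro i hi
      simp only [hdiv]
      interval_cases i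
      · exact lf0
      · exact lf1
    limG := by
      intro i hi
      simp only [hdiv]
      interval_cases i
      · exact lg0
      · exact lg1
    ineq := by
      intro i hi t
      simp only [hdiv, Nat.unpair_pair]
      interval_cases i
      · have a := i0 t
        have b := mul_nonneg (Nat.cast_nonneg (α := ℝ) c1) (sub_nonneg.2 (l0 t))
        push_cast
        linarith
      · have a := i1 t
        have b := mul_nonneg (Nat.cast_nonneg (α := ℝ) c0) (sub_nonneg.2 (l1 t))
        push_cast
        linarith }
  exact N.least
end Con

theorem part1 : ∃ A D : ℕ → Bool, CEReal A ∧ CEReal D ∧ ¬ SolovayLeastSeq A ∧ ¬ SolovayLeastSeq D ∧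
        ∀ X : ℕ → Bool, CEReal X → SolovayLe X A → SolovayLe X D → SolovayLeastSeq X := by
  obtain ⟨H, hc, he⟩ := exists_H
  let K : Con := ⟨H, hc, he⟩
  exact ⟨K.A 0, K.A 1, K.ceA 0, K.ceA 1, K.nlA (by omega), K.nlA (by omega), fun X _ h0 h1 => K.minimal h0 h1⟩

/-- The Solovay degrees of c.e. reals and the `K`-degrees of c.e. reals
are not elementarily equivalent: the former contain a minimal pair, the latter do not. -/
theorem stmt7 (U : Str →. Str) (hU : OptimalPF U) :
    (∃ A D : ℕ → Bool, CEReal A ∧ CEReal D ∧ ¬ SolovayLeastSeq A ∧ ¬ SolovayLeastSeq D ∧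
        ∀ X : ℕ → Bool, CEReal X → SolovayLe X A → SolovayLe X D → SolovayLeastSeq X) ∧
    ¬ (∃ A D : ℕ → Bool, CEReal A ∧ CEReal D ∧ ¬ KTrivialSeq U A ∧ ¬ KTrivialSeq U D ∧
        ∀ X : ℕ → Bool, CEReal X → KLeSeq U X A → KLeSeq U X D → KTrivialSeq U X) := by
  exact ⟨part1, part2 hU⟩

end KPaper
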